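/- (Existence for the Dirichlet problem) Let ψ be continuous on ∂_bK₁. Then there exists a unique function η, continuous on K̄₁, which is a viscosity solution of the linearized oblique problem on K₁⁺ and satisfies η = ψ on ∂_bK₁. -/

import Mathlib

open Set MeasureTheory Metric
open scoped RealInnerProductSpace

noncomputable section

abbrev Eucl (n : ℕ) : Type := EuclideanSpace ℝ (Fin n)
abbrev SpaceTime (n : ℕ) : Type := Eucl n × ℝ

/-- The operator norm of an `n × n` real matrix, acting on Euclidean space. -/
noncomputable def matOpNorm {n : ℕ} (A : Matrix (Fin n) (Fin n) ℝ) : ℝ :=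
  ‖(LinearMap.toContinuousLinearMap (Matrix.toEuclideanLin A))‖

/-- `F` is uniformly elliptic with ellipticity constant `Λ`. -/
def UniformlyElliptic {n : ℕ} (Λ : ℝ) (F : Matrix (Fin n) (Fin n) ℝ → ℝ) : Prop :=
  ∀ M N : Matrix (Fin n) (Fin n) ℝ, M.IsSymm → N.IsSymm → N.PosSemidef →
    Λ⁻¹ * matOpNorm N ≤ F (M + N) - F M ∧ F (M + N) - F M ≤ Λ * matOpNorm N

/-- Pucci minimal operator `P⁻(R, a, b) = a ∑_{eᵢ>0} eᵢ + b ∑_{eᵢ<0} eᵢ`. -/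
noncomputable def pucciMinus {n : ℕ} (R : Matrix (Fin n) (Fin n) ℝ) (a b : ℝ) : ℝ :=
  if h : R.IsHermitian then
    a * ∑ i, max (h.eigenvalues i) 0 + b * ∑ i, min (h.eigenvalues i) 0
  else 0

/-- Pucci maximal operator `P⁺(R, a, b) = a ∑_{eᵢ<0} eᵢ + b ∑_{eᵢ>0} eᵢ`. -/
noncomputable def pucciPlus {n : ℕ} (R : Matrix (Fin n) (Fin n) ℝ) (a b : ℝ) : ℝ :=
  if h : R.IsHermitian then
    a * ∑ i, min (h.eigenvalues i) 0 + b * ∑ i, max (h.eigenvalues i) 0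
  else 0

/-- Parabolic cylinder `E_ρ(x₀,t₀) = B_ρ(x₀) × (t₀ − ρ², t₀]`. -/
def cylE {n : ℕ} (x₀ : Eucl n) (t₀ ρ : ℝ) : Set (SpaceTime n) :=
  (ball x₀ ρ) ×ˢ (Ioc (t₀ - ρ ^ 2) t₀)

/-- `φ` is C² in `x` and C¹ in `t` on `D`, with time derivative `φt`,
spatial gradient `gφ` and spatial Hessian `Hφ`. -/
structure ParabolicTest {n : ℕ} (φ : SpaceTime n → ℝ) (D : Set (SpaceTime n))
    (φt : SpaceTime n → ℝ) (gφ : SpaceTime n → Eucl n)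
    (Hφ : SpaceTime n → Matrix (Fin n) (Fin n) ℝ) : Prop where
  contPhi : ContinuousOn φ D
  contPhit : ContinuousOn φt D
  contGrad : ContinuousOn gφ D
  contHess : ContinuousOn Hφ D
  symmHess : ∀ p ∈ D, (Hφ p).IsSymm
  timeDeriv : ∀ p ∈ D, HasDerivWithinAt (fun s : ℝ => φ (p.1, s)) (φt p) {s : ℝ | (p.1, s) ∈ D} p.2
  spaceGrad : ∀ p ∈ D, HasGradientWithinAt (fun y => φ (y, p.2)) (gφ p) {y | (y, p.2) ∈ D} p.1
  spaceHess : ∀ p ∈ D, HasFDerivWithinAt (fun y => gφ (y, p.2))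
      (LinearMap.toContinuousLinearMap (Matrix.toEuclideanLin (Hφ p))) {y | (y, p.2) ∈ D} p.1

/-- `φ` touches `u` from above at `p₀` in the set `E`. -/
def TouchesAbove {n : ℕ} (φ u : SpaceTime n → ℝ) (E : Set (SpaceTime n)) (p₀ : SpaceTime n) :
    Prop :=
  p₀ ∈ E ∧ φ p₀ = u p₀ ∧ ∀ p ∈ E, u p ≤ φ p

/-- `φ` touches `u` from below at `p₀` in the set `E`. -/
def TouchesBelow {n : ℕ} (φ u : SpaceTime n → ℝ) (E : Set (SpaceTime n)) (p₀ : SpaceTime n) :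
    Prop :=
  p₀ ∈ E ∧ φ p₀ = u p₀ ∧ ∀ p ∈ E, φ p ≤ u p

/-- `u` is a viscosity subsolution of `u_t = F(D²u)` in `D`. -/
def ViscSub {n : ℕ} (F : Matrix (Fin n) (Fin n) ℝ → ℝ) (u : SpaceTime n → ℝ)
    (D : Set (SpaceTime n)) : Prop :=
  ∀ (φ φt : SpaceTime n → ℝ) (gφ : SpaceTime n → Eucl n)
    (Hφ : SpaceTime n → Matrix (Fin n) (Fin n) ℝ) (p₀ : SpaceTime n) (ρ : ℝ),
    0 < ρ → p₀ ∈ D → cylE p₀.1 p₀.2 ρ ⊆ D →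
    ParabolicTest φ (cylE p₀.1 p₀.2 ρ) φt gφ Hφ →
    TouchesAbove φ u (cylE p₀.1 p₀.2 ρ) p₀ →
    φt p₀ ≤ F (Hφ p₀)

/-- `u` is a viscosity supersolution of `u_t = F(D²u)` in `D`. -/
def ViscSup {n : ℕ} (F : Matrix (Fin n) (Fin n) ℝ → ℝ) (u : SpaceTime n → ℝ)
    (D : Set (SpaceTime n)) : Prop :=
  ∀ (φ φt : SpaceTime n → ℝ) (gφ : SpaceTime n → Eucl n)
    (Hφ : SpaceTime n → Matrix (Fin n) (Fin n) ℝ) (p₀ : SpaceTime n) (ρ : ℝ),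
    0 < ρ → p₀ ∈ D → cylE p₀.1 p₀.2 ρ ⊆ D →
    ParabolicTest φ (cylE p₀.1 p₀.2 ρ) φt gφ Hφ →
    TouchesBelow φ u (cylE p₀.1 p₀.2 ρ) p₀ →
    F (Hφ p₀) ≤ φt p₀

end

/-- The last ("vertical") coordinate `xₙ` of a point in `ℝⁿ = ℝ^{d+1}`. -/
def lastC {d : ℕ} (x : Eucl (d + 1)) : ℝ := x (Fin.last d)

/-- `K_r = (B_r ∩ {xₙ > 0}) × (−r, 0]`. -/
def Kc (d : ℕ) (r : ℝ) : Set (SpaceTime (d + 1)) :=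
  {p | p.1 ∈ ball 0 r ∧ 0 < lastC p.1 ∧ p.2 ∈ Ioc (-r) 0}

/-- `F_r = (B_r ∩ {xₙ = 0}) × (−r, 0]`. -/
def Fc (d : ℕ) (r : ℝ) : Set (SpaceTime (d + 1)) :=
  {p | p.1 ∈ ball 0 r ∧ lastC p.1 = 0 ∧ p.2 ∈ Ioc (-r) 0}

/-- `K_r⁺ = K_r ∪ F_r`. -/
def KcP (d : ℕ) (r : ℝ) : Set (SpaceTime (d + 1)) := Kc d r ∪ Fc d r

/-- The Dirichlet part `∂_b K₁` of the boundary of `K₁`: the part of the topological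
boundary not contained in `F₁ ∪ ((B₁ ∩ {xₙ>0}) × {0})`. -/
def bdryK (d : ℕ) : Set (SpaceTime (d + 1)) :=
  frontier (Kc d 1) \
    (Fc d 1 ∪ {p | p.1 ∈ ball 0 1 ∧ 0 < lastC p.1 ∧ p.2 = 0})

/-- Coefficient data for the linearized oblique problem: `Q` is symmetric, uniformly
elliptic, differentiable (entrywise, with derivative `Q'`) with `‖Q'‖ ≤ C₀/λ`, and the
oblique vector `v` is differentiable with `vₙ ≥ M⁻¹`, `|v| ≤ M`, `|v'| ≤ λ⁻¹`. -/
structure ObliqueData (d : ℕ) (lam Λ M C₀ : ℝ)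
    (Q Q' : ℝ → Matrix (Fin (d + 1)) (Fin (d + 1)) ℝ)
    (v v' : ℝ → Eucl (d + 1)) : Prop where
  lam_pos : 0 < lam
  lam_le_one : lam ≤ 1
  Lam_ge_one : 1 ≤ Λ
  M_ge_one : 1 ≤ M
  C0_pos : 0 < C₀
  Qsymm : ∀ t ∈ Icc (-1 : ℝ) 0, (Q t).IsSymm
  Qlower : ∀ t ∈ Icc (-1 : ℝ) 0,
    (Q t - (Λ * M ^ 2)⁻¹ • (1 : Matrix (Fin (d + 1)) (Fin (d + 1)) ℝ)).PosSemidef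
  Qupper : ∀ t ∈ Icc (-1 : ℝ) 0,
    ((Λ * M ^ 2) • (1 : Matrix (Fin (d + 1)) (Fin (d + 1)) ℝ) - Q t).PosSemidef
  Qderiv : ∀ t ∈ Icc (-1 : ℝ) 0, ∀ i j,
    HasDerivWithinAt (fun s => Q s i j) (Q' t i j) (Icc (-1 : ℝ) 0) t
  Qderiv_bound : ∀ t ∈ Icc (-1 : ℝ) 0, matOpNorm (Q' t) ≤ C₀ / lam
  vderiv : ∀ t ∈ Icc (-1 : ℝ) 0, HasDerivWithinAt v (v' t) (Icc (-1 : ℝ) 0) t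
  vlast : ∀ t ∈ Icc (-1 : ℝ) 0, M⁻¹ ≤ lastC (v t)
  vbound : ∀ t ∈ Icc (-1 : ℝ) 0, ‖v t‖ ≤ M
  vderiv_bound : ∀ t ∈ Icc (-1 : ℝ) 0, ‖v' t‖ ≤ lam⁻¹

/-- `η` is a viscosity subsolution of the linearized oblique problem
`λ η_t = tr(Q(t) D²η)` in `K₁`, `η_t = v(t)·∇η` on `F₁`. -/
def ObliqueSub (d : ℕ) (lam : ℝ) (Q : ℝ → Matrix (Fin (d + 1)) (Fin (d + 1)) ℝ)
    (v : ℝ → Eucl (d + 1)) (η : SpaceTime (d + 1) → ℝ) : Prop :=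
  ContinuousOn η (KcP d 1) ∧
  ∀ (φ φt : SpaceTime (d + 1) → ℝ) (gφ : SpaceTime (d + 1) → Eucl (d + 1))
    (Hφ : SpaceTime (d + 1) → Matrix (Fin (d + 1)) (Fin (d + 1)) ℝ)
    (p₀ : SpaceTime (d + 1)) (ρ : ℝ),
    0 < ρ →
    ParabolicTest φ (cylE p₀.1 p₀.2 ρ ∩ closure (Kc d 1)) φt gφ Hφ →
    TouchesAbove φ η (cylE p₀.1 p₀.2 ρ ∩ closure (Kc d 1)) p₀ →
    (p₀ ∈ Kc d 1 → lam * φt p₀ ≤ (Q p₀.2 * Hφ p₀).trace) ∧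
    (p₀ ∈ Fc d 1 → φt p₀ ≤ ⟪v p₀.2, gφ p₀⟫)

/-- `η` is a viscosity supersolution of the linearized oblique problem. -/
def ObliqueSup (d : ℕ) (lam : ℝ) (Q : ℝ → Matrix (Fin (d + 1)) (Fin (d + 1)) ℝ)
    (v : ℝ → Eucl (d + 1)) (η : SpaceTime (d + 1) → ℝ) : Prop :=
  ContinuousOn η (KcP d 1) ∧
  ∀ (φ φt : SpaceTime (d + 1) → ℝ) (gφ : SpaceTime (d + 1) → Eucl (d + 1))
    (Hφ : SpaceTime (d + 1) → Matrix (Fin (d + 1)) (Fin (d + 1)) ℝ)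
    (p₀ : SpaceTime (d + 1)) (ρ : ℝ),
    0 < ρ →
    ParabolicTest φ (cylE p₀.1 p₀.2 ρ ∩ closure (Kc d 1)) φt gφ Hφ →
    TouchesBelow φ η (cylE p₀.1 p₀.2 ρ ∩ closure (Kc d 1)) p₀ →
    (p₀ ∈ Kc d 1 → (Q p₀.2 * Hφ p₀).trace ≤ lam * φt p₀) ∧
    (p₀ ∈ Fc d 1 → ⟪v p₀.2, gφ p₀⟫ ≤ φt p₀)

/-- `η` is a viscosity solution of the linearized oblique problem on `K₁⁺`. -/
def ObliqueSolution (d : ℕ) (lam : ℝ) (Q : ℝ → Matrix (Fin (d + 1)) (Fin (d + 1)) ℝ)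
    (v : ℝ → Eucl (d + 1)) (η : SpaceTime (d + 1) → ℝ) : Prop :=
  ObliqueSub d lam Q v η ∧ ObliqueSup d lam Q v η

/-- The distance `|x' − y'|` between the horizontal projections. -/
noncomputable def primeDist {d : ℕ} (x y : Eucl (d + 1)) : ℝ :=
  Real.sqrt (∑ i : Fin d, (x i.castSucc - y i.castSucc) ^ 2)

/-- The boundary-adapted parabolic distance `d(·,·)`. -/
noncomputable def pdist {d : ℕ} (P₁ P₂ : SpaceTime (d + 1)) : ℝ :=
  primeDist P₁.1 P₂.1 +
    min (|lastC P₁.1| + |lastC P₂.1| + |P₁.2 - P₂.2|)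
      (|lastC P₁.1 - lastC P₂.1| + Real.sqrt |P₁.2 - P₂.2|)

/-- The rescaled distance `d_λ(P₁,P₂) = λ⁻¹ d(λP₁, λP₂)`. -/
noncomputable def pdistL {d : ℕ} (lam : ℝ) (P₁ P₂ : SpaceTime (d + 1)) : ℝ :=
  lam⁻¹ * pdist (lam • P₁.1, lam * P₁.2) (lam • P₂.1, lam * P₂.2)

open Set MeasureTheory Metric
open scoped RealInnerProductSpace
namespace Obl
open Filter Topology Asymptotics
noncomputable section
set_option linter.unusedSectionVars false
set_option linter.deprecated false
set_option linter.unusedSimpArgs false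
section Jets
variable {Z : Type*} [NormedAddCommGroup Z] [NormedSpace ℝ Z]
def NN (z w : Z × ℝ) : ℝ := |w.2 - z.2| + ‖w.1 - z.1‖ ^ 2
def pol (z : Z × ℝ) (a : ℝ) (p : Z →L[ℝ] ℝ) (X : Z →L[ℝ] Z →L[ℝ] ℝ) (w : Z × ℝ) : ℝ :=
  a * (w.2 - z.2) + p (w.1 - z.1) + 1 / 2 * X (w.1 - z.1) (w.1 - z.1)
def past (z : Z × ℝ) : Set (Z × ℝ) := {w | w.2 ≤ z.2}
def JetW (s : Set (Z × ℝ)) (φ : Z × ℝ → ℝ) (z : Z × ℝ) (a : ℝ) (p : Z →L[ℝ] ℝ)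
    (X : Z →L[ℝ] Z →L[ℝ] ℝ) : Prop :=
  (fun w => φ w - φ z - pol z a p X w) =o[𝓝[s] z] (fun w => NN z w)
def SJ (D : Set (Z × ℝ)) (u : Z × ℝ → ℝ) (z : Z × ℝ) (a : ℝ) (p : Z →L[ℝ] ℝ)
    (X : Z →L[ℝ] Z →L[ℝ] ℝ) : Prop :=
  ∀ ε > 0, ∀ᶠ w in 𝓝[D ∩ past z] z, u w ≤ u z + pol z a p X w + ε * NN z w
lemma NN_nonneg (z w : Z × ℝ) : 0 ≤ NN z w := by unfold NN; positivity
lemma NN_cont (z : Z × ℝ) : Continuous (fun w => NN z w) := by unfold NN; fun_prop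
variable {s : Set (Z × ℝ)} {φ ψ : Z × ℝ → ℝ} {z : Z × ℝ} {a b : ℝ} {p q : Z →L[ℝ] ℝ}
  {X Y : Z →L[ℝ] Z →L[ℝ] ℝ}
lemma JetW.mono {s' : Set (Z × ℝ)} (h : JetW s φ z a p X) (hs : s' ⊆ s) : JetW s' φ z a p X :=
  IsLittleO.mono h (nhdsWithin_mono _ hs)
lemma JetW.add (h : JetW s φ z a p X) (h' : JetW s ψ z b q Y) :
    JetW s (fun w => φ w + ψ w) z (a + b) (p + q) (X + Y) := by
  refine (IsLittleO.add h h').congr_left fun w => ?_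
  simp [pol]; ring
lemma JetW.smul (h : JetW s φ z a p X) (c : ℝ) :
    JetW s (fun w => c * φ w) z (c * a) (c • p) (c • X) := by
  refine (IsLittleO.const_mul_left h c).congr_left fun w => ?_
  simp [pol]; ring
lemma JetW.neg (h : JetW s φ z a p X) : JetW s (fun w => - φ w) z (-a) (-p) (-X) := by
  refine (IsLittleO.neg_left h).congr_left fun w => ?_
  simp [pol]; ring
lemma JetW.sub (h : JetW s φ z a p X) (h' : JetW s ψ z b q Y) :
    JetW s (fun w => φ w - ψ w) z (a - b) (p - q) (X - Y) := by
  refine (IsLittleO.sub h h').congr_left fun w => ?_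
  simp [pol]; ring
lemma JetW.const (c : ℝ) : JetW s (fun _ => c) z 0 0 0 := by
  refine (isLittleO_zero _ _).congr_left fun w => ?_
  simp [pol]
lemma JetW.add_const (h : JetW s φ z a p X) (c : ℝ) : JetW s (fun w => φ w + c) z a p X := by
  refine IsLittleO.congr_left h fun w => ?_
  ring
lemma JetW.congr (h : JetW s φ z a p X) (hz : ψ z = φ z) (he : ψ =ᶠ[𝓝[s] z] φ) :
    JetW s ψ z a p X := by
  refine IsLittleO.congr' h ?_ EventuallyEq.rfl
  filter_upwards [he] with w hw
  simp [hw, hz]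
lemma JetW.time {g : ℝ → ℝ} {g' : ℝ} (h : HasDerivAt g g' z.2) :
    JetW s (fun w : Z × ℝ => g w.2) z g' 0 0 := by
  have h1 : (fun w : Z × ℝ => g w.2 - g z.2 - (w.2 - z.2) * g') =o[𝓝[s] z]
      fun w => w.2 - z.2 := by
    have h0 := (hasDerivAt_iff_isLittleO.1 h)
    have ht : Tendsto (fun w : Z × ℝ => w.2) (𝓝[s] z) (𝓝 z.2) :=
      continuous_snd.continuousAt.mono_left nhdsWithin_le_nhds
    simpa [Function.comp_def] using h0.comp_tendsto ht
  have h2 : (fun w : Z × ℝ => w.2 - z.2) =O[𝓝[s] z] fun w => NN z w := by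
    refine IsBigO.of_bound 1 (Eventually.of_forall fun w => ?_)
    rw [Real.norm_eq_abs, Real.norm_eq_abs, abs_of_nonneg (NN_nonneg z w)]
    unfold NN
    nlinarith [sq_nonneg ‖w.1 - z.1‖]
  refine (h1.trans_isBigO h2).congr_left fun w => ?_
  simp [pol]; ring
lemma JetW.space {f : Z → ℝ} (h : (fun y => f y - f z.1 - p (y - z.1) - 1 / 2 * X (y - z.1) (y - z.1))
    =o[𝓝 z.1] fun y => ‖y - z.1‖ ^ 2) : JetW s (fun w : Z × ℝ => f w.1) z 0 p X := by
  have ht : Tendsto (fun w : Z × ℝ => w.1) (𝓝[s] z) (𝓝 z.1) :=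
    continuous_fst.continuousAt.mono_left nhdsWithin_le_nhds
  have h2 : (fun w : Z × ℝ => ‖w.1 - z.1‖ ^ 2) =O[𝓝[s] z] fun w => NN z w := by
    refine IsBigO.of_bound 1 (Eventually.of_forall fun w => ?_)
    rw [Real.norm_eq_abs, Real.norm_eq_abs, abs_of_nonneg (NN_nonneg z w), abs_of_nonneg (by positivity)]
    unfold NN
    nlinarith [abs_nonneg (w.2 - z.2)]
  refine ((h.comp_tendsto ht).trans_isBigO h2).congr_left fun w => ?_
  simp [pol]; ring
lemma JetW.lin (p : Z →L[ℝ] ℝ) : JetW s (fun w : Z × ℝ => p w.1) z 0 p 0 := by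
  apply JetW.space
  refine (isLittleO_zero _ _).congr_left fun w => ?_
  simp
lemma JetW.quad (B : Z →L[ℝ] Z →L[ℝ] ℝ) (x0 : Z) :
    JetW s (fun w : Z × ℝ => B (w.1 - x0) (w.1 - x0)) z 0
      (B (z.1 - x0) + B.flip (z.1 - x0)) (2 • B) := by
  apply JetW.space (f := fun y => B (y - x0) (y - x0))
  refine (isLittleO_zero _ _).congr_left fun y => ?_
  have : y - x0 = (y - z.1) + (z.1 - x0) := by abel
  rw [this]
  simp only [map_add, ContinuousLinearMap.add_apply, ContinuousLinearMap.flip_apply,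
    ContinuousLinearMap.smul_apply, two_smul]
  ring
lemma dx_tendsto : Tendsto (fun w : Z × ℝ => p (w.1 - z.1)) (𝓝[s] z) (𝓝 0) := by
  have : Continuous (fun w : Z × ℝ => p (w.1 - z.1)) := by fun_prop
  simpa using (this.tendsto z).mono_left nhdsWithin_le_nhds
lemma quad_isBigO (X : Z →L[ℝ] Z →L[ℝ] ℝ) :
    (fun w : Z × ℝ => X (w.1 - z.1) (w.1 - z.1)) =O[𝓝[s] z] fun w => NN z w := by
  refine IsBigO.of_bound ‖X‖ (Eventually.of_forall fun w => ?_)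
  refine (X.le_opNorm₂ _ _).trans ?_
  rw [Real.norm_eq_abs, abs_of_nonneg (NN_nonneg z w), mul_assoc]
  unfold NN
  gcongr
  nlinarith [abs_nonneg (w.2 - z.2)]
lemma JetW.bigO (h : JetW s φ z a p X) :
    (fun w => φ w - φ z - p (w.1 - z.1)) =O[𝓝[s] z] fun w => NN z w := by
  have h1 := IsLittleO.isBigO h
  have h2 := (quad_isBigO (s := s) (z := z) X).const_mul_left (1 / 2)
  have h3 : (fun w : Z × ℝ => a * (w.2 - z.2)) =O[𝓝[s] z] fun w => NN z w := by
    refine IsBigO.of_bound |a| (Eventually.of_forall fun w => ?_)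
    rw [Real.norm_eq_abs, Real.norm_eq_abs, abs_of_nonneg (NN_nonneg z w), abs_mul]
    unfold NN
    gcongr
    nlinarith [sq_nonneg ‖w.1 - z.1‖]
  refine ((h1.add h2).add h3).congr_left fun w => ?_
  simp [pol]; ring
lemma NN_tendsto : Tendsto (fun w => NN z w) (𝓝[s] z) (𝓝 0) := by
  have := ((NN_cont z).tendsto z).mono_left (nhdsWithin_le_nhds (s := s))
  simpa [NN] using this
lemma JetW.tendsto (h : JetW s φ z a p X) : Tendsto φ (𝓝[s] z) (𝓝 (φ z)) := by
  have h1 := h.bigO.trans_tendsto NN_tendsto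
  have h2 := (h1.add (dx_tendsto (s := s) (z := z) (p := p))).add (tendsto_const_nhds (x := φ z))
  simp only [add_zero, zero_add] at h2
  refine h2.congr fun w => ?_
  ring
lemma JetW.prodO (h : JetW s φ z a p X) (h' : JetW s ψ z b q Y) :
    (fun w => (φ w - φ z) * (ψ w - ψ z) - p (w.1 - z.1) * q (w.1 - z.1)) =o[𝓝[s] z]
      fun w => NN z w := by
  have e1 : (fun w : Z × ℝ => p (w.1 - z.1)) =o[𝓝[s] z] fun _ => (1 : ℝ) :=
    (isLittleO_one_iff ℝ).2 dx_tendsto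
  have e2 : (fun w : Z × ℝ => q (w.1 - z.1)) =o[𝓝[s] z] fun _ => (1 : ℝ) :=
    (isLittleO_one_iff ℝ).2 dx_tendsto
  have e3 : (fun w : Z × ℝ => φ w - φ z) =o[𝓝[s] z] fun _ => (1 : ℝ) :=
    (isLittleO_one_iff ℝ).2 (by simpa using h.tendsto.sub_const (φ z))
  have f1 := e3.mul_isBigO h'.bigO
  have f2 := h.bigO.mul_isLittleO e2
  simp only [one_mul, mul_one] at f1 f2
  refine (f1.add f2).congr_left fun w => ?_
  ring
lemma JetW.mul (h : JetW s φ z a p X) (h' : JetW s ψ z b q Y) :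
    JetW s (fun w => φ w * ψ w) z (φ z * b + ψ z * a) (φ z • q + ψ z • p)
      (φ z • Y + ψ z • X + (p.smulRight q + q.smulRight p)) := by
  have h1 := (h.prodO h').add ((IsLittleO.const_mul_left h (ψ z)).add
    (IsLittleO.const_mul_left h' (φ z)))
  refine IsLittleO.congr_left h1 fun w => ?_
  simp [pol]; ring
def T2 (F : ℝ → ℝ) (s0 F1 F2 : ℝ) : Prop :=
  (fun s => F s - F s0 - F1 * (s - s0) - 1 / 2 * F2 * (s - s0) ^ 2) =o[𝓝 s0] fun s => (s - s0) ^ 2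
lemma JetW.comp {F : ℝ → ℝ} {F1 F2 : ℝ} (h : JetW s φ z a p X) (hF : T2 F (φ z) F1 F2) :
    JetW s (fun w => F (φ w)) z (F1 * a) (F1 • p) (F1 • X + F2 • p.smulRight p) := by
  have h1 := h.prodO h
  have h2 : (fun w => (φ w - φ z) ^ 2) =O[𝓝[s] z] fun w => NN z w := by
    refine ((IsLittleO.isBigO h1).add (quad_isBigO (s := s) (z := z) (p.smulRight p))).congr_left
      fun w => ?_
    simp; ring
  have h3 := (hF.comp_tendsto h.tendsto).trans_isBigO h2
  have h4 := (h3.add (IsLittleO.const_mul_left h F1)).add (IsLittleO.const_mul_left h1 (1 / 2 * F2))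
  refine IsLittleO.congr_left h4 fun w => ?_
  simp [pol]; ring
lemma JetW.pull {Z' : Type*} [NormedAddCommGroup Z'] [NormedSpace ℝ Z'] {s' : Set (Z' × ℝ)}
    (π : Z' →L[ℝ] Z) (t0 : ℝ) (z' : Z' × ℝ)
    (h : JetW s φ (π z'.1, t0 + z'.2) a p X)
    (hs : ∀ w ∈ s', (π w.1, t0 + w.2) ∈ s) :
    JetW s' (fun w => φ (π w.1, t0 + w.2)) z' a (p.comp π) (X.bilinearComp π π) := by
  have hc : Continuous (fun w : Z' × ℝ => (π w.1, t0 + w.2)) := by fun_prop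
  have ht : Tendsto (fun w : Z' × ℝ => (π w.1, t0 + w.2)) (𝓝[s'] z') (𝓝[s] (π z'.1, t0 + z'.2)) :=
    (hc.continuousWithinAt).tendsto_nhdsWithin (fun w hw => hs w hw)
  have h1 := h.comp_tendsto ht
  have h2 : (fun w : Z' × ℝ => NN (π z'.1, t0 + z'.2) (π w.1, t0 + w.2)) =O[𝓝[s'] z']
      fun w => NN z' w := by
    refine IsBigO.of_bound (1 + ‖π‖ ^ 2) (Eventually.of_forall fun w => ?_)
    rw [Real.norm_eq_abs, Real.norm_eq_abs, abs_of_nonneg (NN_nonneg _ _), abs_of_nonneg (NN_nonneg _ _)]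
    unfold NN
    simp only [add_sub_add_left_eq_sub, ← map_sub]
    have h3 := π.le_opNorm (w.1 - z'.1)
    have h4 : ‖π (w.1 - z'.1)‖ ^ 2 ≤ (‖π‖ * ‖w.1 - z'.1‖) ^ 2 := by gcongr
    nlinarith [abs_nonneg (w.2 - z'.2), sq_nonneg ‖w.1 - z'.1‖, sq_nonneg ‖π‖,
      mul_nonneg (sq_nonneg ‖π‖) (abs_nonneg (w.2 - z'.2))]
  refine (h1.trans_isBigO h2).congr_left fun w => ?_
  simp [pol]
end Jets
lemma taylor2 {E G : Type*} [NormedAddCommGroup E] [NormedSpace ℝ E] [NormedAddCommGroup G]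
    [NormedSpace ℝ G] {f : E → G} {g : E → E →L[ℝ] G} {X : E →L[ℝ] E →L[ℝ] G} {s : Set E} {x : E}
    (hs : Convex ℝ s) (hx : x ∈ s) (hf : ∀ᶠ y in 𝓝[s] x, HasFDerivWithinAt f (g y) s y)
    (hg : HasFDerivWithinAt g X s x) (hX : ∀ h k, X h k = X k h) :
    (fun y => f y - f x - g x (y - x) - (1 / 2 : ℝ) • X (y - x) (y - x)) =o[𝓝[s] x]
      fun y => ‖y - x‖ ^ 2 := by
  rw [isLittleO_iff]
  intro ε hε
  have h1 := (hg.isLittleO).def hε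
  have h2 := hf.and h1
  rw [eventually_nhdsWithin_iff, Metric.eventually_nhds_iff] at h2
  obtain ⟨δ, hδ, h2⟩ := h2
  rw [eventually_nhdsWithin_iff]
  filter_upwards [Metric.ball_mem_nhds x hδ] with y hy hys
  set s' := s ∩ closedBall x ‖y - x‖
  have hs' : Convex ℝ s' := hs.inter (convex_closedBall _ _)
  set R : E → G := fun y => f y - f x - g x (y - x) - (1 / 2 : ℝ) • X (y - x) (y - x) with hR
  have hd : ∀ w ∈ s', HasFDerivWithinAt R (g w - g x - X (w - x)) s' w := by
    intro w hw
    have hw' : dist w x < δ := lt_of_le_of_lt hw.2 (by rw [← dist_eq_norm]; exact hy)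
    have hfw := (h2 hw' hw.1).1.mono (inter_subset_left : s' ⊆ s)
    have e1 : HasFDerivWithinAt (fun w : E => w - x) (ContinuousLinearMap.id ℝ E) s' w :=
      (hasFDerivWithinAt_id w s').sub_const x
    have e2 : HasFDerivWithinAt (fun w : E => g x (w - x)) ((g x).comp (ContinuousLinearMap.id ℝ E)) s' w :=
      (g x).hasFDerivAt.comp_hasFDerivWithinAt w e1
    have e3 : HasFDerivWithinAt (fun w : E => X (w - x)) (X.comp (ContinuousLinearMap.id ℝ E)) s' w :=
      X.hasFDerivAt.comp_hasFDerivWithinAt w e1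
    have e4 := (e3.clm_apply e1).const_smul (1 / 2 : ℝ)
    refine (((hfw.sub_const (f x)).sub e2).sub e4).congr_fderiv ?_
    ext h
    simp only [ContinuousLinearMap.sub_apply, ContinuousLinearMap.add_apply,
      ContinuousLinearMap.smul_apply, ContinuousLinearMap.comp_apply,
      ContinuousLinearMap.flip_apply, ContinuousLinearMap.id_apply, ContinuousLinearMap.coe_id', id]
    rw [hX h (w - x), ← two_smul ℝ (X (w - x) h), smul_smul]
    norm_num
  have hb : ∀ w ∈ s', ‖g w - g x - X (w - x)‖ ≤ ε * ‖y - x‖ := by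
    intro w hw
    have hw' : dist w x < δ := lt_of_le_of_lt hw.2 (by rw [← dist_eq_norm]; exact hy)
    refine ((h2 hw' hw.1).2).trans ?_
    have : ‖w - x‖ ≤ ‖y - x‖ := by rw [← dist_eq_norm]; exact hw.2
    gcongr
  have hxs : x ∈ s' := ⟨hx, by simp⟩
  have hyss : y ∈ s' := ⟨hys, by simp [dist_eq_norm]⟩
  have := hs'.norm_image_sub_le_of_norm_hasFDerivWithin_le hd hb hxs hyss
  have hRx : R x = 0 := by simp [hR]
  rw [hRx, sub_zero] at this
  rw [Real.norm_of_nonneg (by positivity)]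
  nlinarith [this]
lemma T2_of_deriv {F F1 : ℝ → ℝ} {F2 s0 : ℝ} (h1 : ∀ᶠ s in 𝓝 s0, HasDerivAt F (F1 s) s)
    (h2 : HasDerivAt F1 F2 s0) : T2 F s0 (F1 s0) F2 := by
  have := taylor2 (f := F) (g := fun s => ContinuousLinearMap.toSpanSingleton ℝ (F1 s))
    (X := ContinuousLinearMap.toSpanSingleton ℝ (ContinuousLinearMap.toSpanSingleton ℝ F2)) (s := univ) (x := s0)
    convex_univ (mem_univ _) (by
      rw [nhdsWithin_univ]
      filter_upwards [h1] with s hs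
      exact hs.hasFDerivAt.hasFDerivWithinAt) (by
      have h3 := ((ContinuousLinearMap.smulRightL ℝ ℝ ℝ (1 : ℝ →L[ℝ] ℝ)).hasFDerivAt (x := F1 s0)).comp_hasDerivAt s0 h2
      exact (h3.hasFDerivAt.hasFDerivWithinAt)) (by intro h k; simp; ring)
  rw [nhdsWithin_univ] at this
  unfold T2
  refine (this.congr_left fun s => ?_).congr_right fun s => ?_
  · simp; ring
  · simp
end
end Obl
open Set MeasureTheory Metric
open scoped RealInnerProductSpace
namespace Obl
open Filter Topology Asymptotics
noncomputable section
set_option linter.unusedSectionVars false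
set_option linter.deprecated false
set_option linter.unusedSimpArgs false
variable {d : ℕ}
structure Dat (d : ℕ) where
  lam : ℝ
  Λ : ℝ
  M : ℝ
  L : ℝ
  B : ℝ
  Q : ℝ → Matrix (Fin (d + 1)) (Fin (d + 1)) ℝ
  v : ℝ → Eucl (d + 1)
  lam_pos : 0 < lam
  Λ_pos : 0 < Λ
  M_pos : 1 ≤ M
  L_pos : 0 < L
  B_pos : 0 < B
  symm : ∀ t i j, Q t i j = Q t j i
  ell : ∀ t (h : Fin (d + 1) → ℝ), Λ⁻¹ * ∑ i, h i ^ 2 ≤ ∑ i, ∑ j, Q t i j * (h i * h j)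
  qB : ∀ t i j, |Q t i j| ≤ B
  lipQ : ∀ t s i j, |Q t i j - Q s i j| ≤ L * |t - s|
  lipv : ∀ t s, ‖v t - v s‖ ≤ L * |t - s|
  vlast : ∀ t, M⁻¹ ≤ lastC (v t)
  vb : ∀ t, ‖v t‖ ≤ M
abbrev ee (i : Fin (d + 1)) : Eucl (d + 1) := EuclideanSpace.single i (1 : ℝ)
def trQ (A : Matrix (Fin (d + 1)) (Fin (d + 1)) ℝ)
    (X : Eucl (d + 1) →L[ℝ] Eucl (d + 1) →L[ℝ] ℝ) : ℝ := ∑ i, ∑ j, A i j * X (ee i) (ee j)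
lemma trQ_add (A : Matrix (Fin (d + 1)) (Fin (d + 1)) ℝ) (X Y) :
    trQ A (X + Y) = trQ A X + trQ A Y := by
  simp [trQ, mul_add, Finset.sum_add_distrib]
lemma trQ_smul (A : Matrix (Fin (d + 1)) (Fin (d + 1)) ℝ) (c : ℝ) (X) :
    trQ A (c • X) = c * trQ A X := by
  simp only [trQ, Finset.mul_sum, ContinuousLinearMap.smul_apply, smul_eq_mul]
  exact Finset.sum_congr rfl fun i _ => Finset.sum_congr rfl fun j _ => by ring
lemma trQ_neg (A : Matrix (Fin (d + 1)) (Fin (d + 1)) ℝ) (X) :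
    trQ A (-X) = - trQ A X := by
  have := trQ_smul A (-1) X
  rw [neg_one_mul] at this
  rw [← this]; congr 1; ext; simp
lemma trQ_sub (A : Matrix (Fin (d + 1)) (Fin (d + 1)) ℝ) (X Y) :
    trQ A (X - Y) = trQ A X - trQ A Y := by
  simp [trQ, mul_sub, Finset.sum_sub_distrib]
lemma trQ_zero (A : Matrix (Fin (d + 1)) (Fin (d + 1)) ℝ) : trQ A 0 = 0 := by simp [trQ]
def vec (h : Fin (d + 1) → ℝ) : Eucl (d + 1) := WithLp.toLp 2 h
lemma vec_eq (h : Fin (d + 1) → ℝ) : vec h = ∑ i, h i • ee i := by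
  ext j; simp [vec, Finset.sum_apply, Pi.single_apply]
lemma bil_vec (X : Eucl (d + 1) →L[ℝ] Eucl (d + 1) →L[ℝ] ℝ) (h k : Fin (d + 1) → ℝ) :
    X (vec h) (vec k) = ∑ i, ∑ j, h i * k j * X (ee i) (ee j) := by
  rw [vec_eq h, vec_eq k]
  simp only [map_sum, map_smul, ContinuousLinearMap.sum_apply, ContinuousLinearMap.smul_apply,
    smul_eq_mul, Finset.mul_sum]
  rw [Finset.sum_comm]
  exact Finset.sum_congr rfl fun i _ => Finset.sum_congr rfl fun j _ => by ring
lemma sum_repr {m : ℕ} (A : Matrix (Fin (d + 1)) (Fin (d + 1)) ℝ) (f : Fin m → Fin (d + 1) → ℝ)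
    (h : ∀ i j, A i j = ∑ k, f k i * f k j) (X) :
    trQ A X = ∑ k, X (vec (f k)) (vec (f k)) := by
  simp only [bil_vec, trQ, h, Finset.sum_mul]
  conv_rhs => rw [Finset.sum_comm]
  refine Finset.sum_congr rfl fun i _ => ?_
  rw [Finset.sum_comm]
lemma norm_sq_vec (h : Fin (d + 1) → ℝ) : ‖vec h‖ ^ 2 = ∑ i, h i ^ 2 := by
  rw [EuclideanSpace.real_norm_sq_eq]; rfl
lemma coupling (S : Dat d) : ∃ C > 0, ∃ r > 0, ∀ t s, |t - s| ≤ r → ∃ m : ℕ,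
    ∃ ξ ζ : Fin m → Eucl (d + 1), (∀ X, trQ (S.Q t) X = ∑ k, X (ξ k) (ξ k)) ∧
      (∀ X, trQ (S.Q s) X = ∑ k, X (ζ k) (ζ k)) ∧ ∑ k, ‖ξ k - ζ k‖ ^ 2 ≤ C * |t - s| ^ 2 := by
  set n : ℝ := (d + 1 : ℝ) with hn
  have hnpos : 0 < n := by positivity
  have hL := S.L_pos
  have hΛ := S.Λ_pos
  set δ1 : ℝ := n ^ 2 * S.L with hδ1
  have hδ1pos : 0 < δ1 := by positivity
  refine ⟨2 * n * (S.Λ * δ1 ^ 2), by positivity, (S.Λ * δ1)⁻¹, by positivity, fun t s hts => ?_⟩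
  set κ : ℝ := S.Λ * (δ1 * |t - s|) ^ 2 with hκ
  have hκ0 : 0 ≤ κ := by positivity
  have hκ1 : κ ≤ S.Λ⁻¹ := by
    have h1 : δ1 * |t - s| ≤ S.Λ⁻¹ := by
      calc δ1 * |t - s| ≤ δ1 * (S.Λ * δ1)⁻¹ := by gcongr
        _ = S.Λ⁻¹ := by field_simp
    calc κ ≤ S.Λ * (S.Λ⁻¹) ^ 2 := by rw [hκ]; gcongr
      _ = S.Λ⁻¹ := by field_simp
  set R : Matrix (Fin (d + 1)) (Fin (d + 1)) ℝ :=
    fun i j => (S.Q t i j + S.Q s i j) / 2 - if i = j then κ else 0 with hR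
  set A : Matrix (Fin (d + 1) ⊕ Fin (d + 1)) (Fin (d + 1) ⊕ Fin (d + 1)) ℝ :=
    Matrix.fromBlocks (S.Q t) R R (S.Q s) with hA
  have hRs : ∀ i j, R i j = R j i := by
    intro i j; simp only [hR]; rw [S.symm t i j, S.symm s i j]; simp [eq_comm]
  have hPSD : A.PosSemidef := by
    refine Matrix.PosSemidef.of_dotProduct_mulVec_nonneg ?_ fun x => ?_
    · rw [Matrix.IsHermitian]
      ext i j
      rcases i with i | i <;> rcases j with j | j <;> simp [hA, Matrix.conjTranspose_apply]
      · exact S.symm _ _ _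
      · exact hRs _ _
      · exact hRs _ _
      · exact S.symm _ _ _
    · set a : Fin (d + 1) → ℝ := fun i => x (Sum.inl i) with ha
      set b : Fin (d + 1) → ℝ := fun i => x (Sum.inr i) with hb
      have e0 : star x ⬝ᵥ A.mulVec x = ∑ i, ∑ j, (S.Q t i j * (a i * a j) + R i j * (b i * a j)
          + (R i j * (a i * b j) + S.Q s i j * (b i * b j))) := by
        simp only [dotProduct, Matrix.mulVec, Fintype.sum_sum_type, hA, Matrix.fromBlocks_apply₁₁,
          Matrix.fromBlocks_apply₁₂, Matrix.fromBlocks_apply₂₁, Matrix.fromBlocks_apply₂₂,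
          Pi.star_apply, star_trivial, Finset.sum_add_distrib, mul_add, Finset.mul_sum, ha, hb]
        congr 1 <;> congr 1 <;>
        exact Finset.sum_congr rfl fun i _ => Finset.sum_congr rfl fun j _ => by ring
      set p : Fin (d + 1) → ℝ := fun i => a i + b i with hp
      set q : Fin (d + 1) → ℝ := fun i => a i - b i with hq
      have hdiag : ∀ f : Fin (d + 1) → Fin (d + 1) → ℝ,
          ∑ i, ∑ j, (if i = j then κ else 0) * f i j = κ * ∑ i, f i i := by
        intro f; simp [Finset.mul_sum]
      have hsw : ∀ f : Fin (d + 1) → Fin (d + 1) → ℝ, ∀ t, ∑ i, ∑ j, S.Q t i j * f i j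
          = ∑ i, ∑ j, S.Q t i j * f j i := by
        intro f t
        rw [Finset.sum_comm]
        exact Finset.sum_congr rfl fun i _ => Finset.sum_congr rfl fun j _ => by rw [S.symm]
      have e1 : star x ⬝ᵥ A.mulVec x = (1 / 2) * ∑ i, ∑ j, S.Q t i j * (p i * p j)
          + (1 / 2) * ∑ i, ∑ j, S.Q s i j * (p i * p j)
          + (1 / 2) * ∑ i, ∑ j, (S.Q t i j - S.Q s i j) * (p i * q j)
          - κ / 2 * ∑ i, p i ^ 2 + κ / 2 * ∑ i, q i ^ 2 := by
        have k1 := hsw (fun i j => a i * b j) t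
        have k2 := hsw (fun i j => a i * b j) s
        have k3 := hdiag (fun i j => a i * b j + b i * a j)
        have k4 : κ / 2 * ∑ i, p i ^ 2 - κ / 2 * ∑ i, q i ^ 2 = κ * ∑ i, (a i * b i + b i * a i) := by
          simp only [Finset.mul_sum, ← Finset.sum_sub_distrib]
          exact Finset.sum_congr rfl fun i _ => by simp only [hp, hq]; ring
        have e2 : star x ⬝ᵥ A.mulVec x = (∑ i, ∑ j, (S.Q t i j * (a i * a j) + S.Q s i j * (b i * b j)
          + ((1/2) * (S.Q t i j * (a i * b j)) + (1/2) * (S.Q s i j * (a i * b j))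
          + (1/2) * (S.Q t i j * (b i * a j)) + (1/2) * (S.Q s i j * (b i * a j)))))
          - ∑ i, ∑ j, (if i = j then κ else 0) * (a i * b j + b i * a j) := by
          rw [e0]
          simp only [← Finset.sum_sub_distrib]
          exact Finset.sum_congr rfl fun i _ => Finset.sum_congr rfl fun j _ => by
            simp only [hR]; ring
        have e3 : (1 / 2) * ∑ i, ∑ j, S.Q t i j * (p i * p j)
          + (1 / 2) * ∑ i, ∑ j, S.Q s i j * (p i * p j)
          + (1 / 2) * ∑ i, ∑ j, (S.Q t i j - S.Q s i j) * (p i * q j)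
          = ∑ i, ∑ j, (S.Q t i j * (a i * a j) + S.Q s i j * (b i * b j)
          + (S.Q s i j * (a i * b j)) + (S.Q t i j * (b i * a j))) := by
          simp only [Finset.mul_sum, ← Finset.sum_add_distrib]
          exact Finset.sum_congr rfl fun i _ => Finset.sum_congr rfl fun j _ => by
            simp only [hp, hq]; ring
        rw [e2, k3, e3, ← k4]
        simp only [Finset.sum_add_distrib, ← Finset.mul_sum] at k1 k2 ⊢
        have k1' : ∑ i, ∑ j, S.Q t i j * (b i * a j) = ∑ i, ∑ j, S.Q t i j * (a i * b j) := by
          rw [k1]; exact Finset.sum_congr rfl fun i _ => Finset.sum_congr rfl fun j _ => by ring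
        have k2' : ∑ i, ∑ j, S.Q s i j * (b i * a j) = ∑ i, ∑ j, S.Q s i j * (a i * b j) := by
          rw [k2]; exact Finset.sum_congr rfl fun i _ => Finset.sum_congr rfl fun j _ => by ring
        rw [k1', k2']; ring
      rw [e1]
      have l1 := S.ell t p
      have l2 := S.ell s p
      have hP : ‖vec p‖ ^ 2 = ∑ i, p i ^ 2 := norm_sq_vec p
      have hQ : ‖vec q‖ ^ 2 = ∑ i, q i ^ 2 := norm_sq_vec q
      have l3 : |∑ i, ∑ j, (S.Q t i j - S.Q s i j) * (p i * q j)| ≤ (δ1 * |t - s|) * (‖vec p‖ * ‖vec q‖) := by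
        calc |∑ i, ∑ j, (S.Q t i j - S.Q s i j) * (p i * q j)|
            ≤ ∑ i : Fin (d + 1), ∑ j : Fin (d + 1), (S.L * |t - s|) * (‖vec p‖ * ‖vec q‖) := by
              refine (Finset.abs_sum_le_sum_abs _ _).trans (Finset.sum_le_sum fun i _ => ?_)
              refine (Finset.abs_sum_le_sum_abs _ _).trans (Finset.sum_le_sum fun j _ => ?_)
              rw [abs_mul, abs_mul]
              have r1 : |p i| ≤ ‖vec p‖ := PiLp.norm_apply_le (vec p) i
              have r2 : |q j| ≤ ‖vec q‖ := PiLp.norm_apply_le (vec q) j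
              have r3 := S.lipQ t s i j
              gcongr
          _ = (δ1 * |t - s|) * (‖vec p‖ * ‖vec q‖) := by
              simp [Finset.sum_const, hδ1, hn]; ring
      have l4 := (abs_le.1 l3).1
      set P := ‖vec p‖
      set W := ‖vec q‖
      have hΛi : S.Λ⁻¹ * S.Λ = 1 := inv_mul_cancel₀ hΛ.ne'
      set D := δ1 * |t - s|
      rw [← hP] at l1 l2 ⊢
      rw [← hQ]
      have m1 : (S.Λ⁻¹ - κ / 2) * P ^ 2 ≥ S.Λ⁻¹ / 2 * P ^ 2 := by
        have := sq_nonneg P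
        nlinarith
      have m2 : S.Λ⁻¹ / 2 * P ^ 2 - D * (P * W) / 2 + κ / 2 * W ^ 2 ≥ 0 := by
        have : S.Λ⁻¹ / 2 * P ^ 2 - D * (P * W) / 2 + κ / 2 * W ^ 2
          = S.Λ⁻¹ / 2 * ((P - S.Λ * D * W / 2) ^ 2 + 3 / 4 * (S.Λ * D * W) ^ 2) := by
          rw [hκ]; field_simp; ring
        rw [this]; positivity
      nlinarith
  obtain ⟨m, f, hf⟩ := Matrix.posSemidef_iff_eq_sum_vecMulVec.1 hPSD
  have hf' : ∀ i j, A i j = ∑ k, f k i * f k j := by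
    intro i j; rw [hf]; simp [Matrix.sum_apply, Matrix.vecMulVec_apply]
  refine ⟨m, fun k => vec (fun i => f k (Sum.inl i)), fun k => vec (fun i => f k (Sum.inr i)),
    sum_repr _ _ fun i j => ?_, sum_repr _ _ fun i j => ?_, ?_⟩
  · rw [← hf']; rfl
  · rw [← hf']; rfl
  · have e1 : ∀ k, ‖vec (fun i => f k (Sum.inl i)) - vec (fun i => f k (Sum.inr i))‖ ^ 2
        = ∑ i, (f k (Sum.inl i) - f k (Sum.inr i)) ^ 2 := fun k => norm_sq_vec _
    simp only [e1]
    rw [Finset.sum_comm]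
    have e2 : ∀ i : Fin (d + 1), ∑ k, (f k (Sum.inl i) - f k (Sum.inr i)) ^ 2 = 2 * κ := by
      intro i
      have : ∑ k, (f k (Sum.inl i) - f k (Sum.inr i)) ^ 2
        = A (Sum.inl i) (Sum.inl i) + A (Sum.inr i) (Sum.inr i) - 2 * A (Sum.inl i) (Sum.inr i) := by
        rw [hf', hf', hf', Finset.mul_sum, ← Finset.sum_add_distrib, ← Finset.sum_sub_distrib]
        exact Finset.sum_congr rfl fun k _ => by ring
      rw [this]
      have q1 : A (Sum.inl i) (Sum.inl i) = S.Q t i i := rfl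
      have q2 : A (Sum.inr i) (Sum.inr i) = S.Q s i i := rfl
      have q3 : A (Sum.inl i) (Sum.inr i) = (S.Q t i i + S.Q s i i) / 2 - if i = i then κ else 0 := rfl
      rw [q1, q2, q3, if_pos rfl]; ring
    simp only [e2]
    simp only [Finset.sum_const, Finset.card_univ, Fintype.card_fin, nsmul_eq_mul, hκ]
    push_cast
    rw [← hn]
    apply le_of_eq; ring
lemma repr1 (S : Dat d) (t : ℝ) : ∃ m : ℕ, ∃ ξ : Fin m → Eucl (d + 1),
    ∀ X, trQ (S.Q t) X = ∑ k, X (ξ k) (ξ k) := by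
  obtain ⟨C, _, r, hr, h⟩ := coupling S
  obtain ⟨m, ξ, _, h1, _⟩ := h t t (by simpa using hr.le)
  exact ⟨m, ξ, h1⟩
lemma trQ_mono (S : Dat d) (t : ℝ) {X Y : Eucl (d + 1) →L[ℝ] Eucl (d + 1) →L[ℝ] ℝ}
    (h : ∀ x, X x x ≤ Y x x) : trQ (S.Q t) X ≤ trQ (S.Q t) Y := by
  obtain ⟨m, ξ, hξ⟩ := repr1 S t
  rw [hξ, hξ]
  exact Finset.sum_le_sum fun k _ => h _
def DD (d : ℕ) : Set (SpaceTime (d + 1)) :=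
  {p | ‖p.1‖ ≤ 1 ∧ 0 ≤ lastC p.1 ∧ -1 ≤ p.2 ∧ p.2 ≤ 0}
def bd (d : ℕ) : Set (SpaceTime (d + 1)) := {p | p ∈ DD d ∧ (‖p.1‖ = 1 ∨ p.2 = -1)}
lemma lastC_cont : Continuous (lastC : Eucl (d + 1) → ℝ) := by unfold lastC; fun_prop
lemma lastC_add (x y : Eucl (d + 1)) : lastC (x + y) = lastC x + lastC y := rfl
lemma lastC_sub (x y : Eucl (d + 1)) : lastC (x - y) = lastC x - lastC y := rfl
lemma lastC_smul (c : ℝ) (x : Eucl (d + 1)) : lastC (c • x) = c * lastC x := rfl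
def lastL (d : ℕ) : Eucl (d + 1) →L[ℝ] ℝ := EuclideanSpace.proj (Fin.last d)
lemma lastL_apply (x : Eucl (d + 1)) : lastL d x = lastC x := rfl
lemma abs_lastC_le (x : Eucl (d + 1)) : |lastC x| ≤ ‖x‖ := PiLp.norm_apply_le x _
lemma DD_closed : IsClosed (DD d) := by
  have h := lastC_cont (d := d)
  refine (isClosed_le (f := fun p : SpaceTime (d+1) => ‖p.1‖) (g := fun _ => (1:ℝ)) (by fun_prop) (by fun_prop)).inter <|
    (isClosed_le (f := fun _ => (0:ℝ)) (g := fun p : SpaceTime (d+1) => lastC p.1) (by fun_prop) (h.comp continuous_fst)).inter <|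
    (isClosed_le (f := fun _ => (-1:ℝ)) (g := fun p : SpaceTime (d+1) => p.2) (by fun_prop) (by fun_prop)).inter
    (isClosed_le (f := fun p : SpaceTime (d+1) => p.2) (g := fun _ => (0:ℝ)) (by fun_prop) (by fun_prop))
lemma DD_compact : IsCompact (DD d) := by
  refine IsCompact.of_isClosed_subset ((isCompact_closedBall (0 : Eucl (d + 1)) 1).prod
    (isCompact_Icc (a := (-1 : ℝ)) (b := 0))) DD_closed ?_
  rintro p ⟨h1, _, h3, h4⟩
  exact ⟨by simpa using h1, h3, h4⟩
lemma bd_closed : IsClosed (bd d) := by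
  refine DD_closed.inter (IsClosed.union (isClosed_eq (f := fun p : SpaceTime (d+1) => ‖p.1‖) (by fun_prop) continuous_const)
    (isClosed_eq (f := fun p : SpaceTime (d+1) => p.2) (by fun_prop) continuous_const))
lemma bd_sub : bd d ⊆ DD d := fun _ h => h.1
lemma DD_convex : Convex ℝ (DD d) := by
  rintro p ⟨a1, a2, a3, a4⟩ q ⟨b1, b2, b3, b4⟩ s t hs ht hst
  refine ⟨?_, ?_, ?_, ?_⟩
  · have := (convex_closedBall (0 : Eucl (d + 1)) 1) (x := p.1) (y := q.1) (by simpa using a1) (by simpa using b1) hs ht hst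
    simpa using this
  · show 0 ≤ lastC (s • p.1 + t • q.1)
    rw [lastC_add, lastC_smul, lastC_smul]; positivity
  · show -1 ≤ s * p.2 + t * q.2
    nlinarith
  · show s * p.2 + t * q.2 ≤ 0
    nlinarith
lemma KcP_eq : KcP d 1 = DD d \ bd d := by
  ext p
  simp only [KcP, Kc, Fc, DD, bd, mem_union, mem_diff, mem_setOf_eq, mem_ball_zero_iff, mem_Ioc]
  constructor
  · rintro (⟨h1, h2, h3, h4⟩ | ⟨h1, h2, h3, h4⟩)
    · exact ⟨⟨h1.le, h2.le, h3.le, h4⟩, fun h => h.2.elim h1.ne h3.ne'⟩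
    · exact ⟨⟨h1.le, h2.ge, h3.le, h4⟩, fun h => h.2.elim h1.ne h3.ne'⟩
  · rintro ⟨⟨h1, h2, h3, h4⟩, h5⟩
    have h6 : ¬ (‖p.1‖ = 1 ∨ p.2 = -1) := fun h => h5 ⟨⟨h1, h2, h3, h4⟩, h⟩
    rw [not_or] at h6
    have h7 := lt_of_le_of_ne h1 h6.1
    have h8 := lt_of_le_of_ne h3 (Ne.symm h6.2)
    rcases h2.lt_or_eq with h | h
    · exact Or.inl ⟨h7, h, h8, h4⟩
    · exact Or.inr ⟨h7, h.symm, h8, h4⟩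
lemma Kc_sub : Kc d 1 ⊆ DD d := fun p hp =>
  (KcP_eq (d := d) ▸ (Or.inl hp : p ∈ KcP d 1) : p ∈ DD d \ bd d).1
lemma Fc_sub : Fc d 1 ⊆ DD d := fun p hp =>
  (KcP_eq (d := d) ▸ (Or.inr hp : p ∈ KcP d 1) : p ∈ DD d \ bd d).1
lemma closure_Kc : closure (Kc d 1) = DD d := by
  apply Subset.antisymm (closure_minimal Kc_sub DD_closed)
  rintro p ⟨a1, a2, a3, a4⟩
  set e : Eucl (d + 1) := ee (Fin.last d) with he
  have hen : ‖e‖ = 1 := by simp [he]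
  have hel : lastC e = 1 := by simp [he, lastC]
  have hc : Continuous (fun s : ℝ => (((1 - s) • p.1 + (s / 2) • e, (1 - s) * p.2) : SpaceTime (d + 1))) := by
    fun_prop
  have ht := (hc.tendsto 0).mono_left (nhdsWithin_le_nhds (s := Ioi (0 : ℝ)))
  simp only [sub_zero, one_smul, zero_div, zero_smul, add_zero, one_mul] at ht
  refine mem_closure_of_tendsto ht ?_
  have h1 : ∀ᶠ s in 𝓝[>] (0 : ℝ), s < 1 := nhdsWithin_le_nhds (Iio_mem_nhds one_pos)
  filter_upwards [h1, self_mem_nhdsWithin] with s hs1 hs0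
  have hs0 : 0 < s := hs0
  refine ⟨?_, ?_, ?_, ?_⟩
  · rw [mem_ball_zero_iff]
    have := norm_add_le ((1 - s) • p.1) ((s / 2) • e)
    rw [norm_smul, norm_smul, hen, Real.norm_of_nonneg (by linarith), Real.norm_of_nonneg (by linarith)] at this
    nlinarith
  · show 0 < lastC ((1 - s) • p.1 + (s / 2) • e)
    rw [lastC_add, lastC_smul, lastC_smul, hel]
    nlinarith
  · show -1 < (1 - s) * p.2
    nlinarith
  · show (1 - s) * p.2 ≤ 0
    nlinarith
lemma bdryK_eq : bdryK d = bd d := by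
  have hopen : IsOpen {p : SpaceTime (d + 1) | p.1 ∈ ball 0 1 ∧ 0 < lastC p.1 ∧ p.2 ∈ Ioo (-1 : ℝ) 0} := by
    refine (isOpen_ball.preimage continuous_fst).inter
      ((isOpen_lt continuous_const (lastC_cont.comp continuous_fst)).inter (isOpen_Ioo.preimage continuous_snd))
  have hsub : {p : SpaceTime (d + 1) | p.1 ∈ ball 0 1 ∧ 0 < lastC p.1 ∧ p.2 ∈ Ioo (-1 : ℝ) 0} ⊆ Kc d 1 :=
    fun p hp => ⟨hp.1, hp.2.1, hp.2.2.1, hp.2.2.2.le⟩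
  ext p
  constructor
  · rintro ⟨h1, h2⟩
    have hp : p ∈ DD d := closure_Kc (d := d) ▸ h1.1
    by_contra hb
    have : p ∈ KcP d 1 := by rw [KcP_eq]; exact ⟨hp, hb⟩
    rcases this with h | h
    · rcases h.2.2.2.lt_or_eq with h0 | h0
      · exact h1.2 (interior_maximal hsub hopen ⟨h.1, h.2.1, h.2.2.1, h0⟩)
      · exact h2 (Or.inr ⟨h.1, h.2.1, h0⟩)
    · exact h2 (Or.inl h)
  · intro hp
    have hn : p ∉ KcP d 1 := by rw [KcP_eq]; exact fun h => h.2 hp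
    refine ⟨⟨closure_Kc (d := d) ▸ hp.1, fun h => hn (Or.inl (interior_subset h))⟩, ?_⟩
    rintro (h | ⟨h1, h2, h3⟩)
    · exact hn (Or.inr h)
    · rw [mem_ball_zero_iff] at h1
      rcases hp.2 with h | h
      · linarith
      · linarith
def Sub (S : Dat d) (u : SpaceTime (d + 1) → ℝ) : Prop :=
  (∀ z ∈ Kc d 1, ∀ a p X, SJ (DD d) u z a p X → S.lam * a ≤ trQ (S.Q z.2) X) ∧
  (∀ z ∈ Fc d 1, ∀ a p X, SJ (DD d) u z a p X → a ≤ p (S.v z.2))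
section SJL
variable {Z : Type*} [NormedAddCommGroup Z] [NormedSpace ℝ Z]
variable {D s : Set (Z × ℝ)} {u φ : Z × ℝ → ℝ} {z : Z × ℝ} {a b : ℝ} {p q : Z →L[ℝ] ℝ}
  {X Y : Z →L[ℝ] Z →L[ℝ] ℝ}
lemma SJ.of_max (hm : ∀ᶠ w in 𝓝[D ∩ past z] z, u w - φ w ≤ u z - φ z)
    (hj : JetW (D ∩ past z) φ z a p X) : SJ D u z a p X := by
  intro ε hε
  filter_upwards [hm, IsLittleO.def hj hε] with w h1 h2
  rw [Real.norm_eq_abs, Real.norm_eq_abs, abs_of_nonneg (NN_nonneg _ _)] at h2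
  have := (abs_le.1 h2).2
  linarith
lemma SJ.of_le {u' : Z × ℝ → ℝ} (h : SJ D u' z a p X) (he : u z = u' z)
    (hl : ∀ᶠ w in 𝓝[D ∩ past z] z, u w ≤ u' w) : SJ D u z a p X := by
  intro ε hε
  filter_upwards [h ε hε, hl] with w h1 h2
  rw [he]; linarith
lemma SJ.sub_jet (h : SJ D u z a p X) (hj : JetW (D ∩ past z) φ z b q Y) :
    SJ D (fun w => u w - φ w) z (a - b) (p - q) (X - Y) := by
  intro ε hε
  filter_upwards [h (ε / 2) (half_pos hε), IsLittleO.def hj (half_pos hε)] with w h1 h2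
  rw [Real.norm_eq_abs, Real.norm_eq_abs, abs_of_nonneg (NN_nonneg _ _)] at h2
  have h3 := (abs_le.1 h2).1
  have : pol z (a - b) (p - q) (X - Y) w = pol z a p X w - pol z b q Y w := by
    simp [pol]; ring
  rw [this]; linarith
lemma SJ.zero_of_self (h : SJ D u z a p X) (hj : JetW (D ∩ past z) u z b q Y) :
    SJ D (fun _ => 0) z (a - b) (p - q) (X - Y) := by
  simpa using h.sub_jet hj
lemma SJ.zero_of_max (hm : ∀ᶠ w in 𝓝[D ∩ past z] z, φ w ≤ φ z)
    (hj : JetW (D ∩ past z) φ z a p X) : SJ D (fun _ => 0) z (-a) (-p) (-X) := by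
  refine SJ.of_max ?_ hj.neg
  simpa using hm
lemma zero_time (h : SJ D (fun _ => 0) z a p X) (hD : ∀ᶠ s in 𝓝[>] (0 : ℝ), (z.1, z.2 - s) ∈ D) :
    a ≤ 0 := by
  by_contra ha
  push Not at ha
  have h1 := h (a / 2) (half_pos ha)
  have hc : Tendsto (fun s : ℝ => ((z.1, z.2 - s) : Z × ℝ)) (𝓝[>] 0) (𝓝[D ∩ past z] z) := by
    refine tendsto_nhdsWithin_iff.2 ⟨?_, ?_⟩
    · have : Continuous (fun s : ℝ => ((z.1, z.2 - s) : Z × ℝ)) := by fun_prop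
      simpa using (this.tendsto 0).mono_left (nhdsWithin_le_nhds (s := Ioi (0 : ℝ)))
    · filter_upwards [hD, self_mem_nhdsWithin] with s h1 h2
      exact ⟨h1, by show z.2 - s ≤ z.2; linarith [show 0 < s from h2]⟩
  obtain ⟨s, hs1, hs2⟩ := ((hc.eventually h1).and self_mem_nhdsWithin).exists
  have hs2 : 0 < s := hs2
  simp only [pol, NN, sub_self, map_zero, norm_zero, sub_sub_cancel_left, abs_neg, abs_of_pos hs2,
    ContinuousLinearMap.zero_apply] at hs1
  nlinarith
lemma zero_dir (h : SJ D (fun _ => 0) z a p X) (k : Z)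
    (hD : ∀ᶠ s in 𝓝[>] (0 : ℝ), (z.1 + s • k, z.2) ∈ D) :
    0 ≤ p k ∧ (p k = 0 → 0 ≤ X k k) := by
  have hc : Tendsto (fun s : ℝ => ((z.1 + s • k, z.2) : Z × ℝ)) (𝓝[>] 0) (𝓝[D ∩ past z] z) := by
    refine tendsto_nhdsWithin_iff.2 ⟨?_, ?_⟩
    · have : Continuous (fun s : ℝ => ((z.1 + s • k, z.2) : Z × ℝ)) := by fun_prop
      simpa using (this.tendsto 0).mono_left (nhdsWithin_le_nhds (s := Ioi (0 : ℝ)))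
    · filter_upwards [hD] with s h1
      exact ⟨h1, by simp [past]⟩
  have key : ∀ ε > 0, ∀ᶠ s in 𝓝[>] (0 : ℝ), 0 ≤ p k + s * (1 / 2 * X k k + ε * ‖k‖ ^ 2) := by
    intro ε hε
    filter_upwards [hc.eventually (h ε hε), self_mem_nhdsWithin] with s h1 h2
    have h2 : 0 < s := h2
    simp only [pol, NN, sub_self, add_sub_cancel_left, map_smul, norm_smul, smul_eq_mul, abs_zero,
      ContinuousLinearMap.smul_apply, Real.norm_eq_abs, mul_pow, sq_abs] at h1
    have : 0 ≤ s * (p k + s * (1 / 2 * X k k + ε * ‖k‖ ^ 2)) := by nlinarith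
    exact nonneg_of_mul_nonneg_right this h2
  constructor
  · have h1 : Tendsto (fun s : ℝ => p k + s * (1 / 2 * X k k + 1 * ‖k‖ ^ 2)) (𝓝[>] 0) (𝓝 (p k)) := by
      have : Continuous (fun s : ℝ => p k + s * (1 / 2 * X k k + 1 * ‖k‖ ^ 2)) := by fun_prop
      simpa using (this.tendsto 0).mono_left (nhdsWithin_le_nhds (s := Ioi (0 : ℝ)))
    exact ge_of_tendsto h1 (key 1 one_pos)
  · intro h0
    have h2 : ∀ ε > 0, 0 ≤ 1 / 2 * X k k + ε * ‖k‖ ^ 2 := by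
      intro ε hε
      obtain ⟨s, hs1, hs2⟩ := ((key ε hε).and self_mem_nhdsWithin).exists
      rw [h0, zero_add] at hs1
      exact nonneg_of_mul_nonneg_right hs1 hs2
    have h3 : Tendsto (fun ε : ℝ => 1 / 2 * X k k + ε * ‖k‖ ^ 2) (𝓝[>] 0) (𝓝 (1 / 2 * X k k)) := by
      have : Continuous (fun ε : ℝ => 1 / 2 * X k k + ε * ‖k‖ ^ 2) := by fun_prop
      simpa using (this.tendsto 0).mono_left (nhdsWithin_le_nhds (s := Ioi (0 : ℝ)))
    have := ge_of_tendsto h3 (by filter_upwards [self_mem_nhdsWithin] with ε hε using h2 ε hε)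
    linarith
lemma zero_full (h : SJ D (fun _ => 0) z a p X)
    (hD : ∀ k, ∀ᶠ s in 𝓝[>] (0 : ℝ), (z.1 + s • k, z.2) ∈ D) : p = 0 ∧ ∀ k, 0 ≤ X k k := by
  have h0 : ∀ k, p k = 0 := fun k => le_antisymm (by
    have := (zero_dir h (-k) (hD _)).1; simp at this; exact this) (zero_dir h k (hD k)).1
  exact ⟨ContinuousLinearMap.ext h0, fun k => (zero_dir h k (hD k)).2 (h0 k)⟩
end SJL
lemma dir_K {z : SpaceTime (d + 1)} (hz : z ∈ Kc d 1) (k : Eucl (d + 1)) :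
    ∀ᶠ s in 𝓝[>] (0 : ℝ), (z.1 + s • k, z.2) ∈ DD d := by
  apply nhdsWithin_le_nhds
  have c1 : Continuous (fun s : ℝ => ‖z.1 + s • k‖) := by fun_prop
  have c2 : Continuous (fun s : ℝ => lastC (z.1 + s • k)) := lastC_cont.comp (by fun_prop)
  have h1 := mem_ball_zero_iff.1 hz.1
  filter_upwards [(c1.tendsto 0).eventually_lt_const (u := 1) (by simpa using h1),
    (c2.tendsto 0).eventually_const_lt (u := 0) (by simpa using hz.2.1)] with s h1 h2
  exact ⟨h1.le, h2.le, hz.2.2.1.le, hz.2.2.2⟩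
lemma dir_F {z : SpaceTime (d + 1)} (hz : z ∈ Fc d 1) (k : Eucl (d + 1)) (hk : 0 ≤ lastC k) :
    ∀ᶠ s in 𝓝[>] (0 : ℝ), (z.1 + s • k, z.2) ∈ DD d := by
  have c1 : Continuous (fun s : ℝ => ‖z.1 + s • k‖) := by fun_prop
  have h1 := mem_ball_zero_iff.1 hz.1
  filter_upwards [nhdsWithin_le_nhds ((c1.tendsto 0).eventually_lt_const (u := 1) (by simpa using h1)),
    self_mem_nhdsWithin] with s h1 h2
  refine ⟨h1.le, ?_, hz.2.2.1.le, hz.2.2.2⟩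
  show 0 ≤ lastC (z.1 + s • k)
  rw [lastC_add, lastC_smul, hz.2.1, zero_add]
  exact mul_nonneg (le_of_lt h2) hk
lemma dir_t {z : SpaceTime (d + 1)} (hz : z ∈ DD d) (ht : -1 < z.2) :
    ∀ᶠ s in 𝓝[>] (0 : ℝ), (z.1, z.2 - s) ∈ DD d := by
  have h1 : ∀ᶠ s in 𝓝[>] (0 : ℝ), s < z.2 + 1 := nhdsWithin_le_nhds (Iio_mem_nhds (by linarith))
  filter_upwards [h1, self_mem_nhdsWithin] with s h1 h2
  have h2 : 0 < s := h2
  exact ⟨hz.1, hz.2.1, by show -1 ≤ z.2 - s; linarith, by show z.2 - s ≤ 0; linarith [hz.2.2.2]⟩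
lemma jet_K (S : Dat d) {u : SpaceTime (d + 1) → ℝ} {z} (hz : z ∈ Kc d 1) {a b p q X Y}
    (h : SJ (DD d) u z a p X) (hj : JetW (DD d ∩ past z) u z b q Y)
    (hb : S.lam * b ≤ trQ (S.Q z.2) Y) : S.lam * a ≤ trQ (S.Q z.2) X := by
  have h0 := h.zero_of_self hj
  have h1 := zero_time h0 (dir_t (Kc_sub hz) hz.2.2.1)
  have h2 := (zero_full h0 (dir_K hz)).2
  have h3 : trQ (S.Q z.2) Y ≤ trQ (S.Q z.2) X := trQ_mono S _ fun x => by
    have := h2 x; simp at this; exact this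
  nlinarith [S.lam_pos]
lemma jet_F (S : Dat d) {u : SpaceTime (d + 1) → ℝ} {z} (hz : z ∈ Fc d 1) {a b p q X Y}
    (h : SJ (DD d) u z a p X) (hj : JetW (DD d ∩ past z) u z b q Y)
    (hb : b ≤ q (S.v z.2)) : a ≤ p (S.v z.2) := by
  have h0 := h.zero_of_self hj
  have h1 := zero_time h0 (dir_t (Fc_sub hz) hz.2.2.1)
  have hv : 0 ≤ lastC (S.v z.2) := le_trans (by have := S.M_pos; positivity) (S.vlast z.2)
  have h2 := (zero_dir h0 (S.v z.2) (dir_F hz _ hv)).1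
  simp at h2
  linarith
abbrev mCL (H : Matrix (Fin (d + 1)) (Fin (d + 1)) ℝ) : Eucl (d + 1) →L[ℝ] Eucl (d + 1) :=
  LinearMap.toContinuousLinearMap (Matrix.toEuclideanLin H)
def matX (H : Matrix (Fin (d + 1)) (Fin (d + 1)) ℝ) : Eucl (d + 1) →L[ℝ] Eucl (d + 1) →L[ℝ] ℝ :=
  (innerSL ℝ (E := Eucl (d + 1))).comp (mCL H)
lemma matX_apply (H : Matrix (Fin (d + 1)) (Fin (d + 1)) ℝ) (x y : Eucl (d + 1)) :
    matX H x y = ⟪mCL H x, y⟫ := rfl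
lemma mCL_ee (H : Matrix (Fin (d + 1)) (Fin (d + 1)) ℝ) (i j : Fin (d + 1)) :
    (mCL H (ee i)) j = H j i := by
  simp [mCL, Matrix.toEuclideanLin, Matrix.toLpLin_apply]
lemma matX_ee (H : Matrix (Fin (d + 1)) (Fin (d + 1)) ℝ) (i j : Fin (d + 1)) :
    matX H (ee i) (ee j) = H j i := by
  rw [matX_apply, EuclideanSpace.inner_single_right]
  simp [mCL_ee]
lemma trQ_matX (A H : Matrix (Fin (d + 1)) (Fin (d + 1)) ℝ) : trQ A (matX H) = (A * H).trace := by
  simp only [trQ, matX_ee, Matrix.trace, Matrix.diag, Matrix.mul_apply]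
lemma bil_eq_of_ee {X Y : Eucl (d + 1) →L[ℝ] Eucl (d + 1) →L[ℝ] ℝ}
    (h : ∀ i j, X (ee i) (ee j) = Y (ee i) (ee j)) (x y) : X x y = Y x y := by
  have := bil_vec X (fun i => x i) (fun i => y i)
  have h2 := bil_vec Y (fun i => x i) (fun i => y i)
  simp only [h] at this
  rw [← h2] at this
  exact this
lemma matX_symm {H : Matrix (Fin (d + 1)) (Fin (d + 1)) ℝ} (hH : H.IsSymm) (x y : Eucl (d + 1)) :
    matX H x y = matX H y x := by
  have := bil_eq_of_ee (X := matX H) (Y := (matX H).flip) (fun i j => by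
    simp only [ContinuousLinearMap.flip_apply, matX_ee]; exact hH.apply i j) x y
  exact this
lemma jet_of_test {φ φt : SpaceTime (d + 1) → ℝ} {gφ : SpaceTime (d + 1) → Eucl (d + 1)} {Hφ}
    {p₀ : SpaceTime (d + 1)} {ρ : ℝ} (hρ : 0 < ρ)
    (hT : ParabolicTest φ (cylE p₀.1 p₀.2 ρ ∩ DD d) φt gφ Hφ) (hp : p₀ ∈ DD d) :
    JetW (DD d ∩ past p₀) φ p₀ (φt p₀) (innerSL ℝ (gφ p₀)) (matX (Hφ p₀)) := by
  set C := cylE p₀.1 p₀.2 ρ ∩ DD d with hC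
  have hp0 : p₀ ∈ C := ⟨⟨by simp [hρ], by constructor <;> simp [hρ]⟩, hp⟩
  have hCc : Convex ℝ C := (((convex_ball _ _).prod (convex_Ioc _ _)).inter DD_convex)
  -- the space part
  have hslice : Convex ℝ {y : Eucl (d + 1) | (y, p₀.2) ∈ C} := by
    intro x hx y hy a b ha hb hab
    have := hCc hx hy ha hb hab
    simp only [Prod.smul_mk, Prod.mk_add_mk] at this
    have h2 : a • p₀.2 + b • p₀.2 = p₀.2 := by rw [← add_smul, hab, one_smul]
    rw [h2] at this
    exact this
  have hspace : (fun y => φ (y, p₀.2) - φ p₀ - ⟪gφ p₀, y - p₀.1⟫ -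
      1 / 2 * matX (Hφ p₀) (y - p₀.1) (y - p₀.1)) =o[𝓝[{y | (y, p₀.2) ∈ C}] p₀.1]
      fun y => ‖y - p₀.1‖ ^ 2 := by
    have := taylor2 (f := fun y => φ (y, p₀.2)) (g := fun y => innerSL ℝ (gφ (y, p₀.2)))
      (X := matX (Hφ p₀)) hslice (x := p₀.1) hp0 (by
        filter_upwards [self_mem_nhdsWithin] with y hy
        have h1 := (hT.spaceGrad (y, p₀.2) hy).hasFDerivWithinAt
        exact h1) (by
        have h1 := hT.spaceHess p₀ hp0
        exact (innerSL ℝ (E := Eucl (d + 1))).hasFDerivAt.comp_hasFDerivWithinAt p₀.1 h1)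
        (matX_symm (hT.symmHess p₀ hp0))
    simpa using this
  unfold JetW
  rw [isLittleO_iff]
  intro ε hε
  have h1 := hspace.def hε
  rw [eventually_nhdsWithin_iff] at h1
  have hfst : Tendsto (fun w : SpaceTime (d + 1) => w.1) (𝓝[DD d ∩ past p₀] p₀) (𝓝 p₀.1) :=
    continuous_fst.continuousAt.mono_left nhdsWithin_le_nhds
  have h2 := hfst.eventually h1
  have hcont := hT.contPhit p₀ hp0
  rw [Metric.continuousWithinAt_iff] at hcont
  obtain ⟨δ, hδ, hcont⟩ := hcont ε hε
  have h3 : ∀ᶠ w in 𝓝[DD d ∩ past p₀] p₀, w ∈ ball p₀ δ := nhdsWithin_le_nhds (ball_mem_nhds _ hδ)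
  have h4 : ∀ᶠ w in 𝓝[DD d ∩ past p₀] p₀, w.1 ∈ ball p₀.1 ρ :=
    hfst.eventually (ball_mem_nhds _ hρ)
  have hsnd : Tendsto (fun w : SpaceTime (d + 1) => w.2) (𝓝[DD d ∩ past p₀] p₀) (𝓝 p₀.2) :=
    continuous_snd.continuousAt.mono_left nhdsWithin_le_nhds
  have h5 : ∀ᶠ w in 𝓝[DD d ∩ past p₀] p₀, p₀.2 - ρ ^ 2 < w.2 :=
    hsnd.eventually (Ioi_mem_nhds (by nlinarith [pow_pos hρ 2]))
  filter_upwards [h2, h3, h4, h5, self_mem_nhdsWithin] with w k1 k2 k3 k4 k5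
  obtain ⟨k5, k6⟩ := k5
  have k6 : w.2 ≤ p₀.2 := k6
  have hin : ∀ s ∈ Icc w.2 p₀.2, (w.1, s) ∈ C := by
    intro s hs
    refine ⟨⟨k3, ⟨by show _ < s; linarith [hs.1], hs.2⟩⟩, k5.1, k5.2.1, k5.2.2.1.trans hs.1, hs.2.trans hp.2.2.2⟩
  have k7 := k1 (hin p₀.2 ⟨k6, le_rfl⟩)
  have hmv : ‖(φ (w.1, w.2) - φt p₀ * w.2) - (φ (w.1, p₀.2) - φt p₀ * p₀.2)‖ ≤ ε * ‖w.2 - p₀.2‖ := by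
    refine Convex.norm_image_sub_le_of_norm_hasDerivWithin_le (f := fun s => φ (w.1, s) - φt p₀ * s)
      (f' := fun s => φt (w.1, s) - φt p₀) (s := Icc w.2 p₀.2) ?_ ?_ (convex_Icc _ _)
      ⟨k6, le_rfl⟩ ⟨le_rfl, k6⟩
    · intro s hs
      have e1 := (hT.timeDeriv (w.1, s) (hin s hs)).mono (fun s' hs' => hin s' hs' : Icc w.2 p₀.2 ⊆ _)
      have e2 : HasDerivWithinAt (fun s : ℝ => φt p₀ * s) (φt p₀ * 1) (Icc w.2 p₀.2) s :=
        (hasDerivWithinAt_id _ _).const_mul _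
      have e3 := e1.sub e2
      rw [mul_one] at e3
      exact e3
    · intro s hs
      have := hcont (hin s hs) (by
        rw [mem_ball, Prod.dist_eq, max_lt_iff] at k2
        rw [Prod.dist_eq, max_lt_iff]
        refine ⟨k2.1, lt_of_le_of_lt ?_ k2.2⟩
        rw [Real.dist_eq, Real.dist_eq, abs_sub_comm, abs_sub_comm w.2, abs_of_nonneg, abs_of_nonneg]
        · show p₀.2 - s ≤ _
          linarith [hs.1]
        · linarith
        · linarith [hs.2])
      exact this.le
  rw [Real.norm_eq_abs, Real.norm_of_nonneg (by positivity : (0:ℝ) ≤ ‖w.1 - p₀.1‖^2)] at k7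
  rw [Real.norm_eq_abs, Real.norm_eq_abs] at hmv
  rw [Real.norm_eq_abs, Real.norm_eq_abs, abs_of_nonneg (NN_nonneg _ _)]
  unfold NN
  have e : φ w - φ p₀ - pol p₀ (φt p₀) (innerSL ℝ (gφ p₀)) (matX (Hφ p₀)) w
    = ((φ (w.1, w.2) - φt p₀ * w.2) - (φ (w.1, p₀.2) - φt p₀ * p₀.2)) +
      (φ (w.1, p₀.2) - φ p₀ - ⟪gφ p₀, w.1 - p₀.1⟫ - 1 / 2 * matX (Hφ p₀) (w.1 - p₀.1) (w.1 - p₀.1)) := by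
    simp only [pol, innerSL_apply_apply]; ring
  rw [e]
  refine (abs_add_le _ _).trans ?_
  linarith
lemma poly_test (D : Set (SpaceTime (d + 1))) (z : SpaceTime (d + 1)) (c a : ℝ) (P : Eucl (d + 1))
    (H : Matrix (Fin (d + 1)) (Fin (d + 1)) ℝ) (hH : H.IsSymm) :
    ParabolicTest (fun w => c + pol z a (innerSL ℝ P) (matX H) w) D (fun _ => a)
      (fun w => P + mCL H (w.1 - z.1)) (fun _ => H) where
  contPhi := by
    apply Continuous.continuousOn
    unfold pol; fun_prop
  contPhit := continuousOn_const
  contGrad := by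
    apply Continuous.continuousOn
    fun_prop
  contHess := continuousOn_const
  symmHess := fun _ _ => hH
  timeDeriv := by
    intro p _
    have h1 : HasDerivAt (fun s : ℝ => c + (a * (s - z.2) + (innerSL ℝ P) (p.1 - z.1)
      + 1 / 2 * matX H (p.1 - z.1) (p.1 - z.1))) (a * 1) p.2 :=
      ((((hasDerivAt_id p.2).sub_const z.2).const_mul a).add_const _ |>.add_const _).const_add c
    rw [mul_one] at h1
    exact h1.hasDerivWithinAt
  spaceGrad := by
    intro p _
    rw [hasGradientWithinAt_iff_hasFDerivWithinAt]
    apply HasFDerivAt.hasFDerivWithinAt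
    have e1 : HasFDerivAt (fun x : Eucl (d + 1) => x - z.1) (ContinuousLinearMap.id ℝ _) p.1 :=
      (hasFDerivAt_id p.1).sub_const z.1
    have e2 := (innerSL ℝ P).hasFDerivAt.comp p.1 e1
    have e3 := (matX H).hasFDerivAt.comp p.1 e1
    have e4 := (e3.clm_apply e1).const_mul (1 / 2 : ℝ)
    have e5 := ((e2.const_add (a * (p.2 - z.2))).add e4).const_add c
    refine e5.congr_fderiv ?_
    ext h
    simp only [ContinuousLinearMap.add_apply, ContinuousLinearMap.comp_apply,
      ContinuousLinearMap.smul_apply, ContinuousLinearMap.flip_apply, ContinuousLinearMap.id_apply,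
      Function.comp_apply, InnerProductSpace.toDual_apply_apply, inner_add_left, innerSL_apply_apply,
      smul_eq_mul]
    rw [matX_symm hH h, ← matX_apply]; ring
  spaceHess := by
    intro p _
    apply HasFDerivAt.hasFDerivWithinAt
    have e1 : HasFDerivAt (fun x : Eucl (d + 1) => x - z.1) (ContinuousLinearMap.id ℝ _) p.1 :=
      (hasFDerivAt_id p.1).sub_const z.1
    exact (((mCL H).hasFDerivAt.comp p.1 e1).const_add P)
def symX (X : Eucl (d + 1) →L[ℝ] Eucl (d + 1) →L[ℝ] ℝ) (ε : ℝ) :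
    Matrix (Fin (d + 1)) (Fin (d + 1)) ℝ :=
  fun i j => (X (ee i) (ee j) + X (ee j) (ee i)) / 2 + if i = j then 2 * ε else 0
lemma symX_symm (X : Eucl (d + 1) →L[ℝ] Eucl (d + 1) →L[ℝ] ℝ) (ε : ℝ) : (symX X ε).IsSymm := by
  ext i j
  simp only [Matrix.transpose_apply, symX, eq_comm (a := j)]
  ring
def idX (d : ℕ) : Eucl (d + 1) →L[ℝ] Eucl (d + 1) →L[ℝ] ℝ := innerSL ℝ
lemma idX_apply (x y : Eucl (d + 1)) : idX d x y = ⟪x, y⟫ := rfl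
lemma symX_quad (X : Eucl (d + 1) →L[ℝ] Eucl (d + 1) →L[ℝ] ℝ) (ε : ℝ) (x : Eucl (d + 1)) :
    1 / 2 * matX (symX X ε) x x = 1 / 2 * X x x + ε * ‖x‖ ^ 2 := by
  have h := bil_eq_of_ee (X := matX (symX X ε))
    (Y := (1 / 2 : ℝ) • (X + X.flip) + (2 * ε) • idX d) (fun i j => by
      rw [matX_ee]
      simp only [symX, ContinuousLinearMap.add_apply, ContinuousLinearMap.smul_apply,
        ContinuousLinearMap.flip_apply, idX_apply, smul_eq_mul]
      rw [EuclideanSpace.inner_single_right]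
      simp [Pi.single_apply]
      ring) x x
  rw [h]
  simp only [ContinuousLinearMap.add_apply, ContinuousLinearMap.smul_apply,
        ContinuousLinearMap.flip_apply, idX_apply, smul_eq_mul, real_inner_self_eq_norm_sq]
  ring
lemma trace_symX (S : Dat d) (t : ℝ) (X : Eucl (d + 1) →L[ℝ] Eucl (d + 1) →L[ℝ] ℝ) (ε : ℝ) :
    (S.Q t * symX X ε).trace = trQ (S.Q t) X + 2 * ε * ∑ i, S.Q t i i := by
  simp only [Matrix.trace, Matrix.diag, Matrix.mul_apply, symX, trQ]
  have h1 : ∑ i, ∑ j, S.Q t i j * X (ee j) (ee i) = ∑ i, ∑ j, S.Q t i j * X (ee i) (ee j) := by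
    rw [Finset.sum_comm]
    exact Finset.sum_congr rfl fun i _ => Finset.sum_congr rfl fun j _ => by rw [S.symm]
  have h2 : ∑ i, ∑ j, S.Q t i j * (if j = i then 2 * ε else 0) = 2 * ε * ∑ i, S.Q t i i := by
    simp [Finset.mul_sum, mul_comm]
  have h3 : ∀ i j, S.Q t i j * ((X (ee j) (ee i) + X (ee i) (ee j)) / 2 + if j = i then 2 * ε else 0)
    = 1 / 2 * (S.Q t i j * X (ee j) (ee i)) + 1 / 2 * (S.Q t i j * X (ee i) (ee j))
      + S.Q t i j * (if j = i then 2 * ε else 0) := by intro i j; ring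
  simp only [h3, Finset.sum_add_distrib, ← Finset.mul_sum]
  rw [h1, h2]; ring
lemma touch_poly {u : SpaceTime (d + 1) → ℝ} {z} (hz : z ∈ DD d) {a p X}
    (h : SJ (DD d) u z a p X) {ε : ℝ} (hε : 0 < ε) : ∃ ρ > 0,
    TouchesAbove (fun w => u z + pol z (a - ε) (innerSL ℝ ((InnerProductSpace.toDual ℝ _).symm p))
      (matX (symX X ε)) w) u (cylE z.1 z.2 ρ ∩ DD d) z := by
  have h1 := h ε hε
  rw [eventually_nhdsWithin_iff, Metric.eventually_nhds_iff] at h1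
  obtain ⟨r, hr, h1⟩ := h1
  set ρ := min r 1
  have hρ : 0 < ρ := lt_min hr one_pos
  refine ⟨ρ, hρ, ⟨⟨by simp [hρ], by constructor <;> simp [hρ]⟩, hz⟩, by simp [pol], ?_⟩
  rintro w ⟨⟨hw1, hw2⟩, hw3⟩
  have hρ1 : ρ ≤ 1 := min_le_right _ _
  have hρr : ρ ≤ r := min_le_left _ _
  have hd : dist w z < r := by
    rw [Prod.dist_eq, max_lt_iff]
    refine ⟨lt_of_lt_of_le hw1 hρr, ?_⟩
    rw [Real.dist_eq, abs_lt]
    have := hw2.1; have := hw2.2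
    constructor <;> nlinarith
  have h2 := h1 hd ⟨hw3, hw2.2⟩
  have h3 : w.2 ≤ z.2 := hw2.2
  have e : u z + pol z (a - ε) (innerSL ℝ ((InnerProductSpace.toDual ℝ _).symm p)) (matX (symX X ε)) w
    = u z + pol z a p X w + ε * NN z w := by
    unfold pol NN
    rw [symX_quad, abs_of_nonpos (by linarith)]
    simp only [innerSL_apply_apply, InnerProductSpace.toDual_symm_apply]
    ring
  show u w ≤ u z + pol z (a - ε) (innerSL ℝ ((InnerProductSpace.toDual ℝ _).symm p)) (matX (symX X ε)) w
  rw [e]; exact h2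
lemma sub_of_tests (S : Dat d) {u : SpaceTime (d + 1) → ℝ}
    (h : ∀ (z : SpaceTime (d + 1)) (a : ℝ) (P : Eucl (d + 1)) (H : Matrix (Fin (d + 1)) (Fin (d + 1)) ℝ),
      z ∈ DD d → H.IsSymm →
      (∃ ρ > 0, TouchesAbove (fun w => u z + pol z a (innerSL ℝ P) (matX H) w) u (cylE z.1 z.2 ρ ∩ DD d) z) →
      (z ∈ Kc d 1 → S.lam * a ≤ (S.Q z.2 * H).trace) ∧ (z ∈ Fc d 1 → a ≤ ⟪S.v z.2, P⟫)) :
    Sub S u := by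
  constructor
  · intro z hz a p X hj
    have h1 : ∀ ε > 0, S.lam * (a - ε) ≤ trQ (S.Q z.2) X + 2 * ε * ∑ i, S.Q z.2 i i := by
      intro ε hε
      have := (h z _ _ _ (Kc_sub hz) (symX_symm X ε) (touch_poly (Kc_sub hz) hj hε)).1 hz
      rwa [trace_symX] at this
    have c : Continuous (fun ε : ℝ => trQ (S.Q z.2) X + 2 * ε * ∑ i, S.Q z.2 i i - S.lam * (a - ε)) := by
      fun_prop
    have := ge_of_tendsto ((c.tendsto 0).mono_left (nhdsWithin_le_nhds (s := Ioi (0 : ℝ))))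
      (by filter_upwards [self_mem_nhdsWithin] with ε hε using sub_nonneg.2 (h1 ε hε))
    simp at this
    exact this
  · intro z hz a p X hj
    have h1 : ∀ ε > 0, a - ε ≤ p (S.v z.2) := by
      intro ε hε
      have := (h z _ _ _ (Fc_sub hz) (symX_symm X ε) (touch_poly (Fc_sub hz) hj hε)).2 hz
      rwa [real_inner_comm, InnerProductSpace.toDual_symm_apply] at this
    exact le_of_forall_pos_le_add fun ε hε => by linarith [h1 ε hε]
def Agree (S : Dat d) (lam : ℝ) (Q : ℝ → Matrix (Fin (d + 1)) (Fin (d + 1)) ℝ)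
    (v : ℝ → Eucl (d + 1)) : Prop :=
  S.lam = lam ∧ ∀ t ∈ Icc (-1 : ℝ) 0, S.Q t = Q t ∧ S.v t = v t
lemma agree_at {S : Dat d} {lam Q v} (h : Agree S lam Q v) {z} (hz : z ∈ DD d) :
    S.Q z.2 = Q z.2 ∧ S.v z.2 = v z.2 := h.2 _ ⟨hz.2.2.1, hz.2.2.2⟩
lemma sub_of_oblique {S : Dat d} {lam Q v} (hA : Agree S lam Q v) {η : SpaceTime (d + 1) → ℝ}
    (h : ObliqueSub d lam Q v η) : Sub S η := by
  refine sub_of_tests S fun z a P H hz hH ⟨ρ, hρ, hT⟩ => ?_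
  have := h.2 _ _ _ _ z ρ hρ (poly_test _ z (η z) a P H hH)
    (by rw [closure_Kc]; exact hT)
  rw [hA.1, (agree_at hA hz).1, (agree_at hA hz).2]
  simpa using this
lemma sub_of_obliqueSup {S : Dat d} {lam Q v} (hA : Agree S lam Q v) {η : SpaceTime (d + 1) → ℝ}
    (h : ObliqueSup d lam Q v η) : Sub S (fun w => - η w) := by
  refine sub_of_tests S fun z a P H hz hH ⟨ρ, hρ, hT⟩ => ?_
  have hneg : (-H).IsSymm := by
    ext i j; simp [hH.apply i j]
  have e : ∀ w, pol z (-a) (innerSL ℝ (-P)) (matX (-H)) w = - pol z a (innerSL ℝ P) (matX H) w := by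
    intro w; simp [pol, matX_apply, mCL]; ring
  have := h.2 _ _ _ _ z ρ hρ (poly_test _ z (η z) (-a) (-P) (-H) hneg) (by
    rw [closure_Kc]
    refine ⟨hT.1, by simp [pol], fun w hw => ?_⟩
    have h2 := hT.2.2 w hw
    have h3 := e w
    show η z + pol z (-a) (innerSL ℝ (-P)) (matX (-H)) w ≤ η w
    have h4 : - η w ≤ - η z + pol z a (innerSL ℝ P) (matX H) w := h2
    linarith)
  rw [hA.1, (agree_at hA hz).1, (agree_at hA hz).2]
  simp at this
  exact this
lemma oblique_of_sub {S : Dat d} {lam Q v} (hA : Agree S lam Q v) {η : SpaceTime (d + 1) → ℝ}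
    (hc : ContinuousOn η (DD d)) (h : Sub S η) : ObliqueSub d lam Q v η := by
  refine ⟨hc.mono (by rw [KcP_eq]; exact diff_subset), ?_⟩
  intro φ φt gφ Hφ p₀ ρ hρ hT ht
  rw [closure_Kc] at hT ht
  have hp := ht.1.2
  have hj := jet_of_test hρ hT hp
  have hs : SJ (DD d) η p₀ (φt p₀) (innerSL ℝ (gφ p₀)) (matX (Hφ p₀)) := by
    refine SJ.of_max ?_ hj
    have h4 : ∀ᶠ w in 𝓝[DD d ∩ past p₀] p₀, w ∈ cylE p₀.1 p₀.2 ρ := by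
      have : ball p₀.1 ρ ×ˢ Ioi (p₀.2 - ρ ^ 2) ∈ 𝓝 p₀ :=
        prod_mem_nhds (ball_mem_nhds _ hρ) (Ioi_mem_nhds (by nlinarith [pow_pos hρ 2]))
      filter_upwards [nhdsWithin_le_nhds this, self_mem_nhdsWithin] with w h1 h2
      exact ⟨h1.1, h1.2, h2.2⟩
    filter_upwards [h4, self_mem_nhdsWithin] with w h1 h2
    have := ht.2.2 w ⟨h1, h2.1⟩
    have := ht.2.1
    linarith
  rw [← hA.1, ← (agree_at hA hp).1, ← (agree_at hA hp).2, ← trQ_matX]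
  refine ⟨fun hk => h.1 _ hk _ _ _ hs, fun hf => ?_⟩
  have := h.2 _ hf _ _ _ hs
  rwa [innerSL_apply_apply, real_inner_comm] at this
lemma obliqueSup_of_sub {S : Dat d} {lam Q v} (hA : Agree S lam Q v) {η : SpaceTime (d + 1) → ℝ}
    (hc : ContinuousOn η (DD d)) (h : Sub S (fun w => - η w)) : ObliqueSup d lam Q v η := by
  refine ⟨hc.mono (by rw [KcP_eq]; exact diff_subset), ?_⟩
  intro φ φt gφ Hφ p₀ ρ hρ hT ht
  rw [closure_Kc] at hT ht
  have hp := ht.1.2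
  have hj := (jet_of_test hρ hT hp).neg
  have hs : SJ (DD d) (fun w => - η w) p₀ (-φt p₀) (-innerSL ℝ (gφ p₀)) (-matX (Hφ p₀)) := by
    refine SJ.of_max ?_ hj
    have h4 : ∀ᶠ w in 𝓝[DD d ∩ past p₀] p₀, w ∈ cylE p₀.1 p₀.2 ρ := by
      have : ball p₀.1 ρ ×ˢ Ioi (p₀.2 - ρ ^ 2) ∈ 𝓝 p₀ :=
        prod_mem_nhds (ball_mem_nhds _ hρ) (Ioi_mem_nhds (by nlinarith [pow_pos hρ 2]))
      filter_upwards [nhdsWithin_le_nhds this, self_mem_nhdsWithin] with w h1 h2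
      exact ⟨h1.1, h1.2, h2.2⟩
    filter_upwards [h4, self_mem_nhdsWithin] with w h1 h2
    have := ht.2.2 w ⟨h1, h2.1⟩
    have := ht.2.1
    linarith
  rw [← hA.1, ← (agree_at hA hp).1, ← (agree_at hA hp).2, ← trQ_matX]
  refine ⟨fun hk => ?_, fun hf => ?_⟩
  · have := h.1 _ hk _ _ _ hs
    rw [trQ_neg] at this; linarith
  · have := h.2 _ hf _ _ _ hs
    rw [ContinuousLinearMap.neg_apply, innerSL_apply_apply, real_inner_comm] at this
    linarith
def Trig (d : ℕ) : Submodule ℝ (Eucl (d + 1) → ℝ) :=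
  Submodule.span ℝ {f | ∃ (k : Eucl (d + 1)) (θ : ℝ), f = fun x => Real.cos (⟪k, x⟫ + θ)}
lemma Trig.cos (k : Eucl (d + 1)) (θ : ℝ) : (fun x => Real.cos (⟪k, x⟫ + θ)) ∈ Trig d :=
  Submodule.subset_span ⟨k, θ, rfl⟩
lemma Trig.const (c : ℝ) : (fun _ => c) ∈ Trig d := by
  have := (Trig d).smul_mem c (Trig.cos 0 0)
  convert this using 1
  ext x; simp
lemma Trig.mul {f g : Eucl (d + 1) → ℝ} (hf : f ∈ Trig d) (hg : g ∈ Trig d) :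
    (fun x => f x * g x) ∈ Trig d := by
  induction hf using Submodule.span_induction with
  | zero => simpa using Trig.const (d := d) 0
  | add f1 f2 _ _ h1 h2 =>
    convert (Trig d).add_mem h1 h2 using 1
    ext x; simp [add_mul]
  | smul c f1 _ h1 =>
    convert (Trig d).smul_mem c h1 using 1
    ext x; simp [mul_assoc]
  | mem f hf =>
    obtain ⟨k, θ, rfl⟩ := hf
    induction hg using Submodule.span_induction with
    | zero => simpa using Trig.const (d := d) 0
    | add f1 f2 _ _ h1 h2 =>
      convert (Trig d).add_mem h1 h2 using 1
      ext x; simp [mul_add]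
    | smul c f1 _ h1 =>
      convert (Trig d).smul_mem c h1 using 1
      ext x; simp; ring
    | mem g hg =>
      obtain ⟨k', θ', rfl⟩ := hg
      convert (Trig d).add_mem ((Trig d).smul_mem (1 / 2 : ℝ) (Trig.cos (k + k') (θ + θ')))
        ((Trig d).smul_mem (1 / 2 : ℝ) (Trig.cos (k - k') (θ - θ'))) using 1
      ext x
      simp only [Pi.add_apply, Pi.smul_apply, smul_eq_mul, inner_add_left, inner_sub_left]
      rw [show ⟪k, x⟫ + ⟪k', x⟫ + (θ + θ') = (⟪k, x⟫ + θ) + (⟪k', x⟫ + θ') by ring,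
        show ⟪k, x⟫ - ⟪k', x⟫ + (θ - θ') = (⟪k, x⟫ + θ) - (⟪k', x⟫ + θ') by ring,
        Real.cos_add (⟪k, x⟫ + θ), Real.cos_sub (⟪k, x⟫ + θ)]
      ring
def sn (c : Eucl (d + 1)) (x : Eucl (d + 1)) : Fin (d + 1) → Icc (-1 : ℝ) 1 :=
  fun i => ⟨Real.sin (x i - c i), Real.sin_mem_Icc _⟩
def trigAlg (c : Eucl (d + 1)) : Subalgebra ℝ C(Fin (d + 1) → Icc (-1 : ℝ) 1, ℝ) where
  carrier := {f | ∃ T ∈ Trig d, ∀ x, T x = f (sn c x)}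
  mul_mem' := by
    rintro f g ⟨T, hT, h1⟩ ⟨T', hT', h2⟩
    exact ⟨_, Trig.mul hT hT', fun x => by simp [h1, h2]⟩
  add_mem' := by
    rintro f g ⟨T, hT, h1⟩ ⟨T', hT', h2⟩
    exact ⟨_, (Trig d).add_mem hT hT', fun x => by simp [h1, h2]⟩
  algebraMap_mem' := fun r => ⟨_, Trig.const r, fun x => by simp⟩
lemma trigAlg_sep (c : Eucl (d + 1)) : (trigAlg c).SeparatesPoints := by
  intro y y' hy
  obtain ⟨i, hi⟩ := Function.ne_iff.1 hy
  refine ⟨fun y => (y i : ℝ), ⟨⟨fun y => (y i : ℝ), by fun_prop⟩, ⟨_, Trig.cos (ee i) (- c i - Real.pi / 2), fun x => ?_⟩, rfl⟩, ?_⟩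
  · rw [EuclideanSpace.inner_single_left]
    simp only [sn, map_one, one_mul, ContinuousMap.coe_mk]
    rw [show x i + (- c i - Real.pi / 2) = (x i - c i) - Real.pi / 2 by ring, Real.cos_sub_pi_div_two]
  · intro h; exact hi (Subtype.ext h)
lemma trig_approx (c : Eucl (d + 1)) (g : Eucl (d + 1) → ℝ) (hg : Continuous g) {e B : ℝ} (he : 0 < e)
    (hB : ∀ x, (∀ i, |x i - c i| ≤ Real.pi / 2) → |g x| ≤ B) :
    ∃ T ∈ Trig d, (∀ x, (∀ i, |x i - c i| ≤ Real.pi / 2) → |T x - g x| ≤ e) ∧ ∀ x, |T x| ≤ B + e := by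
  set G : C(Fin (d + 1) → Icc (-1 : ℝ) 1, ℝ) :=
    ⟨fun y => g (c + vec (fun i => Real.arcsin (y i))), by
      have h1 : Continuous (fun y : Fin (d + 1) → Icc (-1 : ℝ) 1 => (fun i => Real.arcsin (y i) : Fin (d + 1) → ℝ)) := by
        refine continuous_pi fun i => Real.continuous_arcsin.comp (by fun_prop)
      exact hg.comp (continuous_const.add ((PiLp.continuous_toLp 2 _).comp h1))⟩ with hG
  obtain ⟨f, hf⟩ := ContinuousMap.exists_mem_subalgebra_near_continuousMap_of_separatesPoints
    (trigAlg c) (trigAlg_sep c) G e he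
  obtain ⟨f, T, hT, h1⟩ := f
  have h2 : ∀ y, |f y - G y| ≤ e := fun y =>
    ((ContinuousMap.norm_coe_le_norm (f - G) y).trans hf.le)
  refine ⟨T, hT, fun x hx => ?_, fun x => ?_⟩
  · have h3 := h2 (sn c x)
    rw [← h1] at h3
    have : G (sn c x) = g x := by
      show g (c + vec (fun i => Real.arcsin (Real.sin (x i - c i)))) = g x
      congr 1
      ext i
      have := abs_le.1 (hx i)
      have e := Real.arcsin_sin (x := x i - c i) (by linarith) (by linarith)
      show c i + Real.arcsin (Real.sin (x i - c i)) = x i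
      rw [e]; ring
    rwa [this] at h3
  · have h3 := h2 (sn c x)
    rw [← h1] at h3
    have h4 : |G (sn c x)| ≤ B := by
      refine hB _ fun i => ?_
      rw [abs_le]
      have e1 := Real.arcsin_le_pi_div_two (sn c x i)
      have e2 := Real.neg_pi_div_two_le_arcsin (sn c x i)
      simp only [PiLp.add_apply, vec, add_sub_cancel_left]
      exact ⟨e2, e1⟩
    have := abs_sub_abs_le_abs_sub (T x) (G (sn c x))
    linarith
lemma maxP {Z : Type*} [NormedAddCommGroup Z] [ProperSpace Z] (c : Z) (R τ0 τ1 : ℝ)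
    (G : Z × ℝ → ℝ) (hG : UpperSemicontinuousOn G (closedBall c R ×ˢ Icc τ0 τ1))
    (hbot : ∀ x ∈ closedBall c R, G (x, τ0) ≤ 0)
    (hlat : ∀ x t, t ∈ Icc τ0 τ1 → ‖x - c‖ = R → G (x, t) ≤ 0)
    (hint : ∀ z : Z × ℝ, z.1 ∈ ball c R → z.2 ∈ Ioc τ0 τ1 → 0 < G z →
      (∀ w ∈ closedBall c R ×ˢ Icc τ0 τ1, G w ≤ G z) → False) :
    ∀ z ∈ closedBall c R ×ˢ Icc τ0 τ1, G z ≤ 0 := by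
  intro z0 hz0
  obtain ⟨z, hz, hmax⟩ := hG.exists_isMaxOn ⟨z0, hz0⟩ ((isCompact_closedBall c R).prod isCompact_Icc)
  by_contra hpos
  push Not at hpos
  have h1 : 0 < G z := hpos.trans_le (hmax hz0)
  refine hint z ?_ ?_ h1 (fun w hw => hmax hw)
  · rcases (mem_closedBall.1 hz.1).lt_or_eq with h | h
    · exact h
    · rw [dist_eq_norm] at h
      have := hlat z.1 z.2 hz.2 h
      exact absurd h1 (not_lt.2 this)
  · refine ⟨lt_of_le_of_ne hz.2.1 fun h => ?_, hz.2.2⟩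
    have := hbot z.1 hz.1
    rw [h] at this
    exact absurd h1 (not_lt.2 this)
lemma cyl_time {Z : Type*} [NormedAddCommGroup Z] {c : Z} {R τ0 τ1 : ℝ} {z : Z × ℝ}
    (h1 : z.1 ∈ ball c R) (h2 : z.2 ∈ Ioc τ0 τ1) :
    ∀ᶠ s in 𝓝[>] (0 : ℝ), (z.1, z.2 - s) ∈ closedBall c R ×ˢ Icc τ0 τ1 := by
  have h3 : ∀ᶠ s in 𝓝[>] (0 : ℝ), s < z.2 - τ0 := nhdsWithin_le_nhds (Iio_mem_nhds (by linarith [h2.1]))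
  filter_upwards [h3, self_mem_nhdsWithin] with s h3 h4
  have h4 : 0 < s := h4
  exact ⟨ball_subset_closedBall h1, by show τ0 ≤ z.2 - s; linarith, by show z.2 - s ≤ τ1; linarith [h2.2]⟩
lemma cyl_dir {Z : Type*} [NormedAddCommGroup Z] [NormedSpace ℝ Z] {c : Z} {R τ0 τ1 : ℝ} {z : Z × ℝ}
    (h1 : z.1 ∈ ball c R) (h2 : z.2 ∈ Ioc τ0 τ1) (k : Z) :
    ∀ᶠ s in 𝓝[>] (0 : ℝ), (z.1 + s • k, z.2) ∈ closedBall c R ×ˢ Icc τ0 τ1 := by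
  apply nhdsWithin_le_nhds
  have c1 : Continuous (fun s : ℝ => z.1 + s • k) := by fun_prop
  have : ∀ᶠ s in 𝓝 (0 : ℝ), z.1 + s • k ∈ ball c R :=
    c1.continuousAt.eventually (isOpen_ball.mem_nhds (by simpa using h1))
  filter_upwards [this] with s hs
  exact ⟨ball_subset_closedBall hs, h2.1.le, h2.2⟩
lemma max_jet {Z : Type*} [NormedAddCommGroup Z] [NormedSpace ℝ Z] {c : Z} {R τ0 τ1 : ℝ} {z : Z × ℝ}
    (h1 : z.1 ∈ ball c R) (h2 : z.2 ∈ Ioc τ0 τ1) {G : Z × ℝ → ℝ}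
    (hm : ∀ w ∈ closedBall c R ×ˢ Icc τ0 τ1, G w ≤ G z) {s : Set (Z × ℝ)} {a p X}
    (hs : closedBall c R ×ˢ Icc τ0 τ1 ⊆ s)
    (hj : JetW s G z a p X) : 0 ≤ a ∧ p = 0 ∧ ∀ k, X k k ≤ 0 := by
  have h := SJ.zero_of_max (D := closedBall c R ×ˢ Icc τ0 τ1) (by
    filter_upwards [self_mem_nhdsWithin] with w hw using hm w hw.1) (hj.mono (inter_subset_left.trans hs))
  have e1 := zero_time h (cyl_time h1 h2)
  have e2 := zero_full h (cyl_dir h1 h2)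
  refine ⟨by linarith, neg_eq_zero.1 e2.1, fun k => ?_⟩
  have := e2.2 k
  simp at this
  exact this
def Heat (S : Dat d) (h : SpaceTime (d + 1) → ℝ) : Prop :=
  ∀ z, ∃ a p X, JetW univ h z a p X ∧ S.lam * a = trQ (S.Q z.2) X
lemma Heat.cont {S : Dat d} {h} (hh : Heat S h) : Continuous h := by
  rw [continuous_iff_continuousAt]
  intro z
  obtain ⟨a, p, X, hj, _⟩ := hh z
  have := hj.tendsto
  rwa [nhdsWithin_univ] at this
lemma Q_cont (S : Dat d) (i j) : Continuous (fun t => S.Q t i j) := by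
  have : LipschitzWith (Real.toNNReal S.L) (fun t => S.Q t i j) :=
    LipschitzWith.of_dist_le_mul fun t s => by
      rw [Real.dist_eq, Real.dist_eq, Real.coe_toNNReal _ S.L_pos.le]
      exact S.lipQ t s i j
  exact this.continuous
lemma heat_exists (S : Dat d) (s : ℝ) {T} (hT : T ∈ Trig d) :
    ∃ h, (∀ x, h (x, s) = T x) ∧ Heat S h ∧ ∃ B', ∀ x t, s ≤ t → |h (x, t)| ≤ B' := by
  induction hT using Submodule.span_induction with
  | zero => exact ⟨fun _ => 0, fun x => rfl, fun z => ⟨0, 0, 0, JetW.const 0, by simp [trQ_zero]⟩, 0, by simp⟩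
  | add f1 f2 _ _ h1 h2 =>
    obtain ⟨g1, a1, b1, B1, c1⟩ := h1
    obtain ⟨g2, a2, b2, B2, c2⟩ := h2
    refine ⟨fun w => g1 w + g2 w, fun x => by simp [a1, a2], fun z => ?_, B1 + B2, fun x t ht =>
      (abs_add_le _ _).trans (add_le_add (c1 x t ht) (c2 x t ht))⟩
    obtain ⟨_, _, _, j1, e1⟩ := b1 z
    obtain ⟨_, _, _, j2, e2⟩ := b2 z
    exact ⟨_, _, _, j1.add j2, by rw [trQ_add, mul_add, e1, e2]⟩
  | smul c f1 _ h1 =>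
    obtain ⟨g1, a1, b1, B1, c1⟩ := h1
    refine ⟨fun w => c * g1 w, fun x => by simp [a1], fun z => ?_, |c| * B1, fun x t ht => by
      rw [abs_mul]; exact mul_le_mul_of_nonneg_left (c1 x t ht) (abs_nonneg _)⟩
    obtain ⟨_, _, _, j1, e1⟩ := b1 z
    exact ⟨_, _, _, j1.smul c, by rw [trQ_smul, ← e1]; ring⟩
  | mem f hf =>
    obtain ⟨k, θ, rfl⟩ := hf
    set q : ℝ → ℝ := fun τ => ∑ i, ∑ j, S.Q τ i j * (k i * k j) with hq
    have hqc : Continuous q := by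
      refine continuous_finset_sum _ fun i _ => continuous_finset_sum _ fun j _ =>
        (Q_cont S i j).mul continuous_const
    have hq0 : ∀ τ, 0 ≤ q τ := fun τ => le_trans (by
      have := S.Λ_pos; positivity) (S.ell τ (fun i => k i))
    set g : ℝ → ℝ := fun t => Real.exp (- (S.lam⁻¹ * ∫ τ in s..t, q τ)) with hg
    have hgd : ∀ t, HasDerivAt g (g t * (-(S.lam⁻¹ * q t))) t := fun t =>
      ((((hqc.integral_hasStrictDerivAt s t).hasDerivAt).const_mul _).neg).exp
    refine ⟨fun w => Real.cos (⟪k, w.1⟫ + θ) * g w.2, fun x => by simp [hg], fun z => ?_, 1, fun x t ht => ?_⟩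
    · have j1 := (JetW.lin (s := univ) (z := z) (innerSL ℝ k)).add_const θ
      have j2 := j1.comp (T2_of_deriv (F := Real.cos) (F1 := fun s => - Real.sin s)
        (Eventually.of_forall fun s => Real.hasDerivAt_cos s) (Real.hasDerivAt_sin _).neg)
      have j3 := j2.mul (JetW.time (s := univ) (z := z) (hgd z.2))
      refine ⟨_, _, _, j3, ?_⟩
      have e1 : trQ (S.Q z.2) ((innerSL ℝ k : Eucl (d + 1) →L[ℝ] ℝ).smulRight (innerSL ℝ k : Eucl (d + 1) →L[ℝ] ℝ)) = q z.2 := by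
        simp [trQ, hq, EuclideanSpace.inner_single_right]
      simp only [trQ_add, trQ_smul, e1, trQ_zero]
      have e2 : trQ (S.Q z.2) (((-Real.sin ((innerSL ℝ k) z.1 + θ)) • (innerSL ℝ k : Eucl (d + 1) →L[ℝ] ℝ)).smulRight 0) = 0 := by
        simp [trQ]
      have e3 : trQ (S.Q z.2) ((0 : Eucl (d + 1) →L[ℝ] ℝ).smulRight ((-Real.sin ((innerSL ℝ k) z.1 + θ)) • (innerSL ℝ k : Eucl (d + 1) →L[ℝ] ℝ))) = 0 := by
        simp [trQ]
      rw [e2, e3]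
      have := S.lam_pos
      simp only [innerSL_apply_apply]
      field_simp
      ring
    · rw [abs_mul]
      have e1 := Real.abs_cos_le_one (⟪k, x⟫ + θ)
      have e2 : |g t| ≤ 1 := by
        rw [hg, abs_of_pos (Real.exp_pos _), Real.exp_le_one_iff]
        have := intervalIntegral.integral_nonneg ht (fun u _ => hq0 u) (μ := volume)
        have := S.lam_pos
        simp only [Left.neg_nonpos_iff]
        positivity
      exact mul_le_one₀ e1 (abs_nonneg _) e2
lemma trQ_idX_le (S : Dat d) (t : ℝ) : trQ (S.Q t) (idX d) ≤ (d + 1) * S.B := by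
  have : trQ (S.Q t) (idX d) = ∑ i, S.Q t i i := by
    simp only [trQ, idX_apply, EuclideanSpace.inner_single_left]
    simp [Pi.single_apply]
  rw [this]
  refine (Finset.sum_le_card_nsmul _ _ S.B fun i _ => (le_abs_self _).trans (S.qB t i i)).trans ?_
  simp
lemma idX_quad {s : Set (SpaceTime (d + 1))} {z : SpaceTime (d + 1)} (x0 : Eucl (d + 1)) :
    JetW s (fun w => ‖w.1 - x0‖ ^ 2) z 0 ((2 : ℝ) • idX d (z.1 - x0)) ((2 : ℝ) • idX d) := by
  refine IsLittleO.congr_left (JetW.quad (s := s) (z := z) (idX d) x0) fun w => ?_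
  simp only [pol, idX_apply, real_inner_self_eq_norm_sq, ContinuousLinearMap.add_apply,
    ContinuousLinearMap.smul_apply, ContinuousLinearMap.flip_apply, smul_eq_mul]
  rw [real_inner_comm (z.1 - x0)]
  simp [idX_apply]
  ring
lemma trQ_nonpos (S : Dat d) (t : ℝ) {X : Eucl (d + 1) →L[ℝ] Eucl (d + 1) →L[ℝ] ℝ}
    (h : ∀ x, X x x ≤ 0) : trQ (S.Q t) X ≤ 0 := by
  obtain ⟨m, ξ, hξ⟩ := repr1 S t
  rw [hξ]
  exact Finset.sum_nonpos fun k _ => h _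
lemma heat_max (S : Dat d) (s : ℝ) {h : SpaceTime (d + 1) → ℝ} (hh : Heat S h) {B B' : ℝ}
    (hB : ∀ x, h (x, s) ≤ B) (hB' : ∀ x t, s ≤ t → |h (x, t)| ≤ B') (x : Eucl (d + 1)) (t : ℝ)
    (ht : s ≤ t) : h (x, t) ≤ B := by
  set C : ℝ := 2 * ((d + 1) * S.B) * S.lam⁻¹ + 1 with hC
  have hlam := S.lam_pos
  have hBp := S.B_pos
  have hCp : 0 < C := by positivity
  have key : ∀ ν > 0, h (x, t) ≤ B + ν * (‖x‖ ^ 2 + C * (t - s)) := by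
    intro ν hν
    obtain ⟨R, hR1, hR2⟩ : ∃ R, ‖x‖ ≤ R ∧ B' - B ≤ ν * R ^ 2 := by
      refine ⟨‖x‖ + (|B' - B| / ν + 1), by
        have : 0 ≤ |B' - B| / ν + 1 := by positivity
        linarith, ?_⟩
      have e1 : 0 ≤ |B' - B| / ν := by positivity
      have e2 : |B' - B| / ν ≤ (‖x‖ + (|B' - B| / ν + 1)) ^ 2 := by
        nlinarith [norm_nonneg x]
      calc B' - B ≤ |B' - B| := le_abs_self _
        _ = ν * (|B' - B| / ν) := by field_simp
        _ ≤ _ := mul_le_mul_of_nonneg_left e2 hν.le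
    have := maxP (0 : Eucl (d + 1)) R s t (fun w => h w - B - ν * (‖w.1 - 0‖ ^ 2 + C * (w.2 - s))) (by
        apply Continuous.upperSemicontinuous |> fun h => (h ?_).upperSemicontinuousOn _
        have := hh.cont; fun_prop) (fun y hy => by
        have := hB y; simp; nlinarith [norm_nonneg y, mul_nonneg hν.le (sq_nonneg ‖y‖)]) (fun y τ hτ hy => by
        have := (le_abs_self _).trans (hB' y τ hτ.1)
        simp only [hy]
        have : 0 ≤ C * (τ - s) := mul_nonneg hCp.le (by linarith [hτ.1])
        have : 0 ≤ ν * (C * (τ - s)) := by positivity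
        nlinarith) (fun z hz1 hz2 _ hz4 => by
        obtain ⟨a, p, X, hj, he⟩ := hh z
        have hjt : JetW univ (fun w : SpaceTime (d + 1) => C * (w.2 - s)) z (C * 1) 0 0 :=
          JetW.time (g := fun τ => C * (τ - s)) (((hasDerivAt_id z.2).sub_const s).const_mul C)
        have hj2 := (hj.add_const (-B)).sub (((idX_quad (s := univ) (z := z) 0).add hjt).smul ν)
        obtain ⟨k1, _, k3⟩ := max_jet hz1 hz2 hz4 (subset_univ _) hj2
        have k4 := trQ_nonpos S z.2 k3
        rw [trQ_sub, trQ_smul, trQ_add, trQ_smul, trQ_zero] at k4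
        have k5 := trQ_idX_le S z.2
        have k6 : S.lam * C = 2 * ((d + 1) * S.B) + S.lam := by rw [hC]; field_simp
        have k7 : 0 ≤ S.lam * (a - ν * (0 + C * 1)) := mul_nonneg hlam.le k1
        nlinarith [mul_pos hν hlam]) (x, t) ⟨by simpa using hR1, ht, le_rfl⟩
    simp at this
    linarith
  have c : Continuous (fun ν : ℝ => B + ν * (‖x‖ ^ 2 + C * (t - s))) := by fun_prop
  have := ge_of_tendsto ((c.tendsto 0).mono_left (nhdsWithin_le_nhds (s := Ioi (0 : ℝ))))
    (by filter_upwards [self_mem_nhdsWithin] with ε hε using key ε hε)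
  simpa using this
lemma Heat.neg {S : Dat d} {h} (hh : Heat S h) : Heat S (fun w => - h w) := fun z => by
  obtain ⟨a, p, X, hj, he⟩ := hh z
  exact ⟨_, _, _, hj.neg, by rw [trQ_neg, ← he]; ring⟩
lemma heat_sol (S : Dat d) (s : ℝ) {T} (hT : T ∈ Trig d) {B : ℝ} (hB : ∀ x, |T x| ≤ B) :
    ∃ h, (∀ x, h (x, s) = T x) ∧ Heat S h ∧ ∀ x t, s ≤ t → |h (x, t)| ≤ B := by
  obtain ⟨h, h1, h2, B', h3⟩ := heat_exists S s hT
  refine ⟨h, h1, h2, fun x t ht => abs_le.2 ⟨?_, ?_⟩⟩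
  · have := heat_max S s h2.neg (B := B) (B' := B') (fun x => by
      show - h (x, s) ≤ B
      rw [h1]; have := (abs_le.1 (hB x)).1; linarith) (fun x t ht => by
      show |- h (x, t)| ≤ B'
      rw [abs_neg]; exact h3 x t ht) x t ht
    linarith
  · exact heat_max S s h2 (B := B) (B' := B') (fun x => by
      rw [h1]; exact (abs_le.1 (hB x)).2) h3 x t ht
def qA (S : Dat d) : ℝ := 12 * ((d + 1) * S.B) / S.lam
def qA' (S : Dat d) : ℝ := qA S * ((d + 1) * S.B) / S.lam
def qb (S : Dat d) (x0 : Eucl (d + 1)) (s0 : ℝ) (w : SpaceTime (d + 1)) : ℝ :=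
  ‖w.1 - x0‖ ^ 2 * ‖w.1 - x0‖ ^ 2 + qA S * (‖w.1 - x0‖ ^ 2 * (w.2 - s0)) + qA' S * (w.2 - s0) ^ 2
lemma qA_pos (S : Dat d) : 0 < qA S := by
  have := S.B_pos; have := S.lam_pos; unfold qA; positivity
lemma qA'_pos (S : Dat d) : 0 < qA' S := by
  have := S.B_pos; have := S.lam_pos; have := qA_pos S; unfold qA'; positivity
lemma qb_cont (S : Dat d) (x0 : Eucl (d + 1)) (s0 : ℝ) : Continuous (qb S x0 s0) := by
  unfold qb; fun_prop
lemma qb_nonneg (S : Dat d) (x0 : Eucl (d + 1)) (s0 : ℝ) {w : SpaceTime (d + 1)} (h : s0 ≤ w.2) :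
    0 ≤ qb S x0 s0 w := by
  have := qA_pos S; have := qA'_pos S; have : 0 ≤ w.2 - s0 := by linarith
  unfold qb; positivity
lemma qb_ge (S : Dat d) (x0 : Eucl (d + 1)) (s0 : ℝ) {w : SpaceTime (d + 1)} (h : s0 ≤ w.2) :
    ‖w.1 - x0‖ ^ 4 ≤ qb S x0 s0 w := by
  have := qA_pos S; have := qA'_pos S; have : 0 ≤ w.2 - s0 := by linarith
  unfold qb
  have e1 : 0 ≤ qA S * (‖w.1 - x0‖ ^ 2 * (w.2 - s0)) := by positivity
  have e2 : 0 ≤ qA' S * (w.2 - s0) ^ 2 := by positivity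
  nlinarith
lemma qb_jet (S : Dat d) (x0 : Eucl (d + 1)) (s0 : ℝ) {z : SpaceTime (d + 1)} (h : s0 ≤ z.2) :
    ∃ a p X, JetW univ (qb S x0 s0) z a p X ∧ trQ (S.Q z.2) X ≤ S.lam * a := by
  have j1 := idX_quad (s := univ) (z := z) x0
  have j2 : JetW univ (fun w : SpaceTime (d + 1) => w.2 - s0) z 1 0 0 :=
    JetW.time (g := fun t => t - s0) ((hasDerivAt_id z.2).sub_const s0)
  have j3 : JetW univ (fun w : SpaceTime (d + 1) => (w.2 - s0) ^ 2) z (2 * (z.2 - s0)) 0 0 :=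
    JetW.time (g := fun t => (t - s0) ^ 2) (by
      have := ((hasDerivAt_id z.2).sub_const s0).pow 2
      simpa [Pi.pow_def] using this)
  have j := ((j1.mul j1).add ((j1.mul j2).smul (qA S))).add (j3.smul (qA' S))
  refine ⟨_, _, _, j, ?_⟩
  have e0 : trQ (S.Q z.2) ((((2 : ℝ) • idX d (z.1 - x0)).smulRight ((2 : ℝ) • idX d (z.1 - x0)) :
      Eucl (d + 1) →L[ℝ] Eucl (d + 1) →L[ℝ] ℝ)) ≤ 4 * ‖z.1 - x0‖ ^ 2 * trQ (S.Q z.2) (idX d) := by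
    rw [← trQ_smul]
    refine trQ_mono S _ fun x => ?_
    simp only [ContinuousLinearMap.smulRight_apply, ContinuousLinearMap.smul_apply, smul_eq_mul, idX_apply,
      real_inner_self_eq_norm_sq]
    have := real_inner_mul_inner_self_le (z.1 - x0) x
    rw [real_inner_self_eq_norm_sq, real_inner_self_eq_norm_sq] at this
    linarith
  have e2 : trQ (S.Q z.2) (((2 : ℝ) • idX d (z.1 - x0)).smulRight (0 : Eucl (d + 1) →L[ℝ] ℝ)) = 0 := by
    simp [trQ]
  have e3 : trQ (S.Q z.2) ((0 : Eucl (d + 1) →L[ℝ] ℝ).smulRight ((2 : ℝ) • idX d (z.1 - x0))) = 0 := by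
    simp [trQ]
  simp only [trQ_add, trQ_smul, trQ_zero, e2, e3]
  have k5 := trQ_idX_le S z.2
  have hn := sq_nonneg ‖z.1 - x0‖
  have hs : 0 ≤ z.2 - s0 := by linarith
  have hl := S.lam_pos
  have k6 : S.lam * qA S = 12 * ((d + 1) * S.B) := by unfold qA; field_simp
  have k7 : S.lam * qA' S = qA S * ((d + 1) * S.B) := by unfold qA'; field_simp
  have hA := qA_pos S
  set N := ‖z.1 - x0‖ ^ 2
  set I := trQ (S.Q z.2) (idX d)
  have m1 : N * I ≤ N * ((d + 1) * S.B) := mul_le_mul_of_nonneg_left k5 hn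
  have m2 : (qA S * (z.2 - s0)) * I ≤ (qA S * (z.2 - s0)) * ((d + 1) * S.B) :=
    mul_le_mul_of_nonneg_left k5 (by positivity)
  have m3 : S.lam * (N * 0 + N * 0 + qA S * (N * 1 + (z.2 - s0) * 0) + qA' S * (2 * (z.2 - s0)))
     = (S.lam * qA S) * N + (S.lam * qA' S) * (2 * (z.2 - s0)) := by ring
  rw [m3, k6, k7]
  nlinarith
lemma C1 (S : Dat d) {u h : SpaceTime (d + 1) → ℝ} (hu : Sub S u)
    (husc : UpperSemicontinuousOn u (DD d)) (hh : Heat S h) {x0 : Eucl (d + 1)} {r t0 t1 e e' m K : ℝ}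
    (hcyl : ∀ x ∈ closedBall x0 r, ∀ t ∈ Icc t0 t1, (x, t) ∈ Kc d 1) (ht : t0 ≤ t1) (hr : 0 < r)
    (he : 0 ≤ e) (he' : 0 < e') (hK : 0 ≤ K)
    (hbot : ∀ x ∈ closedBall x0 r, u (x, t0) ≤ h (x, t0) + e)
    (hm : ∀ x ∈ closedBall x0 r, ∀ t ∈ Icc t0 t1, u (x, t) - h (x, t) ≤ m) (hKm : m ≤ K * r ^ 4) :
    u (x0, t1) ≤ h (x0, t1) + e + e' * (t1 - t0) + K * (qA' S * (t1 - t0) ^ 2) := by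
  have := maxP x0 r t0 t1 (fun w => u w + (-h w - e - e' * (w.2 - t0) - K * qb S x0 t0 w)) (by
      refine UpperSemicontinuousOn.add (husc.mono fun w hw => Kc_sub (hcyl w.1 hw.1 w.2 hw.2))
        (UpperSemicontinuous.upperSemicontinuousOn (Continuous.upperSemicontinuous ?_) _)
      have := hh.cont; have := qb_cont S x0 t0
      fun_prop)
    (fun x hx => by
      have e1 := hbot x hx
      have e2 := mul_nonneg hK (qb_nonneg S x0 t0 (w := (x, t0)) le_rfl)
      simp only [sub_self, mul_zero]
      linarith)
    (fun x t ht hx => by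
      have e1 := hm x (by rw [mem_closedBall, dist_eq_norm, hx]) t ht
      have e2 := mul_le_mul_of_nonneg_left (qb_ge S x0 t0 (w := (x, t)) ht.1) hK
      simp only [hx] at e2
      have e3 : 0 ≤ e' * (t - t0) := mul_nonneg he'.le (by linarith [ht.1])
      show u (x, t) + (- h (x, t) - e - e' * (t - t0) - K * qb S x0 t0 (x, t)) ≤ 0
      linarith)
    (fun z hz1 hz2 _ hz4 => by
      obtain ⟨a, p, X, hj, hje⟩ := hh z
      obtain ⟨b, q, Y, hjb, hbe⟩ := qb_jet S x0 t0 (z := z) hz2.1.le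
      have hjt : JetW univ (fun w : SpaceTime (d + 1) => e' * (w.2 - t0)) z (e' * 1) 0 0 :=
        JetW.time (g := fun τ => e' * (τ - t0)) (((hasDerivAt_id z.2).sub_const t0).const_mul e')
      have hJ := ((hj.add hjt).add (hjb.smul K)).add_const e
      have hz : z ∈ Kc d 1 := hcyl z.1 (ball_subset_closedBall hz1) z.2 ⟨hz2.1.le, hz2.2⟩
      have hSJ : SJ (DD d) u z _ _ _ := SJ.of_max (by
        have hopen : ball x0 r ×ˢ Ioi t0 ∈ 𝓝 z :=
          prod_mem_nhds (isOpen_ball.mem_nhds hz1) (Ioi_mem_nhds hz2.1)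
        filter_upwards [nhdsWithin_le_nhds hopen, self_mem_nhdsWithin] with w h1 h2
        have h3 : w.2 ≤ z.2 := h2.2
        have h4 : t0 < w.2 := h1.2
        have := hz4 w ⟨ball_subset_closedBall h1.1, h4.le, h3.trans hz2.2⟩
        linarith) (hJ.mono (subset_univ _))
      have := hu.1 z hz _ _ _ hSJ
      rw [trQ_add, trQ_add, trQ_smul, trQ_zero] at this
      have k1 := mul_le_mul_of_nonneg_left hbe hK
      have k2 := mul_pos S.lam_pos he'
      nlinarith)
    (x0, t1) ⟨by simp [hr.le], ht, le_rfl⟩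
  simp [qb] at this
  linarith
lemma cinf {E F : Type*} [TopologicalSpace E] [TopologicalSpace F] {K : Set F} (hK : IsCompact K)
    (hne : K.Nonempty) {Ψ : E → F → ℝ} (hΨ : Continuous (fun p : E × F => Ψ p.1 p.2)) {w : F → ℝ} {m : ℝ}
    (hw : ∀ y ∈ K, w y ≤ m) : ∃ g : E → ℝ, Continuous g ∧ (∀ x, ∀ y ∈ K, g x ≤ Ψ x y - w y) ∧
      ∀ x c, (∀ y ∈ K, c ≤ Ψ x y - w y) → c ≤ g x := by
  set g : E → ℝ := fun x => sInf ((fun y => Ψ x y - w y) '' K) with hg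
  have hb : ∀ x, BddBelow ((fun y => Ψ x y - w y) '' K) := by
    intro x
    have hc : ContinuousOn (fun y => Ψ x y) K :=
      (hΨ.comp (continuous_const.prodMk continuous_id)).continuousOn
    obtain ⟨c, hc⟩ := (hK.image_of_continuousOn hc).bddBelow
    refine ⟨c - m, ?_⟩
    rintro _ ⟨y, hy, rfl⟩
    have := hc ⟨y, hy, rfl⟩
    have := hw y hy
    simp only at *
    linarith
  have h1 : ∀ x, ∀ y ∈ K, g x ≤ Ψ x y - w y := fun x y hy => csInf_le (hb x) ⟨y, hy, rfl⟩
  have h2 : ∀ x c, (∀ y ∈ K, c ≤ Ψ x y - w y) → c ≤ g x := fun x c hc =>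
    le_csInf (hne.image _) (by rintro _ ⟨y, hy, rfl⟩; exact hc y hy)
  refine ⟨g, ?_, h1, h2⟩
  rw [continuous_iff_continuousAt]
  intro x0
  rw [ContinuousAt, Metric.tendsto_nhds]
  intro ε hε
  have h3 : ∀ᶠ x in 𝓝 x0, ∀ y ∈ K, |Ψ x y - Ψ x0 y| < ε / 2 := by
    apply hK.eventually_forall_of_forall_eventually
    intro y hy
    have c : Continuous (fun p : E × F => |Ψ p.1 p.2 - Ψ x0 p.2|) :=
      (hΨ.sub (hΨ.comp (continuous_const.prodMk continuous_snd))).abs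
    have := c.tendsto (x0, y)
    simp only [sub_self, abs_zero] at this
    exact this.eventually_lt_const (half_pos hε)
  filter_upwards [h3] with x hx
  rw [Real.dist_eq, abs_lt]
  have e1 : g x0 - ε / 2 ≤ g x := h2 x _ fun y hy => by
    have := h1 x0 y hy; have := (abs_lt.1 (hx y hy)); linarith
  have e2 : g x - ε / 2 ≤ g x0 := h2 x0 _ fun y hy => by
    have := h1 x y hy; have := (abs_lt.1 (hx y hy)); linarith
  constructor <;> linarith
lemma C3 (S : Dat d) {h1 h2 : SpaceTime (d + 1) → ℝ} (hh1 : Heat S h1) (hh2 : Heat S h2)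
    {Ψ : (Eucl (d + 1) × Eucl (d + 1)) × ℝ → ℝ} (hΨ : Continuous Ψ)
    {x0 y0 : Eucl (d + 1)} {t0 s0 r δ c m K e : ℝ} (hδ : 0 < δ) (hr : 0 < r) (hc : 0 < c) (hK : 0 ≤ K) (he : 0 ≤ e)
    (hjet : ∀ z : (Eucl (d + 1) × Eucl (d + 1)) × ℝ, z.1 ∈ ball (x0, y0) r → z.2 ∈ Ioc (-δ) 0 →
      ∃ a p X, JetW univ Ψ z a p X ∧ ∃ n : ℕ, ∃ ξ ζ : Fin n → Eucl (d + 1),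
        (∀ X, trQ (S.Q (t0 + z.2)) X = ∑ k, X (ξ k) (ξ k)) ∧
        (∀ X, trQ (S.Q (s0 + z.2)) X = ∑ k, X (ζ k) (ζ k)) ∧
        c + ∑ k, X (ξ k, ζ k) (ξ k, ζ k) ≤ S.lam * a)
    (hbot : ∀ x ∈ closedBall x0 r, ∀ y ∈ closedBall y0 r,
      h1 (x, t0 + -δ) + h2 (y, s0 + -δ) ≤ Ψ ((x, y), -δ) + e)
    (hm : ∀ x ∈ closedBall x0 r, ∀ y ∈ closedBall y0 r, ∀ t ∈ Icc (-δ) 0,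
      h1 (x, t0 + t) + h2 (y, s0 + t) - Ψ ((x, y), t) + c / (2 * S.lam) * δ ≤ m) (hKm : m ≤ K * r ^ 4) :
    h1 (x0, t0) + h2 (y0, s0) ≤ Ψ ((x0, y0), 0) - c / (2 * S.lam) * δ + e + K * (2 * (qA' S * δ ^ 2)) := by
  have hl := S.lam_pos
  set γ := c / (2 * S.lam) with hγ
  have hγp : 0 < γ := by positivity
  set πf := ContinuousLinearMap.fst ℝ (Eucl (d + 1)) (Eucl (d + 1))
  set πs := ContinuousLinearMap.snd ℝ (Eucl (d + 1)) (Eucl (d + 1))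
  have hmem : ∀ {p : Eucl (d + 1) × Eucl (d + 1)}, p ∈ closedBall (x0, y0) r →
      p.1 ∈ closedBall x0 r ∧ p.2 ∈ closedBall y0 r := by
    intro p hp
    rw [← closedBall_prod_same] at hp; exact hp
  have := maxP (x0, y0) r (-δ) 0 (fun w => h1 (πf w.1, t0 + w.2) + h2 (πs w.1, s0 + w.2) - Ψ w + γ * (w.2 + δ)
      - K * (qb S x0 (t0 - δ) (πf w.1, t0 + w.2) + qb S y0 (s0 - δ) (πs w.1, s0 + w.2)) + (-e)) (by
      refine UpperSemicontinuous.upperSemicontinuousOn (Continuous.upperSemicontinuous ?_) _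
      have := hh1.cont; have := hh2.cont; have := qb_cont S x0 (t0 - δ); have := qb_cont S y0 (s0 - δ)
      fun_prop)
    (fun x hx => by
      have hx' := hmem hx
      have e1 := hbot x.1 hx'.1 x.2 hx'.2
      have e2 := mul_nonneg hK (qb_nonneg S x0 (t0 - δ) (w := (x.1, t0 + -δ)) (by show _ ≤ t0 + -δ; linarith))
      have e3 := mul_nonneg hK (qb_nonneg S y0 (s0 - δ) (w := (x.2, s0 + -δ)) (by show _ ≤ s0 + -δ; linarith))
      show h1 (x.1, t0 + -δ) + h2 (x.2, s0 + -δ) - Ψ ((x.1, x.2), -δ) + γ * (-δ + δ)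
        - K * (qb S x0 (t0 - δ) (x.1, t0 + -δ) + qb S y0 (s0 - δ) (x.2, s0 + -δ)) + (-e) ≤ 0
      rw [neg_add_cancel, mul_zero, mul_add]
      linarith)
    (fun x t ht hx => by
      have hx' := hmem (p := x) (by rw [mem_closedBall, dist_eq_norm, hx])
      have e1 := hm x.1 hx'.1 x.2 hx'.2 t ht
      have ht1 := ht.1
      have q1 := qb_nonneg S x0 (t0 - δ) (w := (x.1, t0 + t)) (by show _ ≤ t0 + t; linarith)
      have q2 := qb_nonneg S y0 (s0 - δ) (w := (x.2, s0 + t)) (by show _ ≤ s0 + t; linarith)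
      have q3 := qb_ge S x0 (t0 - δ) (w := (x.1, t0 + t)) (by show _ ≤ t0 + t; linarith)
      have q4 := qb_ge S y0 (s0 - δ) (w := (x.2, s0 + t)) (by show _ ≤ s0 + t; linarith)
      have q5 : r ^ 4 ≤ qb S x0 (t0 - δ) (x.1, t0 + t) + qb S y0 (s0 - δ) (x.2, s0 + t) := by
        rw [Prod.norm_def] at hx
        rcases max_choice ‖(x - (x0, y0)).1‖ ‖(x - (x0, y0)).2‖ with h | h
        · rw [h] at hx
          have hx : ‖x.1 - x0‖ = r := hx
          simp only [hx] at q3; linarith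
        · rw [h] at hx
          have hx : ‖x.2 - y0‖ = r := hx
          simp only [hx] at q4; linarith
      have q6 := mul_le_mul_of_nonneg_left q5 hK
      have q7 : γ * (t + δ) ≤ γ * δ := mul_le_mul_of_nonneg_left (by linarith [ht.2]) hγp.le
      show h1 (x.1, t0 + t) + h2 (x.2, s0 + t) - Ψ ((x.1, x.2), t) + γ * (t + δ)
        - K * (qb S x0 (t0 - δ) (x.1, t0 + t) + qb S y0 (s0 - δ) (x.2, s0 + t)) + (-e) ≤ 0
      linarith)
    (fun z hz1 hz2 _ hz4 => by
      obtain ⟨a1, p1, X1, j1, i1⟩ := hh1 (πf z.1, t0 + z.2)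
      obtain ⟨a2, p2, X2, j2, i2⟩ := hh2 (πs z.1, s0 + z.2)
      have hz2' := hz2.1
      obtain ⟨a3, p3, X3, j3, i3⟩ := qb_jet S x0 (t0 - δ) (z := (πf z.1, t0 + z.2)) (by show _ ≤ t0 + z.2; linarith)
      obtain ⟨a4, p4, X4, j4, i4⟩ := qb_jet S y0 (s0 - δ) (z := (πs z.1, s0 + z.2)) (by show _ ≤ s0 + z.2; linarith)
      obtain ⟨a, p, X, j, n, ξ, ζ, r1, r2, r3⟩ := hjet z hz1 hz2
      have hjt : JetW univ (fun w : (Eucl (d + 1) × Eucl (d + 1)) × ℝ => γ * (w.2 + δ)) z (γ * 1) 0 0 :=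
        JetW.time (g := fun τ => γ * (τ + δ)) (((hasDerivAt_id z.2).add_const δ).const_mul γ)
      have J := (((((j1.pull (s' := univ) πf t0 z (fun _ _ => mem_univ _)).add
        (j2.pull (s' := univ) πs s0 z (fun _ _ => mem_univ _))).sub j).add hjt).sub
        (((j3.pull (s' := univ) πf t0 z (fun _ _ => mem_univ _)).add
        (j4.pull (s' := univ) πs s0 z (fun _ _ => mem_univ _))).smul K)).add_const (-e)
      obtain ⟨k1, _, k3⟩ := max_jet hz1 hz2 hz4 (subset_univ _) J
      have k4 : ∑ k, (X1 (ξ k) (ξ k) + X2 (ζ k) (ζ k) - X (ξ k, ζ k) (ξ k, ζ k)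
          - K * (X3 (ξ k) (ξ k) + X4 (ζ k) (ζ k))) ≤ 0 := Finset.sum_nonpos fun k _ => by
        have := k3 (ξ k, ζ k)
        have e0 : ((0 : Eucl (d + 1) × Eucl (d + 1) →L[ℝ] Eucl (d + 1) × Eucl (d + 1) →L[ℝ] ℝ)) (ξ k, ζ k) (ξ k, ζ k) = 0 := rfl
        simp only [ContinuousLinearMap.add_apply, ContinuousLinearMap.sub_apply, ContinuousLinearMap.smul_apply,
          ContinuousLinearMap.bilinearComp_apply, smul_eq_mul, e0] at this
        have this : X1 (ξ k) (ξ k) + X2 (ζ k) (ζ k) - X (ξ k, ζ k) (ξ k, ζ k) + 0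
          - K * (X3 (ξ k) (ξ k) + X4 (ζ k) (ζ k)) ≤ 0 := this
        linarith
      simp only [Finset.sum_sub_distrib, Finset.sum_add_distrib, ← Finset.mul_sum, ← r1, ← r2] at k4
      have i1 : S.lam * a1 = trQ (S.Q (t0 + z.2)) X1 := i1
      have i2 : S.lam * a2 = trQ (S.Q (s0 + z.2)) X2 := i2
      have i3 : trQ (S.Q (t0 + z.2)) X3 ≤ S.lam * a3 := i3
      have i4 : trQ (S.Q (s0 + z.2)) X4 ≤ S.lam * a4 := i4
      have k5 := mul_nonneg hl.le k1
      have k6 := mul_le_mul_of_nonneg_left (add_le_add i3 i4) hK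
      have k7 : S.lam * γ = c / 2 := by rw [hγ]; field_simp
      nlinarith)
    ((x0, y0), 0) ⟨by simp [hr.le], by simp [hδ.le]⟩
  have e5 : qb S x0 (t0 - δ) (x0, t0) = qA' S * δ ^ 2 := by simp [qb]
  have e6 : qb S y0 (s0 - δ) (y0, s0) = qA' S * δ ^ 2 := by simp [qb]
  have this : h1 (x0, t0 + 0) + h2 (y0, s0 + 0) - Ψ ((x0, y0), 0) + γ * (0 + δ)
      - K * (qb S x0 (t0 - δ) (x0, t0 + 0) + qb S y0 (s0 - δ) (y0, s0 + 0)) + (-e) ≤ 0 := this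
  rw [add_zero, add_zero, e5, e6] at this
  linarith
lemma box_norm {x c : Eucl (d + 1)} (h : ∀ i, |x i - c i| ≤ Real.pi / 2) : ‖x - c‖ ≤ 2 * (d + 1) := by
  have h1 : ‖x - c‖ ^ 2 ≤ (2 * (d + 1)) ^ 2 := by
    rw [EuclideanSpace.real_norm_sq_eq]
    have : ∀ i ∈ Finset.univ, ((x - c) i) ^ 2 ≤ (4 : ℝ) := fun i _ => by
      have h2 := h i
      have h3 := Real.pi_le_four
      have h4 : |(x - c) i| ≤ 2 := by
        rw [PiLp.sub_apply]; linarith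
      rw [← sq_abs]
      nlinarith [abs_nonneg ((x - c) i)]
    refine (Finset.sum_le_sum this).trans ?_
    simp
    have : (0 : ℝ) ≤ d := Nat.cast_nonneg d
    nlinarith
  exact abs_le_of_sq_le_sq' h1 (by positivity) |>.2
lemma ball_box {x c : Eucl (d + 1)} {r : ℝ} (hr : r ≤ 1) (h : x ∈ closedBall c r) (i) :
    |x i - c i| ≤ Real.pi / 2 := by
  have h1 : ‖(x - c) i‖ ≤ ‖x - c‖ := PiLp.norm_apply_le (x - c) i
  rw [mem_closedBall, dist_eq_norm] at h
  rw [PiLp.sub_apply, Real.norm_eq_abs] at h1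
  have := Real.pi_gt_three
  linarith
lemma lemA (S : Dat d) {u1 u2 : SpaceTime (d + 1) → ℝ} (hu1 : Sub S u1) (hu2 : Sub S u2)
    (hs1 : UpperSemicontinuousOn u1 (DD d)) (hs2 : UpperSemicontinuousOn u2 (DD d)) {m : ℝ}
    (hm1 : ∀ w ∈ DD d, |u1 w| ≤ m) (hm2 : ∀ w ∈ DD d, |u2 w| ≤ m)
    {x0 y0 : Eucl (d + 1)} {t0 s0 r δ0 c : ℝ} (hr : 0 < r) (hr1 : r ≤ 1) (hδ0 : 0 < δ0) (hc : 0 < c)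
    (hcy1 : ∀ x ∈ closedBall x0 r, ∀ t ∈ Icc (t0 - δ0) t0, (x, t) ∈ Kc d 1)
    (hcy2 : ∀ x ∈ closedBall y0 r, ∀ t ∈ Icc (s0 - δ0) s0, (x, t) ∈ Kc d 1)
    {Ψ : (Eucl (d + 1) × Eucl (d + 1)) × ℝ → ℝ} (hΨ : Continuous Ψ)
    (hle : ∀ x ∈ closedBall x0 r, ∀ y ∈ closedBall y0 r, ∀ τ ∈ Icc (-δ0) 0,
      u1 (x, t0 + τ) + u2 (y, s0 + τ) ≤ Ψ ((x, y), τ))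
    (heq : Ψ ((x0, y0), 0) ≤ u1 (x0, t0) + u2 (y0, s0))
    (hjet : ∀ z : (Eucl (d + 1) × Eucl (d + 1)) × ℝ, z.1 ∈ ball (x0, y0) r → z.2 ∈ Ioc (-δ0) 0 →
      ∃ a p X, JetW univ Ψ z a p X ∧ ∃ n : ℕ, ∃ ξ ζ : Fin n → Eucl (d + 1),
        (∀ X, trQ (S.Q (t0 + z.2)) X = ∑ k, X (ξ k) (ξ k)) ∧
        (∀ X, trQ (S.Q (s0 + z.2)) X = ∑ k, X (ζ k) (ζ k)) ∧
        c + ∑ k, X (ξ k, ζ k) (ξ k, ζ k) ≤ S.lam * a) : False := by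
  obtain ⟨mΨ, hmΨ⟩ : ∃ mΨ, ∀ p ∈ (closedBall x0 (2 * (d + 1)) ×ˢ closedBall y0 (2 * (d + 1))) ×ˢ Icc (-1 : ℝ) 0,
      |Ψ p| ≤ mΨ := by
    have hc := ((isCompact_closedBall x0 (2 * (d + 1) : ℝ)).prod
      (isCompact_closedBall y0 (2 * (d + 1) : ℝ))).prod (isCompact_Icc (a := (-1 : ℝ)) (b := 0))
    obtain ⟨b, hb⟩ := hc.exists_bound_of_continuousOn hΨ.continuousOn
    exact ⟨b, hb⟩
  have hrd : r ≤ 2 * (d + 1) := by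
    have : (0 : ℝ) ≤ d := Nat.cast_nonneg d
    linarith
  have hm0 : 0 ≤ m := (abs_nonneg _).trans (hm1 _ (Kc_sub (hcy1 x0 (by simp [hr.le]) t0 (by simp [hδ0.le]))))
  have hmΨ0 : 0 ≤ mΨ := (abs_nonneg _).trans (hmΨ ((x0, y0), 0) ⟨⟨by simp; positivity, by simp; positivity⟩, by simp⟩)
  have hl := S.lam_pos
  have hqA := qA'_pos S
  set γ := c / (2 * S.lam) with hγ
  have hγp : 0 < γ := by positivity
  set B := 2 * mΨ + m + 1 with hB
  set K := (3 * B + mΨ + m + γ) / r ^ 4 with hK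
  have hKr : K * r ^ 4 = 3 * B + mΨ + m + γ := by rw [hK]; field_simp
  have hK0 : 0 ≤ K := by positivity
  set C := 7 + 4 * K * qA' S with hC
  have hCp : 0 < C := by positivity
  set δ := min (min δ0 1) (γ / (2 * C)) with hδ
  have hδp : 0 < δ := by rw [hδ]; positivity
  have hδ1 : δ ≤ 1 := (min_le_left _ _).trans (min_le_right _ _)
  have hδδ0 : δ ≤ δ0 := (min_le_left _ _).trans (min_le_left _ _)
  have hδC : δ ≤ γ / (2 * C) := min_le_right _ _
  have hδ2 : δ ^ 2 ≤ 1 := by nlinarith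
  have hu2b : ∀ y ∈ closedBall y0 r, u2 (y, s0 + -δ) ≤ m := fun y hy =>
    (abs_le.1 (hm2 _ (Kc_sub (hcy2 y hy _ ⟨by linarith, by linarith⟩)))).2
  obtain ⟨g1, g1c, g1a, g1b⟩ := cinf (isCompact_closedBall y0 r) (nonempty_closedBall.2 hr.le)
    (Ψ := fun x y => Ψ ((x, y), -δ)) (by fun_prop) (w := fun y => u2 (y, s0 + -δ)) hu2b
  have hin : ∀ {x c : Eucl (d + 1)}, (∀ i, |x i - c i| ≤ Real.pi / 2) → x ∈ closedBall c (2 * (d + 1)) :=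
    fun h => by rw [mem_closedBall, dist_eq_norm]; exact box_norm h
  have hΨb : ∀ x y τ, (∀ i, |x i - x0 i| ≤ Real.pi / 2) → (∀ i, |y i - y0 i| ≤ Real.pi / 2) → τ ∈ Icc (-δ) 0 →
      -mΨ ≤ Ψ ((x, y), τ) ∧ Ψ ((x, y), τ) ≤ mΨ := fun x y τ hx hy hτ =>
    abs_le.1 (hmΨ _ ⟨⟨hin hx, hin hy⟩, by linarith [hτ.1], hτ.2⟩)
  have hδm : -δ ∈ Icc (-δ) 0 := ⟨le_rfl, by linarith⟩
  have hbb : ∀ {x c : Eucl (d + 1)}, x ∈ closedBall c r → ∀ i, |x i - c i| ≤ Real.pi / 2 :=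
    fun h => ball_box hr1 h
  have hy0 : y0 ∈ closedBall y0 r := by simp [hr.le]
  have hx0 : x0 ∈ closedBall x0 r := by simp [hr.le]
  have g1bd : ∀ x, (∀ i, |x i - x0 i| ≤ Real.pi / 2) → -(mΨ + m) ≤ g1 x ∧ g1 x ≤ mΨ + m := by
    intro x hx
    constructor
    · refine g1b x _ fun y hy => ?_
      have := (hΨb x y (-δ) hx (hbb hy) hδm).1
      have := hu2b y hy
      linarith
    · have := g1a x y0 hy0
      have := (hΨb x y0 (-δ) hx (hbb hy0) hδm).2
      have := (abs_le.1 (hm2 _ (Kc_sub (hcy2 y0 hy0 (s0 + -δ) ⟨by linarith, by linarith⟩)))).1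
      linarith
  obtain ⟨g2, g2c, g2a, g2b⟩ := cinf (isCompact_closedBall x0 r) (nonempty_closedBall.2 hr.le)
    (Ψ := fun y x => Ψ ((x, y), -δ)) (by fun_prop) (w := g1) (m := mΨ + m) (fun x hx => (g1bd x (hbb hx)).2)
  have g2bd : ∀ y, (∀ i, |y i - y0 i| ≤ Real.pi / 2) → |g2 y| ≤ 2 * mΨ + m := by
    intro y hy
    rw [abs_le]
    constructor
    · refine g2b y _ fun x hx => ?_
      have := (hΨb x y (-δ) (hbb hx) hy hδm).1
      have := (g1bd x (hbb hx)).2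
      linarith
    · have := g2a y x0 hx0
      have := (hΨb x0 y (-δ) (hbb hx0) hy hδm).2
      have := (g1bd x0 (hbb hx0)).1
      linarith
  have hδsq : 0 < δ ^ 2 := by positivity
  obtain ⟨T1, hT1, hT1a, hT1b⟩ := trig_approx x0 g1 g1c hδsq (B := 2 * mΨ + m) (fun x hx => by
    have := g1bd x hx
    rw [abs_le]; constructor <;> linarith)
  obtain ⟨T2, hT2, hT2a, hT2b⟩ := trig_approx y0 g2 g2c hδsq (B := 2 * mΨ + m) g2bd
  obtain ⟨h1, h1i, h1h, h1b⟩ := heat_sol S (t0 + -δ) hT1 (B := B) (fun x => (hT1b x).trans (by linarith))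
  obtain ⟨h2, h2i, h2h, h2b⟩ := heat_sol S (s0 + -δ) hT2 (B := B) (fun x => (hT2b x).trans (by linarith))
  have A1 := C1 S hu1 hs1 h1h (x0 := x0) (r := r) (t0 := t0 + -δ) (t1 := t0) (e := δ ^ 2) (e' := δ)
    (m := m + B) (K := K) (fun x hx t ht => hcy1 x hx t ⟨by linarith [ht.1], ht.2⟩) (by linarith) hr hδsq.le hδp hK0
    (fun x hx => by
      have e1 := g1b x (u1 (x, t0 + -δ)) (fun y hy => by
        have := hle x hx y hy (-δ) ⟨by linarith, by linarith⟩
        linarith)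
      have e2 := abs_le.1 (hT1a x (hbb hx))
      rw [h1i]; linarith)
    (fun x hx t ht => by
      have := (abs_le.1 (hm1 _ (Kc_sub (hcy1 x hx t ⟨by linarith [ht.1], ht.2⟩)))).2
      have := (abs_le.1 (h1b x t ht.1)).1
      linarith) (by rw [hKr]; linarith)
  have A2 := C1 S hu2 hs2 h2h (x0 := y0) (r := r) (t0 := s0 + -δ) (t1 := s0) (e := δ ^ 2) (e' := δ)
    (m := m + B) (K := K) (fun x hx t ht => hcy2 x hx t ⟨by linarith [ht.1], ht.2⟩) (by linarith) hr hδsq.le hδp hK0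
    (fun y hy => by
      have e1 := g2b y (u2 (y, s0 + -δ)) (fun x hx => by
        have := g1a x y hy
        linarith)
      have e2 := abs_le.1 (hT2a y (hbb hy))
      rw [h2i]; linarith)
    (fun x hx t ht => by
      have := (abs_le.1 (hm2 _ (Kc_sub (hcy2 x hx t ⟨by linarith [ht.1], ht.2⟩)))).2
      have := (abs_le.1 (h2b x t ht.1)).1
      linarith) (by rw [hKr]; linarith)
  have A3 := C3 S h1h h2h hΨ (x0 := x0) (y0 := y0) (t0 := t0) (s0 := s0) (r := r) (δ := δ) (c := c)
    (m := 2 * B + mΨ + γ) (K := K) (e := 2 * δ ^ 2) hδp hr hc hK0 (by positivity)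
    (fun z hz1 hz2 => hjet z hz1 ⟨by linarith [hz2.1], hz2.2⟩)
    (fun x hx y hy => by
      have e1 := g2a y x hx
      have e2 := abs_le.1 (hT1a x (hbb hx))
      have e3 := abs_le.1 (hT2a y (hbb hy))
      rw [h1i, h2i]; linarith)
    (fun x hx y hy t ht => by
      have e1 := (abs_le.1 (h1b x (t0 + t) (by linarith [ht.1]))).2
      have e2 := (abs_le.1 (h2b y (s0 + t) (by linarith [ht.1]))).2
      have e3 := (hΨb x y t (hbb hx) (hbb hy) ht).1
      have e4 : γ * δ ≤ γ := by nlinarith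
      linarith) (by rw [hKr]; linarith)
  have e : γ * δ ≤ C * δ ^ 2 := by
    rw [hC]
    have e1 : (t0 - (t0 + -δ)) = δ := by ring
    have e2 : (s0 - (s0 + -δ)) = δ := by ring
    rw [e1] at A1
    rw [e2] at A2
    nlinarith
  have e2 : γ ≤ C * δ := by
    have : γ * δ ≤ (C * δ) * δ := by linarith [e, (by ring : C * δ ^ 2 = (C * δ) * δ)]
    exact le_of_mul_le_mul_right this hδp
  have e3 : C * δ ≤ C * (γ / (2 * C)) := mul_le_mul_of_nonneg_left hδC hCp.le
  have e4 : C * (γ / (2 * C)) = γ / 2 := by field_simp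
  linarith
lemma v_cont (S : Dat d) : Continuous S.v := by
  have : LipschitzWith ⟨S.L, S.L_pos.le⟩ S.v := LipschitzWith.of_dist_le_mul fun t s => by
    rw [dist_eq_norm, Real.dist_eq]; exact S.lipv t s
  exact this.continuous
def VV (S : Dat d) (t : ℝ) : Eucl (d + 1) := ∫ s in (0 : ℝ)..t, S.v s
lemma VV_deriv (S : Dat d) (t : ℝ) : HasDerivAt (VV S) (S.v t) t :=
  intervalIntegral.integral_hasDerivAt_right ((v_cont S).intervalIntegrable _ _)
    (v_cont S).stronglyMeasurable.stronglyMeasurableAtFilter (v_cont S).continuousAt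
lemma VV_cont (S : Dat d) : Continuous (VV S) :=
  continuous_iff_continuousAt.2 fun t => (VV_deriv S t).continuousAt
lemma VV_last (S : Dat d) (t s : ℝ) : S.M⁻¹ * |t - s| ≤ |lastC (VV S t - VV S s)| := by
  have key : ∀ a b : ℝ, a ≤ b → S.M⁻¹ * (b - a) ≤ lastC (VV S b - VV S a) := by
    intro a b hab
    have hd : ∀ t, HasDerivAt (fun t => lastL d (VV S t) - S.M⁻¹ * t) (lastL d (S.v t) - S.M⁻¹ * 1) t := fun t =>
      ((lastL d).hasFDerivAt.comp_hasDerivAt t (VV_deriv S t)).sub ((hasDerivAt_id t).const_mul _)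
    have := monotone_of_deriv_nonneg (f := fun t => lastL d (VV S t) - S.M⁻¹ * t) (fun t => (hd t).differentiableAt)
      (fun t => by rw [(hd t).deriv, lastL_apply]; linarith [S.vlast t]) hab
    simp only [lastL_apply] at this
    rw [lastC_sub]; linarith
  rcases le_total s t with h | h
  · rw [abs_of_nonneg (by linarith : 0 ≤ t - s)]
    exact (key s t h).trans (le_abs_self _)
  · rw [abs_of_nonpos (by linarith : t - s ≤ 0)]
    have := key t s h
    rw [lastC_sub] at *
    rw [abs_sub_comm]
    refine le_trans ?_ (this.trans (le_abs_self _))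
    rw [neg_sub]
lemma jet_sq {Z : Type*} [NormedAddCommGroup Z] [NormedSpace ℝ Z] {s : Set (Z × ℝ)} {z : Z × ℝ}
    (A : Z →L[ℝ] Eucl (d + 1)) {ω : ℝ → Eucl (d + 1)} {ω' : Eucl (d + 1)} (hω : HasDerivAt ω ω' z.2) :
    JetW s (fun w : Z × ℝ => ‖A w.1 + ω w.2‖ ^ 2) z (2 * ⟪A z.1 + ω z.2, ω'⟫)
      ((2 : ℝ) • (innerSL ℝ (A z.1 + ω z.2)).comp A) ((2 : ℝ) • (idX d).bilinearComp A A) := by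
  set w0 := A z.1 + ω z.2 with hw0
  have ht : Tendsto (fun w : Z × ℝ => w.2) (𝓝[s] z) (𝓝 z.2) :=
    continuous_snd.continuousAt.mono_left nhdsWithin_le_nhds
  have hN : (fun w : Z × ℝ => w.2 - z.2) =O[𝓝[s] z] fun w => NN z w :=
    IsBigO.of_bound 1 (Eventually.of_forall fun w => by
      rw [one_mul, Real.norm_eq_abs, Real.norm_eq_abs, abs_of_nonneg (NN_nonneg z w)]
      unfold NN; nlinarith [sq_nonneg ‖w.1 - z.1‖])
  have h1 : (fun w : Z × ℝ => ω w.2 - ω z.2 - (w.2 - z.2) • ω') =o[𝓝[s] z] fun w => NN z w :=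
    ((hasDerivAt_iff_isLittleO.1 hω).comp_tendsto ht).trans_isBigO hN
  have h2 : (fun w : Z × ℝ => ω w.2 - ω z.2) =O[𝓝[s] z] fun w => NN z w :=
    (hω.differentiableAt.isBigO_sub.comp_tendsto ht).trans hN
  have h3 : (fun w : Z × ℝ => ‖ω w.2 - ω z.2‖) =O[𝓝[s] z] fun w => NN z w := h2.norm_left
  have h4 : (fun w : Z × ℝ => 2 * ‖A (w.1 - z.1)‖ + ‖ω w.2 - ω z.2‖) =o[𝓝[s] z] fun _ => (1 : ℝ) := by
    rw [isLittleO_one_iff]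
    have e1 : Tendsto (fun w : Z × ℝ => ω w.2) (𝓝[s] z) (𝓝 (ω z.2)) := hω.continuousAt.tendsto.comp ht
    have e2 : Tendsto (fun w : Z × ℝ => A (w.1 - z.1)) (𝓝[s] z) (𝓝 (A (z.1 - z.1))) :=
      Continuous.continuousAt (by fun_prop) |>.mono_left nhdsWithin_le_nhds
    have := (e2.norm.const_mul 2).add (e1.sub_const (ω z.2)).norm
    simpa using this
  have h5 := h4.mul_isBigO h3
  simp only [one_mul] at h5
  have h6 : (fun w : Z × ℝ => 2 * ⟪w0, ω w.2 - ω z.2 - (w.2 - z.2) • ω'⟫) =o[𝓝[s] z] fun w => NN z w := by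
    refine (IsBigO.of_bound (2 * ‖w0‖) (Eventually.of_forall fun w => ?_)).trans_isLittleO h1
    rw [norm_mul, Real.norm_eq_abs, abs_two, mul_assoc]
    exact mul_le_mul_of_nonneg_left (norm_inner_le_norm _ _) (by norm_num)
  have h7 : (fun w : Z × ℝ => 2 * ⟪A (w.1 - z.1), ω w.2 - ω z.2⟫ + ‖ω w.2 - ω z.2‖ ^ 2) =o[𝓝[s] z] fun w => NN z w := by
    refine (IsBigO.of_bound 1 (Eventually.of_forall fun w => ?_)).trans_isLittleO h5
    have := abs_real_inner_le_norm (A (w.1 - z.1)) (ω w.2 - ω z.2)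
    rw [one_mul, Real.norm_eq_abs, Real.norm_eq_abs, abs_le, abs_of_nonneg (by positivity)]
    rw [abs_le] at this
    have := sq_nonneg ‖ω w.2 - ω z.2‖
    constructor <;> nlinarith
  refine (h6.add h7).congr_left fun w => ?_
  have e : A w.1 + ω w.2 = w0 + (A (w.1 - z.1) + (ω w.2 - ω z.2)) := by rw [hw0, map_sub]; abel
  have e1 : ((2 : ℝ) • (innerSL ℝ w0).comp A) (w.1 - z.1) = 2 * ⟪w0, A (w.1 - z.1)⟫ := rfl
  have e2 : ((2 : ℝ) • (idX d).bilinearComp A A) (w.1 - z.1) (w.1 - z.1) = 2 * ‖A (w.1 - z.1)‖ ^ 2 := by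
    rw [← real_inner_self_eq_norm_sq]; rfl
  simp only [pol]
  rw [e1, e2, e, norm_add_sq_real w0, norm_add_sq_real (A (w.1 - z.1))]
  simp only [inner_add_right, inner_sub_right, inner_smul_right]
  ring
lemma jet_pen {Z : Type*} [NormedAddCommGroup Z] [NormedSpace ℝ Z] {s : Set (Z × ℝ)} {z : Z × ℝ}
    (A : Z →L[ℝ] Eucl (d + 1)) {ω : ℝ → Eucl (d + 1)} {ω' : Eucl (d + 1)} (hω : HasDerivAt ω ω' z.2)
    (l : Z →L[ℝ] ℝ) (c : ℝ) : ∃ p X, JetW s (fun w : Z × ℝ => ‖A w.1 + ω w.2‖ ^ 2 + (l w.1 + c) ^ 2) z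
      (2 * ⟪A z.1 + ω z.2, ω'⟫) p X ∧ (∀ h, p h = 2 * ⟪A z.1 + ω z.2, A h⟫ + 2 * (l z.1 + c) * l h) ∧
      ∀ h, X h h = 2 * ‖A h‖ ^ 2 + 2 * (l h) ^ 2 := by
  have j1 := jet_sq (s := s) A hω
  have j2 := (JetW.lin (s := s) (z := z) l).add_const c
  have j := j1.add (j2.mul j2)
  have e1 : ∀ w : Z × ℝ, ‖A w.1 + ω w.2‖ ^ 2 + (l w.1 + c) * (l w.1 + c) = ‖A w.1 + ω w.2‖ ^ 2 + (l w.1 + c) ^ 2 :=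
    fun w => by ring
  have e2 : 2 * ⟪A z.1 + ω z.2, ω'⟫ + ((l z.1 + c) * 0 + (l z.1 + c) * 0) = 2 * ⟪A z.1 + ω z.2, ω'⟫ := by ring
  simp only [e1] at j
  rw [e2] at j
  refine ⟨_, _, j, ?_, ?_⟩
  · intro h
    show 2 * ⟪A z.1 + ω z.2, A h⟫ + ((l z.1 + c) * l h + (l z.1 + c) * l h) = _
    ring
  · intro h
    have e2 : ((2 : ℝ) • (idX d).bilinearComp A A) h h = 2 * ‖A h‖ ^ 2 := by
      rw [← real_inner_self_eq_norm_sq]; rfl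
    show ((2 : ℝ) • (idX d).bilinearComp A A) h h + (((l z.1 + c) * 0 + (l z.1 + c) * 0) + (l h * l h + l h * l h)) = _
    rw [e2]; ring
def Phi (S : Dat d) (z w : SpaceTime (d + 1)) : ℝ :=
  ‖z.1 + VV S z.2 - w.1 - VV S w.2‖ ^ 2 + (lastC z.1 - lastC w.1) ^ 2
lemma Phi_symm (S : Dat d) (z w : SpaceTime (d + 1)) : Phi S z w = Phi S w z := by
  unfold Phi
  rw [← norm_neg]
  congr 1
  · congr 2; abel
  · ring
lemma Phi_cont (S : Dat d) : Continuous (fun p : SpaceTime (d + 1) × SpaceTime (d + 1) => Phi S p.1 p.2) := by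
  have := VV_cont S; have := lastC_cont (d := d)
  unfold Phi; fun_prop
lemma Phi_time (S : Dat d) (z w : SpaceTime (d + 1)) : |z.2 - w.2| ^ 2 ≤ 4 * S.M ^ 2 * Phi S z w := by
  have h1 := VV_last S z.2 w.2
  set q := z.1 + VV S z.2 - w.1 - VV S w.2 with hq
  have h2 : lastC (VV S z.2 - VV S w.2) = lastC q - (lastC z.1 - lastC w.1) := by
    rw [hq]; simp only [lastC_sub, lastC_add]; ring
  have h3 := abs_lastC_le q
  have hM : 0 < S.M := by linarith [S.M_pos]
  have h4 : |z.2 - w.2| ≤ S.M * |lastC q - (lastC z.1 - lastC w.1)| := by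
    rw [← h2]
    calc |z.2 - w.2| = S.M * (S.M⁻¹ * |z.2 - w.2|) := by field_simp
      _ ≤ _ := mul_le_mul_of_nonneg_left h1 hM.le
  have h5 : |lastC q - (lastC z.1 - lastC w.1)| ≤ ‖q‖ + |lastC z.1 - lastC w.1| :=
    (abs_sub _ _).trans (by linarith)
  have h6 : |z.2 - w.2| ≤ S.M * (‖q‖ + |lastC z.1 - lastC w.1|) :=
    h4.trans (mul_le_mul_of_nonneg_left h5 hM.le)
  have h7 : |z.2 - w.2| ^ 2 ≤ (S.M * (‖q‖ + |lastC z.1 - lastC w.1|)) ^ 2 :=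
    pow_le_pow_left₀ (abs_nonneg _) h6 2
  refine h7.trans ?_
  have : Phi S z w = ‖q‖ ^ 2 + |lastC z.1 - lastC w.1| ^ 2 := by rw [sq_abs]; rfl
  rw [this]
  have e := sq_nonneg (‖q‖ - |lastC z.1 - lastC w.1|)
  have e2 : 0 ≤ S.M ^ 2 := by positivity
  nlinarith [sq_nonneg ‖q‖, sq_nonneg |lastC z.1 - lastC w.1|]
lemma Phi_nonneg (S : Dat d) (z w : SpaceTime (d + 1)) : 0 ≤ Phi S z w := by unfold Phi; positivity
lemma Phi_zero (S : Dat d) {z w : SpaceTime (d + 1)} (h : Phi S z w = 0) : z = w := by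
  have h1 := Phi_time S z w
  rw [h, mul_zero] at h1
  have h2 : z.2 = w.2 := by
    have : |z.2 - w.2| ^ 2 = 0 := le_antisymm h1 (by positivity)
    have := abs_eq_zero.1 (pow_eq_zero_iff (two_ne_zero) |>.1 this)
    linarith
  have h3 : ‖z.1 + VV S z.2 - w.1 - VV S w.2‖ ^ 2 = 0 := by
    unfold Phi at h
    nlinarith [sq_nonneg ‖z.1 + VV S z.2 - w.1 - VV S w.2‖, sq_nonneg (lastC z.1 - lastC w.1)]
  rw [h2] at h3
  have h4 := norm_eq_zero.1 (pow_eq_zero_iff (two_ne_zero) |>.1 h3)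
  have h5 : z.1 - w.1 = 0 := by rw [← h4]; abel
  exact Prod.ext (sub_eq_zero.1 h5) h2
lemma noF (S : Dat d) {u : SpaceTime (d + 1) → ℝ} (hu : Sub S u) {z y : SpaceTime (d + 1)} (hz : z ∈ Fc d 1)
    (hy : 0 ≤ lastC y.1) {μ k : ℝ} (hμ : 0 < μ) (hk : 0 ≤ k)
    (hm : ∀ w ∈ DD d, u w - (μ * w.2 + k * Phi S w y) ≤ u z - (μ * z.2 + k * Phi S z y)) : False := by
  obtain ⟨p, X, hj, hp, _⟩ := jet_pen (s := DD d ∩ past z) (z := z) (ContinuousLinearMap.id ℝ _)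
    (ω := fun t => VV S t - (y.1 + VV S y.2)) ((VV_deriv S z.2).sub_const _) (lastL d) (-lastC y.1)
  have hjt : JetW (DD d ∩ past z) (fun w : SpaceTime (d + 1) => μ * w.2) z (μ * 1) 0 0 :=
    JetW.time (g := fun τ => μ * τ) ((hasDerivAt_id z.2).const_mul μ)
  have hJ := hjt.add (hj.smul k)
  have e : ∀ w : SpaceTime (d + 1), μ * w.2 + k * (‖ContinuousLinearMap.id ℝ _ w.1 + (VV S w.2 - (y.1 + VV S y.2))‖ ^ 2
      + (lastL d w.1 + -lastC y.1) ^ 2) = μ * w.2 + k * Phi S w y := by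
    intro w
    rw [lastL_apply, ContinuousLinearMap.id_apply, ← sub_eq_add_neg, ← add_sub_assoc, ← sub_sub]
    rfl
  simp only [e] at hJ
  have hS : SJ (DD d) u z _ _ _ := SJ.of_max (by
    filter_upwards [self_mem_nhdsWithin] with w hw
    exact hm w hw.1) hJ
  have := hu.2 z hz _ _ _ hS
  have e2 : ((0 : Eucl (d + 1) →L[ℝ] ℝ) + k • p) (S.v z.2) = k * p (S.v z.2) := by simp
  rw [e2, hp, lastL_apply, lastL_apply, hz.2.1, ContinuousLinearMap.id_apply, ContinuousLinearMap.id_apply] at this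
  have hv := S.vlast z.2
  have hM : 0 < S.M⁻¹ := by have := S.M_pos; positivity
  have : 0 ≤ k * (lastC y.1 * lastC (S.v z.2)) := by
    have : 0 ≤ lastC (S.v z.2) := by linarith
    positivity
  nlinarith
lemma Kc_nhds {z : SpaceTime (d + 1)} (hz : z ∈ Kc d 1) : ∀ᶠ w in 𝓝 z, w.2 ≤ 0 → w ∈ Kc d 1 := by
  have h1 : ∀ᶠ w : SpaceTime (d + 1) in 𝓝 z, w.1 ∈ ball (0 : Eucl (d + 1)) 1 :=
    continuous_fst.continuousAt (isOpen_ball.mem_nhds hz.1)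
  have h2 : ∀ᶠ w : SpaceTime (d + 1) in 𝓝 z, 0 < lastC w.1 :=
    (lastC_cont.comp continuous_fst).continuousAt.eventually_const_lt hz.2.1
  have h3 : ∀ᶠ w : SpaceTime (d + 1) in 𝓝 z, -1 < w.2 :=
    continuous_snd.continuousAt.eventually_const_lt hz.2.2.1
  filter_upwards [h1, h2, h3] with w a b c e
  exact ⟨a, b, c, e⟩
lemma not_bd {z : SpaceTime (d + 1)} (hz : z ∈ DD d) (h : z ∉ bd d) : z ∈ Kc d 1 ∨ z ∈ Fc d 1 := by
  have : z ∈ KcP d 1 := by rw [KcP_eq]; exact ⟨hz, h⟩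
  exact this
lemma usc_cont_add {X : Type*} [TopologicalSpace X] {s : Set X} {f g : X → ℝ} (hf : UpperSemicontinuousOn f s)
    (hg : ContinuousOn g s) : UpperSemicontinuousOn (fun x => f x + g x) s :=
  hf.add hg.upperSemicontinuousOn
set_option maxHeartbeats 1000000 in
lemma pen_points (S : Dat d) {u1 u2 : SpaceTime (d + 1) → ℝ}
    (hs1 : UpperSemicontinuousOn u1 (DD d)) (hs2 : UpperSemicontinuousOn u2 (DD d)) {m : ℝ}
    (hm1 : ∀ w ∈ DD d, |u1 w| ≤ m) (hm2 : ∀ w ∈ DD d, |u2 w| ≤ m)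
    (hb : ∀ w ∈ bd d, u1 w + u2 w ≤ 0) {z0 : SpaceTime (d + 1)} (hz0 : z0 ∈ DD d) {μ : ℝ} (hμ : 0 < μ)
    (hpos : 4 * μ ≤ u1 z0 + u2 z0) {ε r : ℝ} (hε : 0 < ε) (hr : 0 < r) :
    ∃ (k : ℝ) (z w : SpaceTime (d + 1)), 0 ≤ k ∧ z ∈ DD d ∧ w ∈ DD d ∧ z ∉ bd d ∧ w ∉ bd d ∧
      k * Phi S z w ≤ ε ∧ |z.2 - w.2| ≤ r ∧ ∀ z' ∈ DD d, ∀ w' ∈ DD d,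
        u1 z' + u2 w' - μ * z'.2 - μ * w'.2 - k * Phi S z' w' ≤
        u1 z + u2 w - μ * z.2 - μ * w.2 - k * Phi S z w := by
  have hcomp : IsCompact (DD d ×ˢ DD d) := DD_compact.prod DD_compact
  have hs : UpperSemicontinuousOn (fun p : SpaceTime (d + 1) × SpaceTime (d + 1) => u1 p.1 + u2 p.2) (DD d ×ˢ DD d) := by
    refine UpperSemicontinuousOn.add ?_ ?_
    · exact hs1.comp continuous_fst.continuousOn fun p hp => hp.1
    · exact hs2.comp continuous_snd.continuousOn fun p hp => hp.2
  have hex : ∀ k : ℕ, ∃ p ∈ DD d ×ˢ DD d, ∀ p' ∈ DD d ×ˢ DD d,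
      u1 p'.1 + u2 p'.2 + (- μ * p'.1.2 - μ * p'.2.2 - k * Phi S p'.1 p'.2) ≤
      u1 p.1 + u2 p.2 + (- μ * p.1.2 - μ * p.2.2 - k * Phi S p.1 p.2) := by
    intro k
    have hc : Continuous (fun p : SpaceTime (d + 1) × SpaceTime (d + 1) =>
      (- μ * p.1.2 - μ * p.2.2 - k * Phi S p.1 p.2)) := by
      have := Phi_cont S
      fun_prop
    obtain ⟨p, hp, hmax⟩ := (usc_cont_add hs hc.continuousOn).exists_isMaxOn (show (DD d ×ˢ DD d).Nonempty from ⟨(z0, z0), hz0, hz0⟩) hcomp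
    exact ⟨p, hp, fun p' hp' => hmax hp'⟩
  choose P hP hmax using hex
  obtain ⟨⟨za, zb⟩, hab, φ, hφ, hlim⟩ := hcomp.tendsto_subseq hP
  have Phi0 : ∀ z, Phi S z z = 0 := fun z => by
    have : z.1 + VV S z.2 - z.1 - VV S z.2 = 0 := by abel
    simp [Phi, this]
  have hval : ∀ k : ℕ, ∀ z ∈ DD d, u1 z + u2 z - 2 * μ * z.2 + k * Phi S (P k).1 (P k).2 ≤
      u1 (P k).1 + u2 (P k).2 - μ * (P k).1.2 - μ * (P k).2.2 := by
    intro k z hz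
    have := hmax k (z, z) ⟨hz, hz⟩
    simp only [Phi0] at this
    linarith
  have hφt : Tendsto (fun k => ((φ k : ℕ) : ℝ)) atTop atTop := tendsto_natCast_atTop_atTop.comp hφ.tendsto_atTop
  have ht0 : ∀ z ∈ DD d, -1 ≤ z.2 ∧ z.2 ≤ 0 := fun z hz => hz.2.2
  have hPhi : Tendsto (fun k => Phi S (P (φ k)).1 (P (φ k)).2) atTop (𝓝 (Phi S za zb)) :=
    ((Phi_cont S).tendsto (za, zb)).comp hlim
  have hPhi0 : Phi S za zb = 0 := by
    have hle : ∀ k, (φ k : ℝ) * Phi S (P (φ k)).1 (P (φ k)).2 ≤ 4 * m + 2 * μ := by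
      intro k
      have h1 := hval (φ k) z0 hz0
      have h2 : (P (φ k)).1 ∈ DD d ∧ (P (φ k)).2 ∈ DD d := hP (φ k)
      have := (abs_le.1 (hm1 _ h2.1)).2
      have := (abs_le.1 (hm2 _ h2.2)).2
      have := (abs_le.1 (hm1 _ hz0)).1
      have := (abs_le.1 (hm2 _ hz0)).1
      have := ht0 _ h2.1; have := ht0 _ h2.2; have := ht0 _ hz0
      nlinarith
    by_contra hne
    have hpp : 0 < Phi S za zb := lt_of_le_of_ne (Phi_nonneg S _ _) (Ne.symm hne)
    have := hφt.atTop_mul_pos hpp hPhi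
    obtain ⟨k, hk⟩ := (this.eventually_gt_atTop (4 * m + 2 * μ)).exists
    exact absurd (hle k) (not_le.2 hk)
  have hzz := Phi_zero S hPhi0
  subst hzz
  have hza : za ∈ DD d := hab.1
  have husc : ∀ e > 0, ∀ᶠ k in atTop, u1 (P (φ k)).1 + u2 (P (φ k)).2 < u1 za + u2 za + e := by
    intro e he
    have := hs (za, za) hab (u1 za + u2 za + e) (by simp only; linarith)
    have ht : Tendsto (P ∘ φ) atTop (𝓝[DD d ×ˢ DD d] (za, za)) :=
      tendsto_nhdsWithin_iff.2 ⟨hlim, Eventually.of_forall fun k => hP _⟩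
    exact ht.eventually this
  have hl1 : Tendsto (fun k => (P (φ k)).1) atTop (𝓝 za) := (continuous_fst.tendsto (za, za)).comp hlim
  have hl2 : Tendsto (fun k => (P (φ k)).2) atTop (𝓝 za) := (continuous_snd.tendsto (za, za)).comp hlim
  have hnb : za ∉ bd d := by
    intro hzb
    have := hb za hzb
    obtain ⟨k, hk⟩ := (husc μ hμ).exists
    have h1 := hval (φ k) z0 hz0
    have h2 : (P (φ k)).1 ∈ DD d ∧ (P (φ k)).2 ∈ DD d := hP (φ k)
    have := ht0 _ h2.1; have := ht0 _ h2.2; have := ht0 _ hz0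
    have : 0 ≤ (φ k : ℝ) * Phi S (P (φ k)).1 (P (φ k)).2 := mul_nonneg (Nat.cast_nonneg _) (Phi_nonneg S _ _)
    nlinarith
  have ev1 : ∀ᶠ k in atTop, (P (φ k)).1 ∉ bd d := hl1.eventually (bd_closed.isOpen_compl.mem_nhds hnb)
  have ev2 : ∀ᶠ k in atTop, (P (φ k)).2 ∉ bd d := hl2.eventually (bd_closed.isOpen_compl.mem_nhds hnb)
  have hdt : Tendsto (fun k => μ * (P (φ k)).1.2 + μ * (P (φ k)).2.2) atTop (𝓝 (μ * za.2 + μ * za.2)) :=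
    (((continuous_snd.tendsto za).comp hl1).const_mul μ).add (((continuous_snd.tendsto za).comp hl2).const_mul μ)
  have hds : Tendsto (fun k => |(P (φ k)).1.2 - (P (φ k)).2.2|) atTop (𝓝 |za.2 - za.2|) :=
    (((continuous_snd.tendsto za).comp hl1).sub ((continuous_snd.tendsto za).comp hl2)).abs
  rw [sub_self, abs_zero] at hds
  have ev3 := husc (ε / 2) (by linarith)
  have ev4 := hdt.eventually_const_lt (show μ * za.2 + μ * za.2 - ε / 2 < μ * za.2 + μ * za.2 by linarith)
  have ev5 := hds.eventually_lt_const hr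
  obtain ⟨k, k1, k2, k3, k4, k5⟩ := (ev1.and (ev2.and (ev3.and (ev4.and ev5)))).exists
  refine ⟨φ k, (P (φ k)).1, (P (φ k)).2, Nat.cast_nonneg _, (hP _).1, (hP _).2, k1, k2, ?_, k5.le, ?_⟩
  · have := hval (φ k) za hza
    nlinarith
  · intro z' hz' w' hw'
    have := hmax (φ k) (z', w') ⟨hz', hw'⟩
    simp only at this
    linarith
set_option maxHeartbeats 1000000 in
theorem comparison (S : Dat d) {u1 u2 : SpaceTime (d + 1) → ℝ} (hu1 : Sub S u1) (hu2 : Sub S u2)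
    (hs1 : UpperSemicontinuousOn u1 (DD d)) (hs2 : UpperSemicontinuousOn u2 (DD d)) {m : ℝ}
    (hm1 : ∀ w ∈ DD d, |u1 w| ≤ m) (hm2 : ∀ w ∈ DD d, |u2 w| ≤ m)
    (hb : ∀ w ∈ bd d, u1 w + u2 w ≤ 0) : ∀ z ∈ DD d, u1 z + u2 z ≤ 0 := by
  intro z0 hz0
  by_contra hcon
  push Not at hcon
  set μ := (u1 z0 + u2 z0) / 4 with hμ
  have hμp : 0 < μ := by linarith
  obtain ⟨C, hC, r0, hr0, hcoup⟩ := coupling S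
  have hl := S.lam_pos
  have hL := S.L_pos
  have hM : 0 < S.M := by linarith [S.M_pos]
  set ε := S.lam * μ / (4 * S.lam * S.L * S.M + 16 * C * S.M ^ 2) with hεd
  have hden : 0 < 4 * S.lam * S.L * S.M + 16 * C * S.M ^ 2 := by positivity
  have hε : 0 < ε := by positivity
  obtain ⟨k, z, w, hk, hz, hw, hzb, hwb, hkP, hts, hmax⟩ :=
    pen_points S hs1 hs2 hm1 hm2 hb hz0 hμp (by linarith) hε hr0
  have hzK : z ∈ Kc d 1 := (not_bd hz hzb).resolve_right fun hF =>
    noF S hu1 hF hw.2.1 hμp hk (fun z' hz' => by have := hmax z' hz' w hw; linarith)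
  have hwK : w ∈ Kc d 1 := (not_bd hw hwb).resolve_right fun hF =>
    noF S hu2 hF hz.2.1 hμp hk (fun w' hw' => by
      have := hmax z hz w' hw'
      rw [Phi_symm S w' z, Phi_symm S w z]; linarith)
  set T := |z.2 - w.2| with hT
  have hT0 : 0 ≤ T := abs_nonneg _
  have hT2 : T ^ 2 ≤ 4 * S.M ^ 2 * Phi S z w := Phi_time S z w
  set q := z.1 - w.1 + (VV S (z.2 + 0) - VV S (w.2 + 0)) with hq
  have hq2 : ‖q‖ ^ 2 ≤ Phi S z w := by
    have : q = z.1 + VV S z.2 - w.1 - VV S w.2 := by rw [hq, add_zero, add_zero]; abel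
    rw [this]; unfold Phi; nlinarith [sq_nonneg (lastC z.1 - lastC w.1)]
  have hqT : ‖q‖ * T ≤ 2 * S.M * Phi S z w := by
    have h1 : (‖q‖ * T) ^ 2 ≤ (2 * S.M * Phi S z w) ^ 2 := by
      have := mul_le_mul hq2 hT2 (by positivity) (Phi_nonneg S z w)
      nlinarith
    exact abs_le_of_sq_le_sq' h1 (by have := Phi_nonneg S z w; positivity) |>.2
  have hmargin : 2 * S.lam * k * S.L * T * ‖q‖ + 4 * k * (C * T ^ 2) ≤ S.lam * μ := by
    have e1 : (4 * S.lam * S.L * S.M + 16 * C * S.M ^ 2) * ε = S.lam * μ := by rw [hεd]; field_simp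
    have e2 : 2 * S.lam * k * S.L * T * ‖q‖ = (2 * S.lam * k * S.L) * (‖q‖ * T) := by ring
    have e3 := mul_le_mul_of_nonneg_left hqT (by positivity : 0 ≤ 2 * S.lam * k * S.L)
    have e4 := mul_le_mul_of_nonneg_left hT2 (by positivity : 0 ≤ 4 * k * C)
    have e5 := mul_le_mul_of_nonneg_left hkP hden.le
    rw [e2]; nlinarith
  have hlt : 2 * S.lam * k * S.L * T * ‖q‖ + 4 * k * (C * T ^ 2) < 3 / 2 * S.lam * μ := by nlinarith [mul_pos hl hμp]
  have ev1 : ∀ᶠ y : (Eucl (d + 1) × Eucl (d + 1)) × ℝ in 𝓝 ((z.1, w.1), 0),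
      2 * S.lam * k * S.L * T * ‖y.1.1 - y.1.2 + (VV S (z.2 + y.2) - VV S (w.2 + y.2))‖ + 4 * k * (C * T ^ 2)
        < 3 / 2 * S.lam * μ := by
    have hc : Continuous (fun y : (Eucl (d + 1) × Eucl (d + 1)) × ℝ =>
      2 * S.lam * k * S.L * T * ‖y.1.1 - y.1.2 + (VV S (z.2 + y.2) - VV S (w.2 + y.2))‖ + 4 * k * (C * T ^ 2)) := by
      have := VV_cont S; fun_prop
    exact hc.continuousAt.eventually_lt_const hlt
  have ev2 : ∀ᶠ y : (Eucl (d + 1) × Eucl (d + 1)) × ℝ in 𝓝 ((z.1, w.1), 0),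
      z.2 + y.2 ≤ 0 → (y.1.1, z.2 + y.2) ∈ Kc d 1 := by
    have hc : Continuous (fun y : (Eucl (d + 1) × Eucl (d + 1)) × ℝ => (y.1.1, z.2 + y.2)) := by fun_prop
    have := hc.tendsto ((z.1, w.1), 0)
    simp only [add_zero] at this
    exact this.eventually (Kc_nhds hzK)
  have ev3 : ∀ᶠ y : (Eucl (d + 1) × Eucl (d + 1)) × ℝ in 𝓝 ((z.1, w.1), 0),
      w.2 + y.2 ≤ 0 → (y.1.2, w.2 + y.2) ∈ Kc d 1 := by
    have hc : Continuous (fun y : (Eucl (d + 1) × Eucl (d + 1)) × ℝ => (y.1.2, w.2 + y.2)) := by fun_prop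
    have := hc.tendsto ((z.1, w.1), 0)
    simp only [add_zero] at this
    exact this.eventually (Kc_nhds hwK)
  obtain ⟨ρ, hρ, hball⟩ := Metric.eventually_nhds_iff_ball.1 (ev1.and (ev2.and ev3))
  set r := min (ρ / 2) 1 with hr
  have hrp : 0 < r := by rw [hr]; positivity
  have hr1 : r ≤ 1 := min_le_right _ _
  have hrρ : r < ρ := (min_le_left _ _).trans_lt (by linarith)
  have hin : ∀ x ∈ closedBall z.1 r, ∀ y ∈ closedBall w.1 r, ∀ τ ∈ Icc (-r) 0,
      ((x, y), τ) ∈ ball ((z.1, w.1), (0 : ℝ)) ρ := by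
    intro x hx y hy τ hτ
    rw [mem_ball, Prod.dist_eq, Prod.dist_eq, Real.dist_eq, sub_zero]
    refine max_lt (max_lt ((mem_closedBall.1 hx).trans_lt hrρ) ((mem_closedBall.1 hy).trans_lt hrρ)) ?_
    rw [abs_lt]; constructor <;> linarith [hτ.1, hτ.2]
  have hzc : z.1 ∈ closedBall z.1 r := by simp [hrp.le]
  have hwc : w.1 ∈ closedBall w.1 r := by simp [hrp.le]
  have hz2 : z.2 ≤ 0 := hz.2.2.2
  have hw2 : w.2 ≤ 0 := hw.2.2.2
  have c1 : ∀ x ∈ closedBall z.1 r, ∀ t ∈ Icc (z.2 - r) z.2, (x, t) ∈ Kc d 1 := by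
    intro x hx t ht
    have := (hball _ (hin x hx w.1 hwc (t - z.2) ⟨by linarith [ht.1], by linarith [ht.2]⟩)).2.1
    simp only [add_sub_cancel] at this
    exact this (ht.2.trans hz2)
  have c2 : ∀ x ∈ closedBall w.1 r, ∀ t ∈ Icc (w.2 - r) w.2, (x, t) ∈ Kc d 1 := by
    intro x hx t ht
    have := (hball _ (hin z.1 hzc x hx (t - w.2) ⟨by linarith [ht.1], by linarith [ht.2]⟩)).2.2
    simp only [add_sub_cancel] at this
    exact this (ht.2.trans hw2)
  set cst := u1 z + u2 w - k * Phi S z w with hcst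
  set A : Eucl (d + 1) × Eucl (d + 1) →L[ℝ] Eucl (d + 1) :=
    ContinuousLinearMap.fst ℝ _ _ - ContinuousLinearMap.snd ℝ _ _ with hA
  set ω : ℝ → Eucl (d + 1) := fun τ => VV S (z.2 + τ) - VV S (w.2 + τ) with hω
  have hωd : ∀ τ, HasDerivAt ω (S.v (z.2 + τ) - S.v (w.2 + τ)) τ := fun τ => by
    have h1 := (VV_deriv S (z.2 + τ)).comp_const_add z.2 τ
    have h2 := (VV_deriv S (w.2 + τ)).comp_const_add w.2 τ
    exact h1.sub h2
  have hωc : Continuous ω := continuous_iff_continuousAt.2 fun t => (hωd t).continuousAt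
  have hPhiEq : ∀ x y τ, ‖A (x, y) + ω τ‖ ^ 2 + ((lastL d).comp A (x, y) + 0) ^ 2 = Phi S (x, z.2 + τ) (y, w.2 + τ) := by
    intro x y τ
    have e1 : A (x, y) + ω τ = x + VV S (z.2 + τ) - y - VV S (w.2 + τ) := by
      show x - y + (VV S (z.2 + τ) - VV S (w.2 + τ)) = _
      abel
    rw [e1, add_zero]; rfl
  refine lemA S hu1 hu2 hs1 hs2 hm1 hm2 hrp hr1 hrp (c := S.lam * μ / 2) (by positivity) c1 c2
    (Ψ := fun y => 2 * μ * y.2 + k * (‖A y.1 + ω y.2‖ ^ 2 + ((lastL d).comp A y.1 + 0) ^ 2) + cst)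
    (by fun_prop) ?_ ?_ ?_
  · intro x hx y hy τ hτ
    have h1 := c1 x hx (z.2 + τ) ⟨by linarith [hτ.1], by linarith [hτ.2]⟩
    have h2 := c2 y hy (w.2 + τ) ⟨by linarith [hτ.1], by linarith [hτ.2]⟩
    have := hmax _ (Kc_sub h1) _ (Kc_sub h2)
    simp only [hPhiEq] at *
    linarith
  · have := hPhiEq z.1 w.1 0
    show 2 * μ * 0 + k * (‖A (z.1, w.1) + ω 0‖ ^ 2 + ((lastL d).comp A (z.1, w.1) + 0) ^ 2) + cst ≤ u1 z + u2 w
    rw [this, add_zero, add_zero]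
    show 2 * μ * 0 + k * Phi S z w + cst ≤ _
    linarith
  · intro y hy1 hy2
    obtain ⟨p, X, hj, _, hX⟩ := jet_pen (s := univ) (z := y) A (hωd y.2) ((lastL d).comp A) 0
    have hjt : JetW univ (fun y : (Eucl (d + 1) × Eucl (d + 1)) × ℝ => 2 * μ * y.2) y (2 * μ * 1) 0 0 :=
      JetW.time (g := fun τ => 2 * μ * τ) ((hasDerivAt_id y.2).const_mul (2 * μ))
    have e0 : (z.2 + y.2) - (w.2 + y.2) = z.2 - w.2 := by ring
    obtain ⟨n, ξ, ζ, r1, r2, r3⟩ := hcoup (z.2 + y.2) (w.2 + y.2) (by rw [e0]; exact hts)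
    refine ⟨_, _, _, (hjt.add (hj.smul k)).add_const cst, n, ξ, ζ, r1, r2, ?_⟩
    rw [e0] at r3
    have s1 : ∑ i, ((0 : Eucl (d + 1) × Eucl (d + 1) →L[ℝ] Eucl (d + 1) × Eucl (d + 1) →L[ℝ] ℝ) + k • X) (ξ i, ζ i) (ξ i, ζ i)
        ≤ ∑ i, 4 * k * ‖ξ i - ζ i‖ ^ 2 := Finset.sum_le_sum fun i _ => by
      have e1 : ((0 : Eucl (d + 1) × Eucl (d + 1) →L[ℝ] Eucl (d + 1) × Eucl (d + 1) →L[ℝ] ℝ) + k • X) (ξ i, ζ i) (ξ i, ζ i)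
        = 0 + k * X (ξ i, ζ i) (ξ i, ζ i) := rfl
      have e2 : A (ξ i, ζ i) = ξ i - ζ i := rfl
      have e3 : ((lastL d).comp A) (ξ i, ζ i) = lastC (ξ i - ζ i) := rfl
      have e4 := abs_lastC_le (ξ i - ζ i)
      have e5 : lastC (ξ i - ζ i) ^ 2 ≤ ‖ξ i - ζ i‖ ^ 2 := by
        rw [← sq_abs]; exact pow_le_pow_left₀ (abs_nonneg _) e4 2
      rw [e1, hX, e2, e3, zero_add]
      nlinarith
    rw [← Finset.mul_sum] at s1
    have s2 := mul_le_mul_of_nonneg_left r3 (by positivity : 0 ≤ 4 * k)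
    have hyb := (hball y (by
      obtain ⟨⟨y1, y2⟩, τ⟩ := y
      rw [← ball_prod_same] at hy1
      exact hin y1 (ball_subset_closedBall hy1.1) y2 (ball_subset_closedBall hy1.2) τ ⟨hy2.1.le, hy2.2⟩)).1
    have e6 : A y.1 + ω y.2 = y.1.1 - y.1.2 + (VV S (z.2 + y.2) - VV S (w.2 + y.2)) := rfl
    rw [← e6] at hyb
    have e7 := abs_real_inner_le_norm (A y.1 + ω y.2) (S.v (z.2 + y.2) - S.v (w.2 + y.2))
    have e8 := S.lipv (z.2 + y.2) (w.2 + y.2)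
    rw [e0] at e8
    have e9 : -(‖A y.1 + ω y.2‖ * (S.L * T)) ≤ ⟪A y.1 + ω y.2, S.v (z.2 + y.2) - S.v (w.2 + y.2)⟫ := by
      have := (abs_le.1 e7).1
      have := mul_le_mul_of_nonneg_left e8 (norm_nonneg (A y.1 + ω y.2))
      linarith
    have e10 := mul_le_mul_of_nonneg_left e9 (by positivity : 0 ≤ 2 * S.lam * k)
    set I := ⟪A y.1 + ω y.2, S.v (z.2 + y.2) - S.v (w.2 + y.2)⟫
    set N := ‖A y.1 + ω y.2‖
    have f1 : S.lam * (2 * μ * 1 + k * (2 * I)) = 2 * S.lam * μ + 2 * S.lam * k * I := by ring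
    have f2 : 2 * S.lam * k * (-(N * (S.L * T))) = -(2 * S.lam * k * S.L * T * N) := by ring
    rw [f1]
    rw [f2] at e10
    linarith
def cl (t : ℝ) : ℝ := max (-1) (min t 0)
lemma cl_mem (t : ℝ) : cl t ∈ Icc (-1 : ℝ) 0 :=
  ⟨le_max_left _ _, max_le (by norm_num) (min_le_right _ _)⟩
lemma cl_of {t : ℝ} (h : t ∈ Icc (-1 : ℝ) 0) : cl t = t := by
  unfold cl; rw [min_eq_left h.2, max_eq_right h.1]
lemma cl_lip (t s : ℝ) : |cl t - cl s| ≤ |t - s| := by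
  unfold cl
  refine (abs_max_sub_max_le_max _ _ _ _).trans (max_le (by simp) ?_)
  exact (abs_min_sub_min_le_max _ _ _ _).trans (max_le le_rfl (by simp))
lemma entry_le {n : ℕ} (A : Matrix (Fin n) (Fin n) ℝ) (i j : Fin n) : |A i j| ≤ matOpNorm A := by
  have h1 : (LinearMap.toContinuousLinearMap (Matrix.toEuclideanLin A))
      (EuclideanSpace.single j 1) i = A i j := by
    simp [Matrix.toEuclideanLin_apply]
  have h2 := (LinearMap.toContinuousLinearMap (Matrix.toEuclideanLin A)).le_opNorm
    (EuclideanSpace.single j (1 : ℝ))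
  have h3 := PiLp.norm_apply_le ((LinearMap.toContinuousLinearMap (Matrix.toEuclideanLin A))
      (EuclideanSpace.single j (1 : ℝ))) i
  rw [h1] at h3
  simp only [EuclideanSpace.norm_single, norm_one, mul_one] at h2
  exact h3.trans h2
lemma psd_quad {n : ℕ} {A : Matrix (Fin n) (Fin n) ℝ} (h : A.PosSemidef) (x : Fin n → ℝ) :
    0 ≤ ∑ i, ∑ j, A i j * (x i * x j) := by
  have := h.dotProduct_mulVec_nonneg x
  simp only [dotProduct, Matrix.mulVec, Finset.mul_sum, star_trivial] at this
  refine this.trans_eq (Finset.sum_congr rfl fun i _ => Finset.sum_congr rfl fun j _ => ?_)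
  ring
lemma one_quad {n : ℕ} (c : ℝ) (x : Fin n → ℝ) :
    ∑ i, ∑ j, (c • (1 : Matrix (Fin n) (Fin n) ℝ)) i j * (x i * x j) = c * ∑ i, x i ^ 2 := by
  rw [Finset.mul_sum]
  refine Finset.sum_congr rfl fun i _ => ?_
  simp [Matrix.one_apply, pow_two]
lemma Qbound {n : ℕ} {A : Matrix (Fin n) (Fin n) ℝ} {c : ℝ} (hs : A.IsSymm)
    (h1 : ∀ x : Fin n → ℝ, 0 ≤ ∑ i, ∑ j, A i j * (x i * x j))
    (h2 : ∀ x : Fin n → ℝ, ∑ i, ∑ j, A i j * (x i * x j) ≤ c * ∑ i, x i ^ 2) (i j : Fin n) :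
    |A i j| ≤ c := by
  have ev : ∀ a b : ℝ, ∀ i j, i ≠ j → ∑ k, ∑ l, A k l * ((Pi.single i a + Pi.single j b : Fin n → ℝ) k *
      (Pi.single i a + Pi.single j b : Fin n → ℝ) l) = a ^ 2 * A i i + 2 * a * b * A i j + b ^ 2 * A j j := by
    intro a b i j hij
    simp only [Pi.add_apply, add_mul, mul_add, Finset.sum_add_distrib]
    simp [Pi.single_apply, hij, hs.apply i j]; ring
  have ev1 : ∀ i, ∑ k, ∑ l, A k l * ((Pi.single i 1 : Fin n → ℝ) k * (Pi.single i 1 : Fin n → ℝ) l) = A i i := by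
    intro i; simp [Pi.single_apply]
  have e1 : ∀ i, ∑ k, (Pi.single i (1 : ℝ) : Fin n → ℝ) k ^ 2 = 1 := by
    intro i; simp [Pi.single_apply]
  have d0 : ∀ i, 0 ≤ A i i := fun i => by have := h1 (Pi.single i 1); rwa [ev1] at this
  have d1 : ∀ i, A i i ≤ c := fun i => by
    have := h2 (Pi.single i 1); rwa [ev1, e1, mul_one] at this
  rcases eq_or_ne i j with rfl | hij
  · rw [abs_of_nonneg (d0 i)]; exact d1 i
  · have a1 := h1 (Pi.single i 1 + Pi.single j 1)
    have a2 := h1 (Pi.single i 1 + Pi.single j (-1))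
    rw [ev _ _ _ _ hij] at a1 a2
    have := d1 i; have := d1 j
    rw [abs_le]; constructor <;> linarith
lemma exists_dat {lam Λ M C₀ : ℝ}
    {Q Q' : ℝ → Matrix (Fin (d + 1)) (Fin (d + 1)) ℝ} {v v' : ℝ → Eucl (d + 1)}
    (h : ObliqueData d lam Λ M C₀ Q Q' v v') : ∃ S : Dat d, Agree S lam Q v := by
  have hM := h.M_ge_one
  have hLL : 0 < Λ * M ^ 2 := by have := h.Lam_ge_one; positivity
  have hlow : ∀ t (x : Fin (d + 1) → ℝ), (Λ * M ^ 2)⁻¹ * ∑ i, x i ^ 2 ≤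
      ∑ i, ∑ j, Q (cl t) i j * (x i * x j) := by
    intro t x
    have := psd_quad (h.Qlower _ (cl_mem t)) x
    simp only [Matrix.sub_apply, sub_mul, Finset.sum_sub_distrib] at this
    rw [one_quad] at this; linarith
  have hup : ∀ t (x : Fin (d + 1) → ℝ), 
      ∑ i, ∑ j, Q (cl t) i j * (x i * x j) ≤ (Λ * M ^ 2) * ∑ i, x i ^ 2 := by
    intro t x
    have := psd_quad (h.Qupper _ (cl_mem t)) x
    simp only [Matrix.sub_apply, sub_mul, Finset.sum_sub_distrib] at this
    rw [one_quad] at this; linarith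
  have hl := h.lam_pos
  have hC := h.C0_pos
  refine ⟨⟨lam, Λ * M ^ 2, M, max (C₀ / lam) lam⁻¹, Λ * M ^ 2, fun t => Q (cl t), fun t => v (cl t),
    hl, hLL, hM, lt_max_of_lt_right (by positivity), hLL, ?_, hlow, ?_, ?_, ?_,
    fun t => h.vlast _ (cl_mem t), fun t => h.vbound _ (cl_mem t)⟩, rfl, fun t ht => ?_⟩
  · intro t i j; exact (h.Qsymm _ (cl_mem t)).apply j i
  · intro t i j
    exact Qbound (h.Qsymm _ (cl_mem t)) (fun x => le_trans (by positivity) (hlow t x)) (hup t) i j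
  · intro t s i j
    have := (convex_Icc (-1 : ℝ) 0).norm_image_sub_le_of_norm_hasDerivWithin_le
      (fun x hx => h.Qderiv x hx i j) (fun x hx => (entry_le _ i j).trans (h.Qderiv_bound x hx))
      (cl_mem s) (cl_mem t)
    refine this.trans ?_
    exact mul_le_mul (le_max_left _ _) (cl_lip t s) (abs_nonneg _) (by positivity)
  · intro t s
    have := (convex_Icc (-1 : ℝ) 0).norm_image_sub_le_of_norm_hasDerivWithin_le
      h.vderiv h.vderiv_bound (cl_mem s) (cl_mem t)
    refine this.trans ?_
    exact mul_le_mul (le_max_right _ _) (cl_lip t s) (abs_nonneg _) (by positivity)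
  · simp [cl_of ht]
lemma pol_jet {s : Set (SpaceTime (d + 1))} (z w : SpaceTime (d + 1)) (a : ℝ) (p : Eucl (d + 1) →L[ℝ] ℝ)
    (X : Eucl (d + 1) →L[ℝ] Eucl (d + 1) →L[ℝ] ℝ) :
    JetW s (pol z a p X) w a (p + (1 / 2 : ℝ) • (X (w.1 - z.1) + X.flip (w.1 - z.1))) X := by
  have h1 : JetW s (fun y : SpaceTime (d + 1) => a * (y.2 - z.2)) w a 0 0 := by
    have := ((hasDerivAt_id w.2).sub_const z.2).const_mul a
    rw [mul_one] at this
    exact JetW.time this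
  have h2 : JetW s (fun y : SpaceTime (d + 1) => p y.1 + (- p z.1)) w 0 p 0 := (JetW.lin p).add_const _
  have h3 := JetW.quad (s := s) (z := w) ((1 / 2 : ℝ) • X) z.1
  have h := (h1.add h2).add h3
  have e : ∀ y, pol z a p X y = a * (y.2 - z.2) + (p y.1 + - p z.1) +
      ((1 / 2 : ℝ) • X) (y.1 - z.1) (y.1 - z.1) := by
    intro y; simp [pol]; ring
  rw [show pol z a p X = fun y => a * (y.2 - z.2) + (p y.1 + - p z.1) +
      ((1 / 2 : ℝ) • X) (y.1 - z.1) (y.1 - z.1) from funext e]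
  convert h using 1
  · ring
  · ext k; simp
  · ext k l
    change X k l = (0 : ℝ) + 0 + (2 : ℕ) • ((1 / 2 : ℝ) * X k l)
    rw [nsmul_eq_mul]; push_cast; ring
lemma pol_cont (z : SpaceTime (d + 1)) (a : ℝ) (p : Eucl (d + 1) →L[ℝ] ℝ)
    (X : Eucl (d + 1) →L[ℝ] Eucl (d + 1) →L[ℝ] ℝ) : Continuous (pol z a p X) := by
  unfold pol; fun_prop
lemma trQ_cont (S : Dat d) (X : Eucl (d + 1) →L[ℝ] Eucl (d + 1) →L[ℝ] ℝ) :
    Continuous fun t => trQ (S.Q t) X := by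
  unfold trQ
  refine continuous_finset_sum _ fun i _ => continuous_finset_sum _ fun j _ => ?_
  refine Continuous.mul ?_ continuous_const
  rw [Metric.continuous_iff]
  intro t ε hε
  refine ⟨ε / S.L, div_pos hε S.L_pos, fun s hs => ?_⟩
  rw [Real.dist_eq] at *
  refine (S.lipQ s t i j).trans_lt ?_
  rw [lt_div_iff₀ S.L_pos] at hs; linarith
lemma trQ_LL (S : Dat d) (t : ℝ) : S.Λ⁻¹ ≤ trQ (S.Q t) ((lastL d).smulRight (lastL d)) := by
  have h := S.ell t (Pi.single (Fin.last d) 1)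
  have : trQ (S.Q t) ((lastL d).smulRight (lastL d)) =
      ∑ i, ∑ j, S.Q t i j * ((Pi.single (Fin.last d) 1 : Fin (d + 1) → ℝ) i *
        (Pi.single (Fin.last d) 1 : Fin (d + 1) → ℝ) j) := by
    unfold trQ
    refine Finset.sum_congr rfl fun i _ => Finset.sum_congr rfl fun j _ => ?_
    have : ∀ i, lastL d (ee i) = (Pi.single (Fin.last d) 1 : Fin (d + 1) → ℝ) i := by
      intro i
      rw [lastL_apply]; simp [lastC, ee, Pi.single_apply, eq_comm]
    rw [ContinuousLinearMap.smulRight_apply, ContinuousLinearMap.smul_apply, this, this]; rfl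
  rw [this]
  refine le_trans (le_of_eq ?_) h
  simp [Pi.single_apply]
lemma strict_poly (S : Dat d) {W : SpaceTime (d + 1) → ℝ} {z : SpaceTime (d + 1)} {a p X}
    (hj : SJ (DD d) W z a p X)
    (hv : (z ∈ Kc d 1 ∧ trQ (S.Q z.2) X < S.lam * a) ∨ (z ∈ Fc d 1 ∧ p (S.v z.2) < a)) :
    ∃ ε > 0, ∃ a' p' X', (∀ᶠ w in 𝓝[DD d ∩ past z] z, W w ≤ W z + pol z a' p' X' w - ε * NN z w) ∧
      trQ (S.Q z.2) X' < S.lam * a' ∧ (z ∈ Fc d 1 → p' (S.v z.2) < a') := by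
  have hB := S.B_pos
  have hlam := S.lam_pos
  have hI := trQ_idX_le S z.2
  rcases hv with ⟨hz, hv⟩ | ⟨hz, hv⟩
  · obtain ⟨ε, hε, hε'⟩ : ∃ ε > 0, ε * (2 * S.lam + 4 * ((d + 1) * S.B)) < S.lam * a - trQ (S.Q z.2) X := by
      refine ⟨(S.lam * a - trQ (S.Q z.2) X) / (2 * S.lam + 4 * ((d + 1) * S.B)) / 2, ?_, ?_⟩
      · have := sub_pos.2 hv; positivity
      · have := sub_pos.2 hv
        have h0 : 0 < 2 * S.lam + 4 * ((d + 1) * S.B) := by positivity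
        rw [div_div, mul_comm _ (2 : ℝ), ← div_div, div_mul_cancel₀ _ h0.ne']; linarith
    refine ⟨ε, hε, a - 2 * ε, p, X + (4 * ε) • idX d, ?_, ?_, ?_⟩
    · filter_upwards [hj ε hε, self_mem_nhdsWithin] with w hw hw2
      refine hw.trans ?_
      have h2 : w.2 ≤ z.2 := hw2.2
      simp only [pol, NN, ContinuousLinearMap.add_apply, ContinuousLinearMap.smul_apply, idX_apply,
        real_inner_self_eq_norm_sq, smul_eq_mul]
      rw [abs_of_nonpos (by linarith)]; linarith
    · rw [trQ_add, trQ_smul]; nlinarith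
    · intro h; exact absurd h.2.1 (ne_of_gt hz.2.1)
  · have hvn := S.vlast z.2
    have hM := S.M_pos
    have hvn2 : 0 < lastC (S.v z.2) := lt_of_lt_of_le (by positivity) hvn
    obtain ⟨ε, hε, hε'⟩ : ∃ ε > 0, ε * (2 + lastC (S.v z.2)) < a - p (S.v z.2) := by
      have := sub_pos.2 hv
      refine ⟨(a - p (S.v z.2)) / (2 + lastC (S.v z.2)) / 2, ?_, ?_⟩
      · positivity
      · have h0 : 0 < 2 + lastC (S.v z.2) := by positivity
        rw [div_div, mul_comm _ (2 : ℝ), ← div_div, div_mul_cancel₀ _ h0.ne']; linarith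
    obtain ⟨A, hA, hA2⟩ : ∃ A : ℝ, 0 < A ∧ trQ (S.Q z.2) X + 4 * ε * ((d + 1) * S.B) - 2 * A * S.Λ⁻¹ <
        S.lam * (a - 2 * ε) := by
      have hL := S.Λ_pos
      refine ⟨S.Λ * (|trQ (S.Q z.2) X + 4 * ε * ((d + 1) * S.B) - S.lam * (a - 2 * ε)| + 1), by positivity, ?_⟩
      have : 2 * (S.Λ * (|trQ (S.Q z.2) X + 4 * ε * ((d + 1) * S.B) - S.lam * (a - 2 * ε)| + 1)) * S.Λ⁻¹ =
        2 * (|trQ (S.Q z.2) X + 4 * ε * ((d + 1) * S.B) - S.lam * (a - 2 * ε)| + 1) := by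
        field_simp
      rw [this]
      have := le_abs_self (trQ (S.Q z.2) X + 4 * ε * ((d + 1) * S.B) - S.lam * (a - 2 * ε))
      linarith [abs_nonneg (trQ (S.Q z.2) X + 4 * ε * ((d + 1) * S.B) - S.lam * (a - 2 * ε))]
    refine ⟨ε, hε, a - 2 * ε, p + ε • lastL d,
      X + (4 * ε) • idX d + (-(2 * A)) • (lastL d).smulRight (lastL d), ?_, ?_, ?_⟩
    · have hev : ∀ᶠ w in 𝓝[DD d ∩ past z] z, lastC (w.1 - z.1) < ε / A := by
        apply eventually_nhdsWithin_of_eventually_nhds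
        have : ContinuousAt (fun w : SpaceTime (d + 1) => lastC (w.1 - z.1)) z :=
          (lastC_cont.comp (by fun_prop : Continuous fun w : SpaceTime (d + 1) => w.1 - z.1)).continuousAt
        exact this.eventually (gt_mem_nhds (by
          show lastC (z.1 - z.1) < _
          rw [sub_self]; have : lastC (0 : Eucl (d + 1)) = 0 := by simp [lastC]
          rw [this]; positivity))
      filter_upwards [hj ε hε, self_mem_nhdsWithin, hev] with w hw hw2 hw3
      refine hw.trans ?_
      have h2 : w.2 ≤ z.2 := hw2.2
      have h0 : 0 ≤ lastC (w.1 - z.1) := by rw [lastC_sub, hz.2.1]; linarith [hw2.1.2.1]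
      simp only [pol, NN, ContinuousLinearMap.add_apply, ContinuousLinearMap.smul_apply, idX_apply,
        real_inner_self_eq_norm_sq, smul_eq_mul, ContinuousLinearMap.smulRight_apply, lastL_apply]
      rw [abs_of_nonpos (by linarith)]
      rw [lt_div_iff₀ hA] at hw3
      nlinarith [mul_nonneg h0 (sub_nonneg.2 hw3.le)]
    · rw [trQ_add, trQ_add, trQ_smul, trQ_smul]
      have := trQ_LL S z.2
      nlinarith
    · intro _
      simp only [ContinuousLinearMap.add_apply, ContinuousLinearMap.smul_apply, lastL_apply, smul_eq_mul]
      linarith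
lemma future_sep {G : SpaceTime (d + 1) → ℝ} (hG : UpperSemicontinuousOn G (DD d)) (z : SpaceTime (d + 1))
    {ρ δ : ℝ} (hρ : 0 < ρ)
    (h : ∀ w ∈ DD d, ‖w.1 - z.1‖ = ρ → w.2 = z.2 → G w < δ) :
    ∃ σ > 0, σ ≤ ρ ∧ ∀ w ∈ DD d, ‖w.1 - z.1‖ = ρ → z.2 ≤ w.2 → w.2 ≤ z.2 + σ → G w < δ := by
  obtain ⟨V, hV, hV2⟩ := upperSemicontinuousOn_iff_preimage_Ici.1 hG δ
  set C : Set (SpaceTime (d + 1)) := (DD d ∩ V) ∩ {w | ‖w.1 - z.1‖ = ρ ∧ z.2 ≤ w.2} with hC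
  have hCc : IsCompact C := (DD_compact.inter_right hV).inter_right
    ((isClosed_eq (f := fun w : SpaceTime (d + 1) => ‖w.1 - z.1‖) (g := fun _ => ρ) (by fun_prop) continuous_const).inter
      (isClosed_le (f := fun _ : SpaceTime (d + 1) => z.2) (g := fun w => w.2) continuous_const (by fun_prop)))
  have key : ∀ w ∈ DD d, δ ≤ G w → w ∈ DD d ∩ V := fun w hw h => by rw [← hV2]; exact ⟨hw, h⟩
  rcases C.eq_empty_or_nonempty with he | hne
  · refine ⟨ρ, hρ, le_rfl, fun w hw h1 h2 _ => ?_⟩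
    by_contra h4
    have : w ∈ C := ⟨key w hw (not_lt.1 h4), h1, h2⟩
    rw [he] at this; exact this
  · obtain ⟨w0, hw0, hmin⟩ := hCc.exists_isMinOn hne (continuous_snd.continuousOn)
    have h0 : z.2 < w0.2 := by
      refine lt_of_le_of_ne hw0.2.2 fun e => ?_
      have h1 := h w0 hw0.1.1 hw0.2.1 e.symm
      have : w0 ∈ DD d ∩ G ⁻¹' Ici δ := by rw [hV2]; exact hw0.1
      exact absurd this.2 (not_le.2 h1)
    refine ⟨min ρ ((w0.2 - z.2) / 2), lt_min hρ (by linarith), min_le_left _ _, fun w hw h1 h2 h3 => ?_⟩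
    by_contra h4
    have : w ∈ C := ⟨key w hw (not_lt.1 h4), h1, h2⟩
    have := hmin this
    simp only [mem_setOf_eq] at this
    have := min_le_right ρ ((w0.2 - z.2) / 2)
    linarith
lemma bump (S : Dat d) {W : SpaceTime (d + 1) → ℝ} (hW : UpperSemicontinuousOn W (DD d)) {m : ℝ}
    (hm : ∀ w ∈ DD d, W w ≤ m) {z : SpaceTime (d + 1)} {a p X}
    (hj : SJ (DD d) W z a p X)
    (hv : (z ∈ Kc d 1 ∧ trQ (S.Q z.2) X < S.lam * a) ∨ (z ∈ Fc d 1 ∧ p (S.v z.2) < a)) :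
    ∃ P : SpaceTime (d + 1) → ℝ, ∃ ρ > 0, ∃ σ > 0, ∃ c > 0, Continuous P ∧ P z = W z ∧
      ∀ w ∈ DD d, ‖w.1 - z.1‖ ≤ ρ → |w.2 - z.2| ≤ σ → w ∉ bd d ∧
        ((‖w.1 - z.1‖ = ρ ∨ |w.2 - z.2| = σ) → W w < P w - c) ∧
        ∃ a p X, JetW (DD d ∩ past w) P w a p X ∧ (w ∈ Kc d 1 → trQ (S.Q w.2) X < S.lam * a) ∧
          (w ∈ Fc d 1 → p (S.v w.2) < a) := by
  obtain ⟨ε, hε, a, p, X, hle, hK, hF⟩ := strict_poly S hj hv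
  have hlam := S.lam_pos
  have hzD : z ∉ bd d := by
    have : z ∈ KcP d 1 := by rcases hv with h | h; exacts [Or.inl h.1, Or.inr h.1]
    rw [KcP_eq] at this; exact this.2
  have e1 : ∀ᶠ w in 𝓝 z, w ∈ DD d → w.2 ≤ z.2 → W w ≤ W z + pol z a p X w - ε * NN z w := by
    rw [eventually_nhdsWithin_iff] at hle
    filter_upwards [hle] with w hw h1 h2 using hw ⟨h1, h2⟩
  have e2 : ∀ᶠ w in 𝓝 z, trQ (S.Q w.2) X < S.lam * a :=
    ((trQ_cont S X).comp continuous_snd).continuousAt.eventually (gt_mem_nhds hK)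
  have e3 : ∀ᶠ w in 𝓝 z, w ∈ Fc d 1 →
      (p + (1 / 2 : ℝ) • (X (w.1 - z.1) + X.flip (w.1 - z.1))) (S.v w.2) < a := by
    rcases hv with hv | hv
    · filter_upwards [Kc_nhds hv.1] with w hw h1
      exact absurd h1.2.1 (ne_of_gt (hw h1.2.2.2).2.1)
    · have hc : Continuous fun w : SpaceTime (d + 1) =>
          (p + (1 / 2 : ℝ) • (X (w.1 - z.1) + X.flip (w.1 - z.1))) (S.v w.2) := by
        have := v_cont S
        fun_prop
      have := hc.continuousAt (x := z) |>.eventually_lt (continuousAt_const (y := a)) (by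
        simpa using hF hv.1)
      filter_upwards [this] with w hw _ using hw
  have e4 : ∀ᶠ w in 𝓝 z, w ∉ bd d := bd_closed.isOpen_compl.mem_nhds hzD
  obtain ⟨r, hr, hball⟩ := Metric.eventually_nhds_iff.1 (e1.and (e2.and (e3.and e4)))
  set ρ := r / 2 with hρd
  have hρ : 0 < ρ := by positivity
  have hin : ∀ w : SpaceTime (d + 1), ‖w.1 - z.1‖ ≤ ρ → |w.2 - z.2| ≤ ρ → dist w z < r := by
    intro w h1 h2
    rw [Prod.dist_eq, dist_eq_norm, Real.dist_eq]
    exact max_lt (by linarith) (by linarith)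
  have hP0 : Continuous fun w => W z + pol z a p X w := continuous_const.add (pol_cont z a p X)
  obtain ⟨σ, hσ, hσρ, hsep⟩ := future_sep (G := fun w => W w + - (W z + pol z a p X w))
    (usc_cont_add hW hP0.neg.continuousOn) z (δ := - (ε * ρ ^ 2 / 2)) hρ (by
      intro w hw h1 h2
      have := (hball (hin w h1.le (by rw [h2]; simpa using hρ.le))).1 hw h2.le
      simp only [NN, h1, h2, sub_self, abs_zero] at this
      have : 0 < ε * ρ ^ 2 := by positivity
      linarith)
  obtain ⟨m0, hm0⟩ := DD_compact.exists_bound_of_continuousOn hP0.continuousOn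
  set c := min (ε * ρ ^ 2 / 2) (ε * σ / 2) with hc
  have hcpos : 0 < c := lt_min (by positivity) (by positivity)
  have hc1 := min_le_left (ε * ρ ^ 2 / 2) (ε * σ / 2)
  have hc2 := min_le_right (ε * ρ ^ 2 / 2) (ε * σ / 2)
  rw [← hc] at hc1 hc2
  set k := (|m| + |m0| + c + 1) / σ with hk
  have hkpos : 0 < k := by positivity
  have hkσ : k * σ = |m| + |m0| + c + 1 := by rw [hk]; field_simp
  refine ⟨fun w => (W z + pol z a p X w) + k * max (w.2 - z.2) 0, ρ, hρ, σ, hσ, c, hcpos, by fun_prop,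
    by simp [pol], fun w hw h1 h2 => ?_⟩
  obtain ⟨b1, b2, b3, b4⟩ := hball (hin w h1 (h2.trans hσρ))
  refine ⟨b4, ?_, ?_⟩
  · intro hor
    have hmx : 0 ≤ k * max (w.2 - z.2) 0 := by positivity
    rcases le_total w.2 z.2 with ht | ht
    · have := b1 hw ht
      have hN : c < ε * NN z w := by
        unfold NN
        rcases hor with h | h
        · rw [h]; nlinarith [abs_nonneg (w.2 - z.2), mul_pos hε (pow_pos hρ 2)]
        · rw [h]; nlinarith [sq_nonneg ‖w.1 - z.1‖, mul_pos hε hσ]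
      linarith
    · have ha : |w.2 - z.2| = w.2 - z.2 := abs_of_nonneg (by linarith)
      rcases hor with h | h
      · have := hsep w hw h ht (by linarith)
        linarith
      · show W w < W z + pol z a p X w + k * max (w.2 - z.2) 0 - c
        rw [← ha, h, max_eq_left hσ.le, hkσ]
        have h5 := hm w hw
        have h6 := (abs_le.1 (hm0 w hw)).1
        have := le_abs_self m; have := le_abs_self m0
        linarith
  · have hpj := (pol_jet (s := DD d ∩ past w) z w a p X)
    rcases le_or_gt w.2 z.2 with ht | ht
    · refine ⟨a, _, X, (hpj.add_const (W z)).congr ?_ ?_, fun _ => b2, b3⟩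
      · rw [max_eq_right (by linarith)]; ring
      · filter_upwards [self_mem_nhdsWithin] with y hy
        have : y.2 ≤ w.2 := hy.2
        rw [max_eq_right (by linarith)]; ring
    · have hd : HasDerivAt (fun t : ℝ => k * max (t - z.2) 0) k w.2 := by
        have h0 : HasDerivAt (fun t : ℝ => k * (t - z.2)) k w.2 := by
          simpa using ((hasDerivAt_id w.2).sub_const z.2).const_mul k
        refine h0.congr_of_eventuallyEq ?_
        filter_upwards [lt_mem_nhds ht] with t ht
        rw [max_eq_left (by linarith)]
      refine ⟨a + k, _, X + 0, ((hpj.add_const (W z)).add (JetW.time hd)).congr ?_ ?_, fun h => ?_,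
        fun h => ?_⟩
      · ring
      · exact Eventually.of_forall fun y => by ring
      · rw [trQ_add, trQ_zero, add_zero, mul_add]; have := mul_pos hlam hkpos; linarith
      · have := b3 h
        rw [ContinuousLinearMap.add_apply]
        show _ + (0 : ℝ) < _
        linarith
def env (f : SpaceTime (d + 1) → ℝ) (z : SpaceTime (d + 1)) : ℝ :=
  sInf {y | ∀ᶠ w in 𝓝[DD d] z, f w ≤ y}
section env
variable {f : SpaceTime (d + 1) → ℝ} {m : ℝ}
lemma env_set_bdd (hf : ∀ w ∈ DD d, |f w| ≤ m) {z} (hz : z ∈ DD d) :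
    BddBelow {y | ∀ᶠ w in 𝓝[DD d] z, f w ≤ y} := by
  refine ⟨f z, fun y hy => ?_⟩
  exact hy.self_of_nhdsWithin hz
lemma env_set_ne (hf : ∀ w ∈ DD d, |f w| ≤ m) (z) :
    (m : ℝ) ∈ {y | ∀ᶠ w in 𝓝[DD d] z, f w ≤ y} := by
  show ∀ᶠ w in 𝓝[DD d] z, f w ≤ m
  filter_upwards [self_mem_nhdsWithin] with w hw using (abs_le.1 (hf w hw)).2
lemma le_env (hf : ∀ w ∈ DD d, |f w| ≤ m) {z} (hz : z ∈ DD d) : f z ≤ env f z :=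
  le_csInf ⟨m, env_set_ne hf z⟩ fun y hy => by
    have hy : ∀ᶠ w in 𝓝[DD d] z, f w ≤ y := hy
    exact hy.self_of_nhdsWithin hz
lemma env_le (hf : ∀ w ∈ DD d, |f w| ≤ m) {z} (hz : z ∈ DD d) {y : ℝ}
    (h : ∀ᶠ w in 𝓝[DD d] z, f w ≤ y) : env f z ≤ y := csInf_le (env_set_bdd hf hz) h
lemma env_abs (hf : ∀ w ∈ DD d, |f w| ≤ m) {z} (hz : z ∈ DD d) : |env f z| ≤ m :=
  abs_le.2 ⟨(abs_le.1 (hf z hz)).1.trans (le_env hf hz), env_le hf hz (env_set_ne hf z)⟩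
lemma env_ev (hf : ∀ w ∈ DD d, |f w| ≤ m) {z} {y : ℝ} (h : env f z < y) :
    ∀ᶠ w in 𝓝[DD d] z, f w < y := by
  obtain ⟨y', hy', h2⟩ := exists_lt_of_csInf_lt ⟨m, env_set_ne hf z⟩ h
  have : ∀ᶠ w in 𝓝[DD d] z, f w ≤ y' := hy'
  filter_upwards [this] with w hw using hw.trans_lt h2
lemma env_freq (hf : ∀ w ∈ DD d, |f w| ≤ m) {z} (hz : z ∈ DD d) {y : ℝ} (h : y < env f z) :
    ∃ᶠ w in 𝓝[DD d] z, y < f w := by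
  intro hn
  have : env f z ≤ y := env_le hf hz (by filter_upwards [hn] with w hw using not_lt.1 hw)
  linarith
lemma env_usc (hf : ∀ w ∈ DD d, |f w| ≤ m) : UpperSemicontinuousOn (env f) (DD d) := by
  intro z hz y hy
  obtain ⟨y', h1, h2⟩ := exists_between hy
  have := eventually_eventually_nhdsWithin.2 (env_ev hf h1)
  filter_upwards [this, self_mem_nhdsWithin] with w hw hwD
  exact (env_le hf hwD (by filter_upwards [hw] with x hx using hx.le)).trans_lt h2
lemma env_le_cont (hf : ∀ w ∈ DD d, |f w| ≤ m) {g : SpaceTime (d + 1) → ℝ}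
    (hg : ContinuousOn g (DD d)) (h : ∀ w ∈ DD d, f w ≤ g w) {z} (hz : z ∈ DD d) : env f z ≤ g z := by
  refine le_of_forall_pos_le_add fun ε hε => env_le hf hz ?_
  have := (hg z hz).eventually_lt (continuousWithinAt_const (b := g z + ε)) (by linarith)
  filter_upwards [this, self_mem_nhdsWithin] with w hw hwD using (h w hwD).trans hw.le
end env
lemma Sub_congr {S : Dat d} {u u' : SpaceTime (d + 1) → ℝ} (h : Sub S u) (e : ∀ w ∈ DD d, u w = u' w) :
    Sub S u' := by
  have key : ∀ z ∈ DD d, ∀ a p X, SJ (DD d) u' z a p X → SJ (DD d) u z a p X := fun z hz a p X hs =>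
    hs.of_le (e z hz) (by filter_upwards [self_mem_nhdsWithin] with w hw using (e w hw.1).le)
  exact ⟨fun z hz a p X hs => h.1 z hz a p X (key z (Kc_sub hz) a p X hs),
    fun z hz a p X hs => h.2 z hz a p X (key z (Fc_sub hz) a p X hs)⟩
lemma Sub_const (S : Dat d) (c : ℝ) : Sub S (fun _ => c) :=
  ⟨fun z hz a p X h => jet_K S hz h (JetW.const c) (by rw [trQ_zero]; simp),
   fun z hz a p X h => jet_F S hz h (JetW.const c) (by simp)⟩
structure PS (S : Dat d) (ψ : SpaceTime (d + 1) → ℝ) (m : ℝ) (s : SpaceTime (d + 1) → ℝ) : Prop where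
  usc : UpperSemicontinuousOn s (DD d)
  sub : Sub S s
  bdy : ∀ w ∈ bd d, s w ≤ ψ w
  low : ∀ w ∈ DD d, -m ≤ s w
lemma usc_abs {s : SpaceTime (d + 1) → ℝ} (h : UpperSemicontinuousOn s (DD d)) {m : ℝ}
    (hl : ∀ w ∈ DD d, -m ≤ s w) : ∃ m', ∀ w ∈ DD d, |s w| ≤ m' := by
  obtain ⟨b, hb⟩ := h.bddAbove_of_isCompact DD_compact
  refine ⟨max |b| |m|, fun w hw => abs_le.2 ⟨?_, ?_⟩⟩
  · have := hl w hw; have := le_abs_self m; have := le_max_right |b| |m|; linarith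
  · exact (hb (mem_image_of_mem s hw)).trans ((le_abs_self b).trans (le_max_left _ _))
lemma PS.le_of {S : Dat d} {ψ : SpaceTime (d + 1) → ℝ} {m : ℝ} {s} (h : PS S ψ m s)
    {g : SpaceTime (d + 1) → ℝ} (hg : ContinuousOn g (DD d)) (hs : Sub S (fun w => - g w))
    (hb : ∀ w ∈ bd d, ψ w ≤ g w) : ∀ w ∈ DD d, s w ≤ g w := by
  obtain ⟨m1, h1⟩ := usc_abs h.usc h.low
  obtain ⟨m2, h2⟩ := DD_compact.exists_bound_of_continuousOn hg
  have := comparison S h.sub hs h.usc hg.neg.upperSemicontinuousOn (m := max m1 m2)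
    (fun w hw => (h1 w hw).trans (le_max_left _ _)) (fun w hw => by
      rw [abs_neg]; exact (h2 w hw).trans (le_max_right _ _)) (fun w hw => by
      have := h.bdy w hw; have := hb w hw; linarith)
  intro w hw; have := this w hw; linarith
lemma Nb_nhds {z r : SpaceTime (d + 1)} {ρ σ : ℝ} (h1 : ‖r.1 - z.1‖ < ρ) (h2 : |r.2 - z.2| < σ) :
    ∀ᶠ w in 𝓝 r, ‖w.1 - z.1‖ < ρ ∧ |w.2 - z.2| < σ := by
  have c1 : Continuous fun w : SpaceTime (d + 1) => ‖w.1 - z.1‖ := by fun_prop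
  have c2 : Continuous fun w : SpaceTime (d + 1) => |w.2 - z.2| := by fun_prop
  exact (c1.continuousAt.eventually_lt continuousAt_const h1).and
    (c2.continuousAt.eventually_lt continuousAt_const h2)
lemma Nb_compact (z : SpaceTime (d + 1)) (ρ σ : ℝ) :
    IsCompact (DD d ∩ {w | ‖w.1 - z.1‖ ≤ ρ ∧ |w.2 - z.2| ≤ σ}) := by
  have c1 : Continuous fun w : SpaceTime (d + 1) => ‖w.1 - z.1‖ := by fun_prop
  have c2 : Continuous fun w : SpaceTime (d + 1) => |w.2 - z.2| := by fun_prop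
  exact DD_compact.inter_right ((isClosed_le c1 continuous_const).inter (isClosed_le c2 continuous_const))
lemma Sub_of_not {S : Dat d} {W : SpaceTime (d + 1) → ℝ}
    (h : ∀ z a p X, SJ (DD d) W z a p X → ((z ∈ Kc d 1 ∧ trQ (S.Q z.2) X < S.lam * a) ∨
      (z ∈ Fc d 1 ∧ p (S.v z.2) < a)) → False) : Sub S W :=
  ⟨fun z hz a p X hs => not_lt.1 fun hn => h z a p X hs (Or.inl ⟨hz, hn⟩),
   fun z hz a p X hs => not_lt.1 fun hn => h z a p X hs (Or.inr ⟨hz, hn⟩)⟩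
lemma env_sub (S : Dat d) {u : SpaceTime (d + 1) → ℝ} {m : ℝ} (hu : ∀ w ∈ DD d, |u w| ≤ m)
    {A : Set (SpaceTime (d + 1) → ℝ)} (hA : ∀ s ∈ A, Sub S s ∧ UpperSemicontinuousOn s (DD d))
    (hle : ∀ s ∈ A, ∀ w ∈ DD d, s w ≤ u w) (hex : ∀ w ∈ DD d, ∀ y < u w, ∃ s ∈ A, y < s w) :
    Sub S (env u) := by
  refine Sub_of_not fun z a p X hs hv => ?_
  have hzD : z ∈ DD d := by rcases hv with h | h; exacts [Kc_sub h.1, Fc_sub h.1]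
  obtain ⟨P, ρ, hρ, σ, hσ, c, hc, hP, hPz, hN⟩ := bump S (env_usc hu)
    (fun w hw => (abs_le.1 (env_abs hu hw)).2) hs hv
  have f1 := env_freq hu hzD (show env u z - c / 3 < env u z by linarith)
  have f2 : ∀ᶠ w in 𝓝 z, P w < P z + c / 3 :=
    hP.continuousAt.eventually_lt continuousAt_const (by linarith)
  have f3 := Nb_nhds (z := z) (r := z) (ρ := ρ) (σ := σ) (by simpa using hρ) (by simpa using hσ)
  obtain ⟨w, hw1, hw2, hw3, hwD⟩ := (f1.and_eventually ((eventually_nhdsWithin_of_eventually_nhds f2).and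
    ((eventually_nhdsWithin_of_eventually_nhds f3).and self_mem_nhdsWithin))).exists
  obtain ⟨s, hsA, hsw⟩ := hex w hwD _ hw1
  obtain ⟨r, hr, hmax⟩ := UpperSemicontinuousOn.exists_isMaxOn (f := fun w => s w + - P w)
    (⟨w, hwD, hw3.1.le, hw3.2.le⟩ : (DD d ∩ {w | ‖w.1 - z.1‖ ≤ ρ ∧ |w.2 - z.2| ≤ σ}).Nonempty) (Nb_compact z ρ σ)
    ((usc_cont_add (hA s hsA).2 hP.neg.continuousOn).mono inter_subset_left)
  have h1 : s w + - P w ≤ s r + - P r := hmax ⟨hwD, hw3.1.le, hw3.2.le⟩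
  obtain ⟨g1, g2, a', p', X', g3, g4, g5⟩ := hN r hr.1 hr.2.1 hr.2.2
  have h2 : s r ≤ env u r := (hle s hsA r hr.1).trans (le_env hu hr.1)
  have h3 : ¬ (‖r.1 - z.1‖ = ρ ∨ |r.2 - z.2| = σ) := fun h => by
    have := g2 h; linarith
  push Not at h3
  have hr1 := lt_of_le_of_ne hr.2.1 h3.1
  have hr2 := lt_of_le_of_ne hr.2.2 h3.2
  have hsj : SJ (DD d) s r a' p' X' := by
    refine SJ.of_max ?_ g3
    filter_upwards [self_mem_nhdsWithin, eventually_nhdsWithin_of_eventually_nhds (Nb_nhds hr1 hr2)]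
      with y hy hy2
    have : s y + - P y ≤ s r + - P r := hmax ⟨hy.1, hy2.1.le, hy2.2.le⟩
    linarith
  rcases not_bd hr.1 g1 with h | h
  · have := (hA s hsA).1.1 r h _ _ _ hsj; have := g4 h; linarith
  · have := (hA s hsA).1.2 r h _ _ _ hsj; have := g5 h; linarith
open Classical in
lemma env_neg_sub (S : Dat d) {ψ U : SpaceTime (d + 1) → ℝ} {m m' : ℝ} (hU : PS S ψ m U)
    (hUm : ∀ w ∈ DD d, |U w| ≤ m') (hmaxi : ∀ s, PS S ψ m s → ∀ w ∈ DD d, s w ≤ U w) :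
    Sub S (env fun w => - U w) := by
  refine Sub_of_not fun z a p X hs hv => ?_
  have hUm2 : ∀ w ∈ DD d, |(fun w => - U w) w| ≤ m' := fun w hw => by
    simpa only [abs_neg] using hUm w hw
  have hzD : z ∈ DD d := by rcases hv with h | h; exacts [Kc_sub h.1, Fc_sub h.1]
  obtain ⟨P, ρ, hρ, σ, hσ, c, hc, hP, hPz, hN⟩ := bump S (env_usc hUm2)
    (fun w hw => (abs_le.1 (env_abs hUm2 hw)).2) hs hv
  set W := env fun w => - U w with hW
  have hle : ∀ w ∈ DD d, - U w ≤ W w := fun w hw => le_env hUm2 hw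
  set V : SpaceTime (d + 1) → ℝ := fun w =>
    if (‖w.1 - z.1‖ ≤ ρ ∧ |w.2 - z.2| ≤ σ) ∧ U w < - P w + c then - P w + c else U w with hV
  have hUV : ∀ w, U w ≤ V w := by
    intro w; simp only [hV]; split_ifs with h
    · exact h.2.le
    · exact le_rfl
  have hPV : ∀ w, (‖w.1 - z.1‖ ≤ ρ ∧ |w.2 - z.2| ≤ σ) → - P w + c ≤ V w := by
    intro w hw; simp only [hV]; split_ifs with h
    · exact le_rfl
    · push Not at h; exact h hw
  have hVmax : ∀ w, (‖w.1 - z.1‖ ≤ ρ ∧ |w.2 - z.2| ≤ σ) → V w = max (U w) (- P w + c) := by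
    intro w hw; simp only [hV]; split_ifs with h
    · rw [max_eq_right h.2.le]
    · push Not at h; rw [max_eq_left (h hw)]
  have hVP : ∀ w ∈ DD d, V w ≠ U w → ‖w.1 - z.1‖ < ρ ∧ |w.2 - z.2| < σ ∧ V w = - P w + c := by
    intro w hw hne
    by_cases h : (‖w.1 - z.1‖ ≤ ρ ∧ |w.2 - z.2| ≤ σ) ∧ U w < - P w + c
    · obtain ⟨-, g2, -⟩ := hN w hw h.1.1 h.1.2
      have h3 : ¬ (‖w.1 - z.1‖ = ρ ∨ |w.2 - z.2| = σ) := fun h' => by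
        have := g2 h'; have := hle w hw; linarith [h.2]
      push Not at h3
      exact ⟨lt_of_le_of_ne h.1.1 h3.1, lt_of_le_of_ne h.1.2 h3.2, by simp only [hV, if_pos h]⟩
    · exact absurd (by simp only [hV, if_neg h]) hne
  have hPS : PS S ψ m V := by
    refine ⟨?_, ⟨?_, ?_⟩, ?_, fun w hw => (hU.low w hw).trans (hUV w)⟩
    · intro w hw
      by_cases hin : ‖w.1 - z.1‖ < ρ ∧ |w.2 - z.2| < σ
      · have h1 := (hU.usc.sup (hP.neg.add continuous_const : Continuous fun w => - P w + c).continuousOn.upperSemicontinuousOn) w hw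
        intro y hy
        rw [hVmax w ⟨hin.1.le, hin.2.le⟩] at hy
        filter_upwards [h1 y hy, eventually_nhdsWithin_of_eventually_nhds (Nb_nhds hin.1 hin.2)] with x hx hx2
        rw [hVmax x ⟨hx2.1.le, hx2.2.le⟩]; exact hx
      · have hev : ∀ᶠ x in 𝓝[DD d] w, V x = U x := by
          by_cases hb : ‖w.1 - z.1‖ ≤ ρ ∧ |w.2 - z.2| ≤ σ
          · have hbb : ‖w.1 - z.1‖ = ρ ∨ |w.2 - z.2| = σ := by
              by_contra hcon; push Not at hcon
              exact hin ⟨lt_of_le_of_ne hb.1 hcon.1, lt_of_le_of_ne hb.2 hcon.2⟩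
            have h1 := (hN w hw hb.1 hb.2).2.1 hbb
            have h2 := (usc_cont_add (env_usc hUm2) hP.neg.continuousOn) w hw (-c) (by
              show W w + - P w < -c; linarith)
            filter_upwards [h2, self_mem_nhdsWithin] with x hx hxD
            have hx : W x + - P x < -c := hx
            simp only [hV]; rw [if_neg]
            intro hcon; have := hle x hxD; linarith [hcon.2]
          · have hcl : IsClosed {w : SpaceTime (d + 1) | ‖w.1 - z.1‖ ≤ ρ ∧ |w.2 - z.2| ≤ σ} := by
              have c1 : Continuous fun w : SpaceTime (d + 1) => ‖w.1 - z.1‖ := by fun_prop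
              have c2 : Continuous fun w : SpaceTime (d + 1) => |w.2 - z.2| := by fun_prop
              exact (isClosed_le c1 continuous_const).inter (isClosed_le c2 continuous_const)
            have := hcl.isOpen_compl.mem_nhds hb
            filter_upwards [mem_nhdsWithin_of_mem_nhds this] with x hx
            simp only [hV]; rw [if_neg]
            intro hcon; exact hx hcon.1
        have hwe : V w = U w := hev.self_of_nhdsWithin hw
        intro y hy
        rw [hwe] at hy
        filter_upwards [hev, hU.usc w hw y hy] with x hx hx2
        rw [hx]; exact hx2
    · intro w hw a' p' X' hs'
      by_cases he : V w = U w
      · exact hU.sub.1 w hw _ _ _ (hs'.of_le he.symm (Eventually.of_forall hUV))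
      · obtain ⟨i1, i2, i3⟩ := hVP w (Kc_sub hw) he
        obtain ⟨-, -, a1, p1, X1, g3, g4, -⟩ := hN w (Kc_sub hw) i1.le i2.le
        have : SJ (DD d) (fun w => - P w + c) w a' p' X' := hs'.of_le i3.symm (by
          filter_upwards [eventually_nhdsWithin_of_eventually_nhds (Nb_nhds i1 i2)] with x hx
          exact hPV x ⟨hx.1.le, hx.2.le⟩)
        refine jet_K S hw this (g3.neg.add_const c) ?_
        rw [trQ_neg]; have := g4 hw; linarith
    · intro w hw a' p' X' hs'
      by_cases he : V w = U w
      · exact hU.sub.2 w hw _ _ _ (hs'.of_le he.symm (Eventually.of_forall hUV))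
      · obtain ⟨i1, i2, i3⟩ := hVP w (Fc_sub hw) he
        obtain ⟨-, -, a1, p1, X1, g3, -, g4⟩ := hN w (Fc_sub hw) i1.le i2.le
        have : SJ (DD d) (fun w => - P w + c) w a' p' X' := hs'.of_le i3.symm (by
          filter_upwards [eventually_nhdsWithin_of_eventually_nhds (Nb_nhds i1 i2)] with x hx
          exact hPV x ⟨hx.1.le, hx.2.le⟩)
        refine jet_F S hw this (g3.neg.add_const c) ?_
        rw [ContinuousLinearMap.neg_apply]; have := g4 hw; linarith
    · intro w hw
      have : V w = U w := by
        by_contra hne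
        obtain ⟨i1, i2, -⟩ := hVP w (bd_sub hw) hne
        exact (hN w (bd_sub hw) i1.le i2.le).1 hw
      rw [this]; exact hU.bdy w hw
  have f1 := env_freq hUm2 hzD (show W z - c / 3 < W z by linarith)
  have f2 : ∀ᶠ w in 𝓝 z, P w < P z + c / 3 :=
    hP.continuousAt.eventually_lt continuousAt_const (by linarith)
  have f3 := Nb_nhds (z := z) (r := z) (ρ := ρ) (σ := σ) (by simpa using hρ) (by simpa using hσ)
  obtain ⟨w, hw1, hw2, hw3, hwD⟩ := (f1.and_eventually ((eventually_nhdsWithin_of_eventually_nhds f2).and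
    ((eventually_nhdsWithin_of_eventually_nhds f3).and self_mem_nhdsWithin))).exists
  have k1 := hmaxi V hPS w hwD
  have k2 := hPV w ⟨hw3.1.le, hw3.2.le⟩
  linarith
theorem perron (S : Dat d) {ψ : SpaceTime (d + 1) → ℝ} {m : ℝ} (hψ : ∀ w ∈ bd d, |ψ w| ≤ m)
    (hup : ∀ p ∈ bd d, ∀ ε > 0, ∃ g : SpaceTime (d + 1) → ℝ, ContinuousOn g (DD d) ∧
      Sub S (fun w => - g w) ∧ (∀ w ∈ bd d, ψ w ≤ g w) ∧ g p ≤ ψ p + ε)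
    (hlo : ∀ p ∈ bd d, ∀ ε > 0, ∃ g : SpaceTime (d + 1) → ℝ, ContinuousOn g (DD d) ∧
      Sub S g ∧ (∀ w ∈ bd d, g w ≤ ψ w) ∧ (∀ w ∈ DD d, -m ≤ g w) ∧ ψ p - ε ≤ g p) :
    ∃ u, ContinuousOn u (DD d) ∧ Sub S u ∧ Sub S (fun w => - u w) ∧ ∀ w ∈ bd d, u w = ψ w := by
  have hPSm : ∀ s, PS S ψ m s → ∀ w ∈ DD d, |s w| ≤ m := fun s hs w hw =>
    abs_le.2 ⟨hs.low w hw, hs.le_of (g := fun _ => m) continuousOn_const (Sub_const S (-m))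
      (fun w hw => (abs_le.1 (hψ w hw)).2) w hw⟩
  have hne : PS S ψ m (fun _ => -m) := ⟨continuousOn_const.upperSemicontinuousOn, Sub_const S _,
    fun w hw => (abs_le.1 (hψ w hw)).1, fun w hw => le_rfl⟩
  set u : SpaceTime (d + 1) → ℝ := fun z => sSup {y | ∃ s, PS S ψ m s ∧ y = s z} with hu
  have hne2 : ∀ z, {y | ∃ s, PS S ψ m s ∧ y = s z}.Nonempty := fun z => ⟨_, _, hne, rfl⟩
  have hsu : ∀ s, PS S ψ m s → ∀ w ∈ DD d, s w ≤ u w := fun s hs w hw =>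
    le_csSup ⟨m, by rintro y ⟨s', hs', rfl⟩; exact (abs_le.1 (hPSm s' hs' w hw)).2⟩ ⟨s, hs, rfl⟩
  have hum : ∀ w ∈ DD d, |u w| ≤ m := fun w hw => abs_le.2 ⟨hsu _ hne w hw, csSup_le (hne2 w) (by
    rintro y ⟨s', hs', rfl⟩; exact (abs_le.1 (hPSm s' hs' w hw)).2)⟩
  set U := env u with hUd
  have hUm : ∀ w ∈ DD d, |U w| ≤ m := fun w hw => env_abs hum hw
  have hUS : Sub S U := env_sub S hum (A := {s | PS S ψ m s}) (fun s hs => ⟨hs.sub, hs.usc⟩) hsu (by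
    intro w hw y hy
    obtain ⟨_, ⟨s, hs, rfl⟩, h⟩ := exists_lt_of_lt_csSup (hne2 w) hy
    exact ⟨s, hs, h⟩)
  have hUb : ∀ w ∈ bd d, U w ≤ ψ w := by
    intro w hw
    refine le_of_forall_pos_le_add fun ε hε => ?_
    obtain ⟨g, hg, hgs, hgb, hgw⟩ := hup w hw ε hε
    refine (env_le_cont hum hg (fun x hx => csSup_le (hne2 x) ?_) (bd_sub hw)).trans hgw
    rintro y ⟨s, hs, rfl⟩
    exact hs.le_of hg hgs hgb x hx
  have hUP : PS S ψ m U := ⟨env_usc hum, hUS, hUb, fun w hw => (abs_le.1 (hUm w hw)).1⟩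
  have hmaxi : ∀ s, PS S ψ m s → ∀ w ∈ DD d, s w ≤ U w := fun s hs w hw =>
    (hsu s hs w hw).trans (le_env hum hw)
  have hUm2 : ∀ w ∈ DD d, |(fun w => - U w) w| ≤ m := fun w hw => by
    simpa only [abs_neg] using hUm w hw
  set W := env (fun w => - U w) with hW
  have hWS : Sub S W := env_neg_sub S hUP hUm hmaxi
  have hWb : ∀ w ∈ bd d, W w ≤ - ψ w := by
    intro w hw
    refine le_of_forall_pos_le_add fun ε hε => ?_
    obtain ⟨g, hg, hgs, hgb, hgm, hgw⟩ := hlo w hw ε hε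
    have hgP : PS S ψ m g := ⟨hg.upperSemicontinuousOn, hgs, hgb, hgm⟩
    have := env_le_cont hUm2 hg.neg (fun x hx => neg_le_neg (hmaxi g hgP x hx)) (bd_sub hw)
    have h2 : W w ≤ - g w := this
    linarith
  have hcomp := comparison S hUS hWS (env_usc hum) (env_usc hUm2) hUm (fun w hw => env_abs hUm2 hw)
    (fun w hw => by have := hUb w hw; have := hWb w hw; linarith)
  have hle : ∀ w ∈ DD d, - U w ≤ W w := fun w hw => le_env hUm2 hw
  have hWU : ∀ w ∈ DD d, W w = - U w := fun w hw => by
    have := hcomp w hw; have := hle w hw; linarith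
  refine ⟨U, ?_, hUS, Sub_congr hWS hWU, fun w hw => ?_⟩
  · intro w hw
    rw [ContinuousWithinAt, tendsto_order]
    refine ⟨fun y hy => ?_, fun y hy => hUP.usc w hw y hy⟩
    have := env_usc hUm2 w hw (-y) (by
      show W w < -y
      rw [hWU w hw]; linarith)
    filter_upwards [this, self_mem_nhdsWithin] with x hx hxD
    have hx : W x < -y := hx
    rw [hWU x hxD] at hx; linarith
  · have := hUb w hw; have := hWb w hw; have := hWU w (bd_sub hw); linarith
structure Barrier (S : Dat d) (p0 : SpaceTime (d + 1)) (b : SpaceTime (d + 1) → ℝ) (θ : ℝ) : Prop where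
  cont : ContinuousOn b (DD d)
  zero : b p0 = 0
  pos : ∀ w ∈ DD d, w ≠ p0 → 0 < b w
  tpos : 0 < θ
  jet : ∀ w ∈ DD d, w ∉ bd d → b w < θ → ∃ a p X, JetW (DD d ∩ past w) b w a p X ∧
    (w ∈ Kc d 1 → trQ (S.Q w.2) X ≤ S.lam * a) ∧ (w ∈ Fc d 1 → p (S.v w.2) ≤ a)
lemma Kc_nbd {w : SpaceTime (d + 1)} (h : w ∈ Kc d 1) : w ∉ bd d := by
  have : w ∈ KcP d 1 := Or.inl h
  rw [KcP_eq] at this; exact this.2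
lemma Fc_nbd {w : SpaceTime (d + 1)} (h : w ∈ Fc d 1) : w ∉ bd d := by
  have : w ∈ KcP d 1 := Or.inr h
  rw [KcP_eq] at this; exact this.2
lemma Barrier.use {S : Dat d} {p0 b θ} (hb : Barrier S p0 b θ) (hp0 : p0 ∈ bd d)
    {ψ : SpaceTime (d + 1) → ℝ} {m : ℝ} (hψc : ContinuousOn ψ (bd d)) (hψ : ∀ w ∈ bd d, |ψ w| ≤ m)
    {ε : ℝ} (hε : 0 < ε) : ∃ g : SpaceTime (d + 1) → ℝ, ContinuousOn g (DD d) ∧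
      Sub S (fun w => - g w) ∧ (∀ w ∈ bd d, ψ w ≤ g w) ∧ (∀ w ∈ DD d, g w ≤ m) ∧ g p0 ≤ ψ p0 + ε := by
  have hm : 0 ≤ m := (abs_nonneg _).trans (hψ p0 hp0)
  have hb0 : ∀ w ∈ DD d, 0 ≤ b w := fun w hw => by
    by_cases h : w = p0
    · rw [h, hb.zero]
    · exact (hb.pos w hw h).le
  have hC : IsCompact (bd d ∩ ψ ⁻¹' Ici (ψ p0 + ε)) :=
    DD_compact.of_isClosed_subset (hψc.preimage_isClosed_of_isClosed bd_closed isClosed_Ici)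
      (inter_subset_left.trans bd_sub)
  obtain ⟨b0, hb0p, hb0'⟩ : ∃ b0 > 0, ∀ w ∈ bd d, ψ p0 + ε ≤ ψ w → b0 ≤ b w := by
    rcases (bd d ∩ ψ ⁻¹' Ici (ψ p0 + ε)).eq_empty_or_nonempty with he | hne
    · refine ⟨1, one_pos, fun w hw h => ?_⟩
      have : w ∈ bd d ∩ ψ ⁻¹' Ici (ψ p0 + ε) := ⟨hw, h⟩
      rw [he] at this; exact absurd this (notMem_empty _)
    · obtain ⟨w0, hw0, hmin⟩ := hC.exists_isMinOn hne (hb.cont.mono (inter_subset_left.trans bd_sub))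
      refine ⟨b w0, hb.pos w0 (bd_sub hw0.1) ?_, fun w hw h => hmin ⟨hw, h⟩⟩
      rintro rfl
      have : ψ w0 + ε ≤ ψ w0 := hw0.2
      linarith
  have hθ := hb.tpos
  set K := (2 * m + 1) / min b0 θ with hK
  have hmin : 0 < min b0 θ := lt_min hb0p hθ
  have hKp : 0 < K := by positivity
  have hKm : K * min b0 θ = 2 * m + 1 := by rw [hK]; field_simp
  have hK1 : 2 * m + 1 ≤ K * b0 := by rw [← hKm]; exact mul_le_mul_of_nonneg_left (min_le_left _ _) hKp.le
  have hK2 : 2 * m + 1 ≤ K * θ := by rw [← hKm]; exact mul_le_mul_of_nonneg_left (min_le_right _ _) hKp.le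
  have hψ0 := abs_le.1 (hψ p0 hp0)
  have key : ∀ w ∈ DD d, min (ψ p0 + ε + K * b w) m ≠ m → b w < θ := by
    intro w hw hne
    by_contra hcon
    apply hne
    rw [min_eq_right]
    have := mul_le_mul_of_nonneg_left (not_lt.1 hcon) hKp.le
    linarith
  have sj1 : ∀ w a p X, SJ (DD d) (fun w => - min (ψ p0 + ε + K * b w) m) w a p X →
      min (ψ p0 + ε + K * b w) m = m → SJ (DD d) (fun _ => - m) w a p X := fun w a p X hs he =>
    hs.of_le (by rw [he]) (Eventually.of_forall fun y => neg_le_neg (min_le_right _ _))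
  have sj2 : ∀ w a p X, SJ (DD d) (fun w => - min (ψ p0 + ε + K * b w) m) w a p X →
      min (ψ p0 + ε + K * b w) m ≠ m → SJ (DD d) (fun w => - (K * b w + (ψ p0 + ε))) w a p X :=
    fun w a p X hs he => by
      refine hs.of_le ?_ (Eventually.of_forall fun y => ?_)
      · rcases min_choice (ψ p0 + ε + K * b w) m with h | h
        · rw [h]; ring
        · exact absurd h he
      · have := min_le_left (ψ p0 + ε + K * b y) m
        linarith
  refine ⟨fun w => min (ψ p0 + ε + K * b w) m, (continuousOn_const.add (hb.cont.const_smul K)).inf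
    continuousOn_const, ⟨?_, ?_⟩, ?_, fun w _ => min_le_right _ _, ?_⟩
  · intro w hw a p X hs
    by_cases he : min (ψ p0 + ε + K * b w) m = m
    · exact (Sub_const S (-m)).1 w hw _ _ _ (sj1 w a p X hs he)
    · obtain ⟨a1, p1, X1, h1, h2, -⟩ := hb.jet w (Kc_sub hw) (Kc_nbd hw) (key w (Kc_sub hw) he)
      refine jet_K S hw (sj2 w a p X hs he) ((h1.smul K).add_const _).neg ?_
      rw [trQ_neg, trQ_smul]
      have := mul_le_mul_of_nonneg_left (h2 hw) hKp.le
      linarith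
  · intro w hw a p X hs
    by_cases he : min (ψ p0 + ε + K * b w) m = m
    · exact (Sub_const S (-m)).2 w hw _ _ _ (sj1 w a p X hs he)
    · obtain ⟨a1, p1, X1, h1, -, h2⟩ := hb.jet w (Fc_sub hw) (Fc_nbd hw) (key w (Fc_sub hw) he)
      refine jet_F S hw (sj2 w a p X hs he) ((h1.smul K).add_const _).neg ?_
      rw [ContinuousLinearMap.neg_apply, ContinuousLinearMap.smul_apply, smul_eq_mul]
      have := mul_le_mul_of_nonneg_left (h2 hw) hKp.le
      linarith
  · intro w hw
    refine le_min ?_ (abs_le.1 (hψ w hw)).2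
    have h1 := hb0 w (bd_sub hw)
    have h2 := mul_nonneg hKp.le h1
    rcases le_or_gt (ψ p0 + ε) (ψ w) with h | h
    · have := mul_le_mul_of_nonneg_left (hb0' w hw h) hKp.le
      have := (abs_le.1 (hψ w hw)).2
      linarith
    · linarith
  · exact (min_le_left _ _).trans (by rw [hb.zero]; linarith)
lemma bar_bottom (S : Dat d) {p0 : SpaceTime (d + 1)} (hp : p0 ∈ DD d) (ht : p0.2 = -1) :
    ∃ b θ, Barrier S p0 b θ := by
  have hl := S.lam_pos
  have hB := S.B_pos
  have hM := S.M_pos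
  set C := 2 * ((d + 1) * S.B) / S.lam + 4 * S.M with hC
  have hCp : 0 < C := by positivity
  refine ⟨fun w => ‖w.1 - p0.1‖ ^ 2 + C * (w.2 + 1), 1, ?_, ?_, ?_, one_pos, ?_⟩
  · fun_prop
  · simp [ht]
  · intro w hw hne
    have h1 : 0 ≤ w.2 + 1 := by linarith [hw.2.2.1]
    rcases h1.eq_or_lt with h2 | h2
    · have : w.1 ≠ p0.1 := fun h => hne (Prod.ext h (by linarith))
      have := norm_pos_iff.2 (sub_ne_zero.2 this)
      rw [← h2]; positivity
    · positivity
  · intro w hw hwb _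
    have hd : HasDerivAt (fun t : ℝ => C * (t + 1)) C w.2 := by
      simpa using ((hasDerivAt_id w.2).add_const 1).const_mul C
    refine ⟨_, _, _, (idX_quad p0.1).add (JetW.time hd), fun h => ?_, fun h => ?_⟩
    · rw [trQ_add, trQ_zero, trQ_smul, zero_add, add_zero]
      have := trQ_idX_le S w.2
      have h2 : S.lam * C = 2 * ((d + 1) * S.B) + S.lam * (4 * S.M) := by rw [hC]; field_simp
      have : 0 < S.lam * (4 * S.M) := by positivity
      linarith
    · rw [ContinuousLinearMap.add_apply, ContinuousLinearMap.smul_apply, idX_apply]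
      show _ + (0 : ℝ) ≤ _
      have h1 := real_inner_le_norm (w.1 - p0.1) (S.v w.2)
      have h2 : ‖w.1 - p0.1‖ ≤ 2 := (norm_sub_le _ _).trans (by linarith [hw.1, hp.1])
      have h3 := S.vb w.2
      have h4 : ‖w.1 - p0.1‖ * ‖S.v w.2‖ ≤ 2 * S.M := mul_le_mul h2 h3 (norm_nonneg _) (by norm_num)
      have h5 : 0 < 2 * ((d + 1) * S.B) / S.lam := by positivity
      rw [smul_eq_mul]
      linarith
lemma inner_ee (x : Eucl (d + 1)) (i) : innerSL ℝ x (ee i) = x i := by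
  simp [ee, EuclideanSpace.inner_single_right]
lemma trQ_rank1 (A : Matrix (Fin (d + 1)) (Fin (d + 1)) ℝ) (x y : Eucl (d + 1)) :
    trQ A ((innerSL ℝ x).smulRight (innerSL ℝ y)) = ∑ i, ∑ j, A i j * (x i * y j) := by
  unfold trQ
  refine Finset.sum_congr rfl fun i _ => Finset.sum_congr rfl fun j _ => ?_
  rw [ContinuousLinearMap.smulRight_apply, ContinuousLinearMap.smul_apply, inner_ee, inner_ee, smul_eq_mul]
lemma trQ_ell (S : Dat d) (t : ℝ) (x : Eucl (d + 1)) :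
    S.Λ⁻¹ * ‖x‖ ^ 2 ≤ trQ (S.Q t) ((innerSL ℝ x).smulRight (innerSL ℝ x)) := by
  rw [trQ_rank1, EuclideanSpace.norm_sq_eq]
  simpa using S.ell t (fun i => x i)
lemma r_lower {x x0 : Eucl (d + 1)} (hx : ‖x‖ ≤ 1) (hx0 : ‖x0‖ = 1) :
    ‖x - x0‖ ^ 2 / 2 ≤ 1 - innerSL ℝ x0 x := by
  have := norm_sub_sq_real x x0
  rw [hx0, real_inner_comm] at this
  rw [innerSL_apply_apply]
  nlinarith [norm_nonneg x]
lemma r_upper {x x0 : Eucl (d + 1)} (hx : ‖x‖ ≤ 1) (hx0 : ‖x0‖ = 1) :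
    1 - innerSL ℝ x0 x ≤ 2 := by
  have := (abs_le.1 (abs_real_inner_le_norm x0 x)).1
  rw [hx0] at this
  rw [innerSL_apply_apply]; linarith
lemma sq_time_jet {s : Set (SpaceTime (d + 1))} {z : SpaceTime (d + 1)} (t0 : ℝ) :
    JetW s (fun w : SpaceTime (d + 1) => (w.2 - t0) ^ 2) z (2 * (z.2 - t0)) 0 0 := by
  have : HasDerivAt (fun t : ℝ => (t - t0) ^ 2) (2 * (z.2 - t0)) z.2 := by
    have h := ((hasDerivAt_id z.2).sub_const t0).fun_pow 2
    exact h.congr_deriv (by simp)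
  exact JetW.time this
lemma bar_lateral (S : Dat d) {p0 : SpaceTime (d + 1)} (hp : p0 ∈ DD d) (hx0 : ‖p0.1‖ = 1)
    (hn : 0 < lastC p0.1) : ∃ b θ, Barrier S p0 b θ := by
  have hl := S.lam_pos
  have hL := S.Λ_pos
  set ℓ := innerSL ℝ p0.1 with hℓ
  set F : ℝ → ℝ := fun s => (1 - s) - (1 - s) ^ 2 / 4 with hF
  set A := 4 * S.Λ * S.lam with hA
  have hAp : 0 < A := by positivity
  set b : SpaceTime (d + 1) → ℝ := fun w => A * F (ℓ w.1) + (w.2 - p0.2) ^ 2 with hb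
  have hc : Continuous b := by
    rw [hb, hF]; fun_prop
  have hFlow : ∀ w ∈ DD d, ‖w.1 - p0.1‖ ^ 2 / 4 ≤ F (ℓ w.1) := by
    intro w hw
    have h1 := r_lower hw.1 hx0
    have h2 := r_upper hw.1 hx0
    rw [← hℓ] at h1 h2
    simp only [hF]
    nlinarith [sq_nonneg ‖w.1 - p0.1‖]
  have hpos : ∀ w ∈ DD d, w ≠ p0 → 0 < b w := by
    intro w hw hne
    have h1 := hFlow w hw
    have h2 : 0 ≤ A * F (ℓ w.1) := mul_nonneg hAp.le (le_trans (by positivity) h1)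
    by_cases h : w.2 = p0.2
    · have : w.1 ≠ p0.1 := fun h' => hne (Prod.ext h' h)
      have := norm_pos_iff.2 (sub_ne_zero.2 this)
      have : 0 < F (ℓ w.1) := lt_of_lt_of_le (by positivity) h1
      simp only [hb]; positivity
    · have := sub_ne_zero.2 h
      simp only [hb]; positivity
  obtain ⟨θ, hθ, hθ2⟩ : ∃ θ > 0, ∀ w ∈ DD d, lastC w.1 = 0 → θ ≤ b w := by
    have hCc : IsCompact (DD d ∩ {w | lastC w.1 = 0}) := DD_compact.inter_right
      (isClosed_eq (lastC_cont.comp continuous_fst) continuous_const)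
    rcases (DD d ∩ {w | lastC w.1 = 0}).eq_empty_or_nonempty with he | hne
    · refine ⟨1, one_pos, fun w hw h => ?_⟩
      have : w ∈ DD d ∩ {w | lastC w.1 = 0} := ⟨hw, h⟩
      rw [he] at this; exact absurd this (notMem_empty _)
    · obtain ⟨w0, hw0, hmin⟩ := hCc.exists_isMinOn hne hc.continuousOn
      refine ⟨b w0, hpos w0 hw0.1 ?_, fun w hw h => hmin ⟨hw, h⟩⟩
      rintro rfl
      have : lastC w0.1 = 0 := hw0.2
      linarith
  refine ⟨b, θ, hc.continuousOn, ?_, hpos, hθ, ?_⟩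
  · simp [hb, hF, hℓ, hx0]
  · intro w hw hwb hlt
    have hT : T2 F (ℓ w.1) (-1 + (1 - ℓ w.1) / 2) (-(1 / 2)) := by
      refine T2_of_deriv (F1 := fun s => -1 + (1 - s) / 2) (Eventually.of_forall fun s => ?_) ?_
      · have h1 := (hasDerivAt_id s).const_sub 1
        have h2 := h1.fun_sub ((h1.fun_pow 2).div_const 4)
        exact h2.congr_deriv (by simp; ring)
      · have h1 := (((hasDerivAt_id (ℓ w.1)).const_sub 1).div_const 2).const_add (-1)
        exact h1.congr_deriv (by norm_num)
    have hj := (((JetW.lin (s := DD d ∩ past w) (z := w) ℓ).comp hT).smul A).add (sq_time_jet p0.2)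
    refine ⟨_, _, _, hj, fun h => ?_, fun h => ?_⟩
    · rw [trQ_add, trQ_zero, trQ_smul, trQ_add, trQ_smul, trQ_smul, trQ_zero]
      have h1 := trQ_ell S w.2 p0.1
      rw [hx0, ← hℓ] at h1
      have h2 : -1 ≤ w.2 - p0.2 := by linarith [hw.2.2.1, hp.2.2.2]
      have h3 : A * S.Λ⁻¹ = 4 * S.lam := by rw [hA]; field_simp
      have h4 : A * (S.Λ⁻¹ * 1 ^ 2) ≤ A * _ := mul_le_mul_of_nonneg_left h1 hAp.le
      have h5 : S.lam * (-1) ≤ S.lam * (w.2 - p0.2) := mul_le_mul_of_nonneg_left h2 hl.le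
      nlinarith
    · have := hθ2 w hw h.2.1; linarith
lemma ctaylor {g g1 : ℂ → ℂ} {a g2 : ℂ} (h1 : ∀ᶠ ζ in 𝓝 a, HasDerivAt g (g1 ζ) ζ)
    (h2 : HasDerivAt g1 g2 a) :
    (fun ζ => g ζ - g a - g1 a * (ζ - a) - g2 / 2 * (ζ - a) ^ 2) =o[𝓝 a] fun ζ => ‖ζ - a‖ ^ 2 := by
  rw [isLittleO_iff]
  intro c hc
  have h3 := (hasDerivAt_iff_isLittleO.1 h2).def hc
  obtain ⟨r, hr, hb⟩ := Metric.eventually_nhds_iff_ball.1 (h1.and h3)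
  filter_upwards [Metric.ball_mem_nhds a hr] with ζ hζ
  set F : ℂ → ℂ := fun w => g w - g1 a * (w - a) - g2 / 2 * (w - a) ^ 2
  have hF : ∀ w ∈ Metric.closedBall a ‖ζ - a‖,
      HasDerivWithinAt F (g1 w - g1 a - (w - a) * g2) (Metric.closedBall a ‖ζ - a‖) w := by
    intro w hw
    have hw' : w ∈ Metric.ball a r := by
      rw [mem_closedBall] at hw; rw [mem_ball] at hζ ⊢
      rw [dist_eq_norm ζ a] at hζ; linarith
    have e1 := (hasDerivAt_id w).sub_const a
    have e2 := ((hb w hw').1.fun_sub (e1.const_mul (g1 a))).fun_sub ((e1.fun_pow 2).const_mul (g2 / 2))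
    exact (e2.congr_deriv (by simp; ring)).hasDerivWithinAt
  have hbd : ∀ w ∈ Metric.closedBall a ‖ζ - a‖, ‖g1 w - g1 a - (w - a) * g2‖ ≤ c * ‖ζ - a‖ := by
    intro w hw
    have hw' : w ∈ Metric.ball a r := by
      rw [mem_closedBall] at hw; rw [mem_ball] at hζ ⊢
      rw [dist_eq_norm ζ a] at hζ; linarith
    have := (hb w hw').2
    rw [mem_closedBall, dist_eq_norm] at hw
    rw [smul_eq_mul] at this
    exact this.trans (mul_le_mul_of_nonneg_left hw hc.le)
  have := (convex_closedBall a ‖ζ - a‖).norm_image_sub_le_of_norm_hasDerivWithin_le hF hbd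
    (Metric.mem_closedBall_self (norm_nonneg _)) (by rw [mem_closedBall, dist_eq_norm] : ζ ∈ _)
  rw [norm_pow, norm_norm]
  calc _ = ‖F ζ - F a‖ := by congr 1; simp only [F]; ring
    _ ≤ _ := this
    _ = _ := by ring
lemma cjet {s : Set (SpaceTime (d + 1))} {z : SpaceTime (d + 1)} {g g1 : ℂ → ℂ} {g2 k : ℂ}
    (P R : Eucl (d + 1) →L[ℝ] ℝ) {a : ℂ} (ha : k + P z.1 + Complex.I * R z.1 = a)
    (h1 : ∀ᶠ ζ in 𝓝 a, HasDerivAt g (g1 ζ) ζ)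
    (h2 : HasDerivAt g1 g2 a) :
    JetW s (fun w => (g (k + P w.1 + Complex.I * R w.1)).re) z 0
      ((g1 a).re • P - (g1 a).im • R)
      (g2.re • (P.smulRight P - R.smulRight R) - g2.im • (P.smulRight R + R.smulRight P)) := by
  apply JetW.space (f := fun y => (g (k + P y + Complex.I * R y)).re)
  have hc : Tendsto (fun y => k + P y + Complex.I * R y) (𝓝 z.1) (𝓝 a) := by
    rw [← ha]
    exact Continuous.continuousAt (by fun_prop : Continuous fun y => k + P y + Complex.I * R y)
  have ho := (ctaylor h1 h2).comp_tendsto hc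
  have hO : (fun y => ‖k + P y + Complex.I * R y - a‖ ^ 2) =O[𝓝 z.1] fun y => ‖y - z.1‖ ^ 2 := by
    refine IsBigO.of_bound ((‖P‖ + ‖R‖) ^ 2) (Eventually.of_forall fun y => ?_)
    have e : k + P y + Complex.I * R y - a = (P (y - z.1) : ℂ) + Complex.I * (R (y - z.1) : ℂ) := by
      rw [← ha]; simp only [map_sub]; push_cast; ring
    have : ‖k + P y + Complex.I * R y - a‖ ≤ (‖P‖ + ‖R‖) * ‖y - z.1‖ := by
      rw [e]
      refine (norm_add_le _ _).trans ?_
      rw [norm_mul, Complex.norm_I, one_mul, Complex.norm_real, Complex.norm_real, add_mul]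
      exact add_le_add (P.le_opNorm _) (R.le_opNorm _)
    rw [norm_pow, norm_norm, norm_pow, norm_norm, ← mul_pow]
    gcongr
  refine IsBigO.trans_isLittleO (IsBigO.of_bound 1 (Eventually.of_forall fun y => ?_)) (ho.trans_isBigO hO)
  rw [one_mul]
  refine le_trans (le_of_eq ?_) (Complex.abs_re_le_norm _)
  rw [Real.norm_eq_abs]
  congr 1
  simp only [Function.comp]
  have e : k + P y + Complex.I * R y - a = (P (y - z.1) : ℂ) + Complex.I * (R (y - z.1) : ℂ) := by
      rw [← ha]; simp only [map_sub]; push_cast; ring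
  rw [e, ha]
  simp only [ContinuousLinearMap.sub_apply, ContinuousLinearMap.smul_apply,
    ContinuousLinearMap.add_apply, ContinuousLinearMap.smulRight_apply, smul_eq_mul]
  simp [pow_two, -map_sub]
  ring
def qf (A : Matrix (Fin (d + 1)) (Fin (d + 1)) ℝ) (x y : Eucl (d + 1)) : ℝ :=
  trQ A ((innerSL ℝ x).smulRight (innerSL ℝ y))
lemma qf_add_left (A : Matrix (Fin (d + 1)) (Fin (d + 1)) ℝ) (x y z : Eucl (d + 1)) :
    qf A (x + y) z = qf A x z + qf A y z := by
  simp only [qf, trQ_rank1, PiLp.add_apply, mul_add, add_mul, Finset.sum_add_distrib]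
lemma qf_smul_left (A : Matrix (Fin (d + 1)) (Fin (d + 1)) ℝ) (c : ℝ) (x z : Eucl (d + 1)) :
    qf A (c • x) z = c * qf A x z := by
  simp only [qf, trQ_rank1, PiLp.smul_apply, smul_eq_mul, Finset.mul_sum]
  refine Finset.sum_congr rfl fun i _ => Finset.sum_congr rfl fun j _ => by ring
lemma qf_smul_right (A : Matrix (Fin (d + 1)) (Fin (d + 1)) ℝ) (c : ℝ) (x z : Eucl (d + 1)) :
    qf A z (c • x) = c * qf A z x := by
  simp only [qf, trQ_rank1, PiLp.smul_apply, smul_eq_mul, Finset.mul_sum]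
  refine Finset.sum_congr rfl fun i _ => Finset.sum_congr rfl fun j _ => by ring
lemma qf_symm (S : Dat d) (t : ℝ) (x y : Eucl (d + 1)) : qf (S.Q t) x y = qf (S.Q t) y x := by
  simp only [qf, trQ_rank1]
  rw [Finset.sum_comm]
  refine Finset.sum_congr rfl fun i _ => Finset.sum_congr rfl fun j _ => by rw [S.symm t j i]; ring
lemma inner_last (x : Eucl (d + 1)) : innerSL ℝ (ee (Fin.last d)) x = lastC x := by
  simp [lastC, ee, EuclideanSpace.inner_single_left]
lemma corner_vec (S : Dat d) (t : ℝ) {x0 : Eucl (d + 1)} (hx0 : ‖x0‖ = 1) (hn : lastC x0 = 0) :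
    ∃ s σ : ℝ, 0 < σ ∧ qf (S.Q t) (-x0 + s • ee (Fin.last d)) (-x0 + s • ee (Fin.last d)) =
        qf (S.Q t) (σ • ee (Fin.last d)) (σ • ee (Fin.last d)) ∧
      qf (S.Q t) (-x0 + s • ee (Fin.last d)) (σ • ee (Fin.last d)) = 0 := by
  have hL := S.Λ_pos
  set e := ee (Fin.last d) with he
  have he1 : ‖e‖ = 1 := by simp [he, ee]
  have h22 : 0 < qf (S.Q t) e e := by
    have := trQ_ell S t e
    rw [he1] at this
    exact lt_of_lt_of_le (by positivity) this
  set s := qf (S.Q t) x0 e / qf (S.Q t) e e with hs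
  have hpp : 0 < qf (S.Q t) (-x0 + s • e) (-x0 + s • e) := by
    have := trQ_ell S t (-x0 + s • e)
    refine lt_of_lt_of_le ?_ this
    have : -x0 + s • e ≠ 0 := by
      intro h
      have h1 : innerSL ℝ x0 (-x0 + s • e) = 0 := by rw [h, map_zero]
      have h2 : innerSL ℝ x0 e = lastC x0 := inner_ee x0 _
      rw [map_add, map_neg, map_smul, h2, hn, innerSL_apply_apply, real_inner_self_eq_norm_sq, hx0] at h1
      norm_num at h1
    have := norm_pos_iff.2 this
    positivity
  refine ⟨s, √(qf (S.Q t) (-x0 + s • e) (-x0 + s • e) / qf (S.Q t) e e), by positivity, ?_, ?_⟩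
  · rw [qf_smul_left _ _ e, qf_smul_right _ _ e, ← mul_assoc, Real.mul_self_sqrt (by positivity)]
    field_simp
  · rw [qf_smul_right _ _ e, qf_add_left _ _ _ e, qf_smul_left _ _ e]
    have : qf (S.Q t) (-x0) e = - qf (S.Q t) x0 e := by
      rw [← neg_one_smul ℝ x0, qf_smul_left]; ring
    rw [this, hs]; field_simp; ring
lemma cre_nonneg {κ : ℝ} (hκ : 0 < κ) (hκ1 : κ ≤ 1) {z : ℂ} (hz : 0 ≤ z.im) :
    0 ≤ (((κ : ℂ) + Complex.I) * z ^ ((κ / 8 : ℝ) : ℂ)).re := by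
  have hr : (((κ : ℂ) + Complex.I) * z ^ ((κ / 8 : ℝ) : ℂ)).re =
      ‖z‖ ^ (κ / 8) * (κ * Real.cos (z.arg * (κ / 8)) - Real.sin (z.arg * (κ / 8))) := by
    rw [Complex.mul_re, Complex.cpow_ofReal_re, Complex.cpow_ofReal_im]
    simp; ring
  rw [hr]
  have h0 : 0 ≤ z.arg := Complex.arg_nonneg_iff.2 hz
  have h1 : z.arg ≤ 4 := (Complex.arg_le_pi z).trans Real.pi_le_four
  set a := z.arg * (κ / 8) with ha
  have ha0 : 0 ≤ a := by positivity
  have ha1 : a ≤ κ / 2 := by rw [ha]; nlinarith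
  have h2 := Real.sin_le ha0
  have h3 := Real.one_sub_sq_div_two_le_cos (x := a)
  have h4 : 1 / 2 ≤ Real.cos a := by nlinarith
  have h5 : κ * (1 / 2) ≤ κ * Real.cos a := mul_le_mul_of_nonneg_left h4 hκ.le
  exact mul_nonneg (by positivity) (by linarith)
lemma cpow_derivs (c : ℂ) (γ : ℝ) {a : ℂ} (ha : a ∈ Complex.slitPlane) :
    (∀ᶠ ζ in 𝓝 a, HasDerivAt (fun z : ℂ => c * z ^ (γ : ℂ)) (c * γ * ζ ^ ((γ - 1 : ℝ) : ℂ)) ζ) ∧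
    HasDerivAt (fun ζ : ℂ => c * γ * ζ ^ ((γ - 1 : ℝ) : ℂ))
      (c * γ * ((γ - 1 : ℝ) : ℂ) * a ^ ((γ - 2 : ℝ) : ℂ)) a := by
  constructor
  · filter_upwards [Complex.isOpen_slitPlane.mem_nhds ha] with ζ hζ
    have h := ((hasDerivAt_id ζ).cpow_const (c := (γ : ℂ)) hζ).const_mul c
    exact h.congr_deriv (by simp; ring)
  · have h := ((hasDerivAt_id a).cpow_const (c := ((γ - 1 : ℝ) : ℂ)) ha).const_mul (c * γ)
    refine h.congr_deriv ?_
    have : ((γ - 1 : ℝ) : ℂ) - 1 = ((γ - 2 : ℝ) : ℂ) := by push_cast; ring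
    rw [this]; simp; ring
lemma rpow_T2 (γ : ℝ) {w : ℝ} (hw : 0 < w) :
    T2 (fun s : ℝ => s ^ γ) w (γ * w ^ (γ - 1)) (γ * ((γ - 1) * w ^ (γ - 2))) := by
  refine T2_of_deriv (F1 := fun s => γ * s ^ (γ - 1)) ?_ ?_
  · filter_upwards [lt_mem_nhds hw] with s hs
    exact Real.hasDerivAt_rpow_const (Or.inl hs.ne')
  · have := (Real.hasDerivAt_rpow_const (x := w) (p := γ - 1) (Or.inl hw.ne')).const_mul γ
    rwa [show γ - 1 - 1 = γ - 2 by ring] at this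
lemma cpow_re_cont (c : ℂ) {γ : ℝ} (hγ : 0 < γ) {a : ℂ} (ha : a ∈ Complex.slitPlane ∨ a = 0) :
    ContinuousAt (fun z : ℂ => (c * z ^ (γ : ℂ)).re) a := by
  have : ContinuousAt (fun z : ℂ => z ^ (γ : ℂ)) a := by
    rcases ha with h | rfl
    · exact continuousAt_cpow_const h
    · have := Complex.continuousAt_cpow_zero_of_re_pos (z := (γ : ℂ)) (by simpa using hγ)
      exact ContinuousAt.comp (f := fun z : ℂ => (z, (γ : ℂ))) (x := 0) this (by fun_prop)
  exact Complex.continuous_re.continuousAt.comp (continuousAt_const.mul this)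
lemma corner_pde {κ γ ε Λ δ C2 w : ℝ} {z : ℂ} {m1 m2 qN : ℝ} (hκ : 0 < κ) (hκ1 : κ ≤ 1) (hγ : 0 < γ)
    (hγ1 : γ ≤ 1 / 8) (hε : 0 < ε) (hΛ : 0 < Λ) (hC2 : 1 ≤ C2) (hw : 0 < w) (hw3 : w ≤ 3)
    (hwz : w ≤ C2 * ‖z‖) (hδ : δ = ε / (2 * C2 ^ 2 * Λ)) (hm : |m1| + |m2| ≤ δ) (hq : 2 * Λ⁻¹ ≤ qN)
    {g2 : ℂ} (hg : g2 = ((κ : ℂ) + Complex.I) * γ * ((γ - 1 : ℝ) : ℂ) * z ^ ((γ - 2 : ℝ) : ℂ)) :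
    g2.re * m1 - g2.im * m2 + ε * (γ * ((γ - 1) * w ^ (γ - 2)) * qN) ≤
      - (γ * (1 - γ) * ε / (9 * Λ)) := by
  have hz : 0 < ‖z‖ := by
    by_contra h
    have : ‖z‖ = 0 := le_antisymm (not_lt.1 h) (norm_nonneg _)
    rw [this] at hwz; linarith
  have hc : ‖(κ : ℂ) + Complex.I‖ ≤ 2 := by
    refine (norm_add_le _ _).trans ?_
    rw [Complex.norm_I, Complex.norm_real, Real.norm_of_nonneg hκ.le]; linarith
  have hzn : ‖z‖ ^ (γ - 2) ≤ C2 ^ 2 * w ^ (γ - 2) := by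
    have h1 : (C2 * ‖z‖) ^ (γ - 2) ≤ w ^ (γ - 2) := Real.rpow_le_rpow_of_nonpos hw hwz (by linarith)
    rw [Real.mul_rpow (by positivity) hz.le] at h1
    have h2 : C2 ^ (-2 : ℝ) ≤ C2 ^ (γ - 2) := Real.rpow_le_rpow_of_exponent_le hC2 (by linarith)
    rw [Real.rpow_neg (by positivity), Real.rpow_two] at h2
    have h3 : (C2 ^ 2)⁻¹ * ‖z‖ ^ (γ - 2) ≤ w ^ (γ - 2) :=
      le_trans (mul_le_mul_of_nonneg_right h2 (by positivity)) h1
    rwa [inv_mul_le_iff₀ (by positivity)] at h3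
  have hg2 : ‖g2‖ ≤ 2 * (γ * (1 - γ)) * (C2 ^ 2 * w ^ (γ - 2)) := by
    rw [hg, norm_mul, norm_mul, norm_mul, Complex.norm_cpow_real, Complex.norm_real, Complex.norm_real,
      Real.norm_of_nonneg hγ.le, Real.norm_of_nonpos (by linarith : γ - 1 ≤ 0), mul_assoc ‖_‖]
    have : γ * -(γ - 1) = γ * (1 - γ) := by ring
    rw [this]
    have : 0 ≤ γ * (1 - γ) := mul_nonneg hγ.le (by linarith)
    gcongr
  have hlow : (1 : ℝ) / 9 ≤ w ^ (γ - 2) := by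
    have h1 : (3 : ℝ) ^ (γ - 2) ≤ w ^ (γ - 2) := Real.rpow_le_rpow_of_nonpos hw hw3 (by linarith)
    have h2 : (3 : ℝ) ^ (-2 : ℝ) ≤ 3 ^ (γ - 2) :=
      Real.rpow_le_rpow_of_exponent_le (by norm_num) (by linarith)
    rw [Real.rpow_neg (by positivity), Real.rpow_two] at h2
    norm_num at h2 ⊢; linarith
  have h1 : g2.re * m1 - g2.im * m2 ≤ ‖g2‖ * δ := by
    have e1 : g2.re * m1 ≤ ‖g2‖ * |m1| := by
      refine (le_abs_self _).trans ?_
      rw [abs_mul]; gcongr; exact Complex.abs_re_le_norm _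
    have e2 : -(g2.im * m2) ≤ ‖g2‖ * |m2| := by
      refine (neg_le_abs _).trans ?_
      rw [abs_mul]; gcongr; exact Complex.abs_im_le_norm _
    have e3 : ‖g2‖ * (|m1| + |m2|) ≤ ‖g2‖ * δ := by gcongr
    linarith
  have hδ0 : 0 < δ := by rw [hδ]; positivity
  have h2 : ‖g2‖ * δ ≤ γ * (1 - γ) * w ^ (γ - 2) * (ε / Λ) := by
    refine (mul_le_mul_of_nonneg_right hg2 hδ0.le).trans (le_of_eq ?_)
    rw [hδ]; field_simp
  have hG : 0 < γ * (1 - γ) := mul_pos hγ (by linarith)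
  have hW : 0 < w ^ (γ - 2) := by positivity
  have h3 : γ * (1 - γ) * w ^ (γ - 2) * ε * (2 * Λ⁻¹) ≤ γ * (1 - γ) * w ^ (γ - 2) * ε * qN := by
    gcongr
  have h4 : γ * (1 - γ) * (ε / Λ) * (1 / 9) ≤ γ * (1 - γ) * (ε / Λ) * w ^ (γ - 2) := by
    have : 0 < ε / Λ := by positivity
    gcongr
  have h5 : γ * (1 - γ) * ε / (9 * Λ) = γ * (1 - γ) * (ε / Λ) * (1 / 9) := by field_simp
  have h6 : γ * (1 - γ) * w ^ (γ - 2) * ε * (2 * Λ⁻¹) = 2 * (γ * (1 - γ) * w ^ (γ - 2) * (ε / Λ)) := by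
    field_simp
  rw [h5]
  nlinarith
set_option maxHeartbeats 2000000 in
lemma corner_f (S : Dat d) (t0 : ℝ) {x0 : Eucl (d + 1)} (hx0 : ‖x0‖ = 1) (hn : lastC x0 = 0) :
    ∃ f : Eucl (d + 1) → ℝ, (∀ x, ‖x‖ ≤ 1 → 0 ≤ lastC x → ContinuousAt f x) ∧ f x0 = 0 ∧
      (∀ x, ‖x‖ ≤ 1 → 0 ≤ lastC x → x ≠ x0 → 0 < f x) ∧ ∃ τ > 0, ∃ c' > 0,
      ∀ (s : Set (SpaceTime (d + 1))) (w : SpaceTime (d + 1)), ‖w.1‖ ≤ 1 → 0 ≤ lastC w.1 → w.1 ≠ x0 →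
        |w.2 - t0| < τ → ∃ p X, JetW s (fun w => f w.1) w 0 p X ∧ trQ (S.Q w.2) X ≤ - c' ∧
          (lastC w.1 = 0 → p (S.v w.2) ≤ - c') := by
  obtain ⟨sl, σ, hσ, hq1, hq2⟩ := corner_vec S t0 hx0 hn
  have hL := S.Λ_pos
  have hM : 0 < S.M := lt_of_lt_of_le one_pos S.M_pos
  set e := ee (Fin.last d) with he
  have he1 : ‖e‖ = 1 := by simp [he, ee]
  have hx0e : innerSL ℝ x0 e = 0 := by rw [← hn]; exact inner_ee x0 _
  set xP := -x0 + sl • e with hxP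
  set xR := σ • e with hxR
  set xN := -x0 + e with hxN
  set P := innerSL ℝ xP with hP
  set R := innerSL ℝ xR with hR
  set N := innerSL ℝ xN with hN
  have hPa : ∀ x, P x = - innerSL ℝ x0 x + sl * lastC x := by
    intro x
    rw [hP, hxP, map_add, map_neg, map_smul, ← inner_last x]; rfl
  have hRa : ∀ x, R x = σ * lastC x := by
    intro x
    rw [hR, hxR, map_smul, ← inner_last x]; rfl
  have hNa : ∀ x, N x = - innerSL ℝ x0 x + lastC x := by
    intro x
    rw [hN, hxN, map_add, map_neg, ← inner_last x]; rfl
  have hNn : ‖xN‖ ^ 2 = 2 := by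
    have := norm_add_sq_real (-x0) e
    rw [norm_neg, hx0, he1, inner_neg_left] at this
    rw [innerSL_apply_apply] at hx0e
    rw [hxN, this, hx0e]; norm_num
  set κ := min 1 (σ / (4 * S.M ^ 2 * (1 + |sl|))) with hκ
  have hκ0 : 0 < κ := lt_min one_pos (by positivity)
  have hκ1 : κ ≤ 1 := min_le_left _ _
  have hκ2 : κ * (S.M * (1 + |sl|)) ≤ σ / (4 * S.M) := by
    have : κ ≤ σ / (4 * S.M ^ 2 * (1 + |sl|)) := min_le_right _ _
    calc κ * (S.M * (1 + |sl|)) ≤ σ / (4 * S.M ^ 2 * (1 + |sl|)) * (S.M * (1 + |sl|)) := by gcongr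
      _ = _ := by field_simp
  set ε := σ / (8 * S.M ^ 2) with hε
  have hε0 : 0 < ε := by positivity
  set γ := κ / 8 with hγ
  have hγ0 : 0 < γ := by positivity
  have hγ1 : γ ≤ 1 / 8 := by rw [hγ]; linarith
  set C2 := 1 + (1 + |sl|) / σ with hC2
  have hC21 : 1 ≤ C2 := by rw [hC2]; have : 0 ≤ (1 + |sl|) / σ := by positivity
                           linarith
  set c : ℂ := (κ : ℂ) + Complex.I with hc
  set zz : Eucl (d + 1) → ℂ := fun x => 1 + P x + Complex.I * R x with hzz
  have hzre : ∀ x, (zz x).re = 1 + P x := by intro x; simp [hzz]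
  have hzim : ∀ x, (zz x).im = R x := by intro x; simp [hzz]
  have hr0 : ∀ x, ‖x‖ ≤ 1 → 0 ≤ 1 - innerSL ℝ x0 x := fun x hx =>
    le_trans (by positivity) (r_lower hx hx0)
  have hw0 : ∀ x, ‖x‖ ≤ 1 → 0 ≤ lastC x → x ≠ x0 → 0 < 1 + N x := by
    intro x hx hl hne
    have h1 := r_lower hx hx0
    have h2 := norm_pos_iff.2 (sub_ne_zero.2 hne)
    have h3 : 0 < ‖x - x0‖ ^ 2 / 2 := by positivity
    rw [hNa]; linarith
  have hzs : ∀ x, ‖x‖ ≤ 1 → 0 ≤ lastC x → x ≠ x0 → zz x ∈ Complex.slitPlane := by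
    intro x hx hl hne
    rw [Complex.mem_slitPlane_iff, hzre, hzim, hRa]
    rcases hl.lt_or_eq with h | h
    · right; positivity
    · left
      have := hw0 x hx hl hne
      rw [hNa, ← h] at this; rw [hPa, ← h]; simpa using this
  have hz0 : zz x0 = 0 := by
    have h1 : innerSL ℝ x0 x0 = 1 := by rw [innerSL_apply_apply, real_inner_self_eq_norm_sq, hx0]; norm_num
    apply Complex.ext
    · rw [hzre, hPa, hn, h1]; simp
    · rw [hzim, hRa, hn]; simp
  have hN0 : 1 + N x0 = 0 := by
    have h1 : innerSL ℝ x0 x0 = 1 := by rw [innerSL_apply_apply, real_inner_self_eq_norm_sq, hx0]; norm_num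
    rw [hNa, hn, h1]; simp
  have hw3 : ∀ x, ‖x‖ ≤ 1 → 1 + N x ≤ 3 := by
    intro x hx
    have h1 := r_upper hx hx0
    have h2 := (abs_le.1 (abs_lastC_le x)).2
    rw [hNa]; linarith
  have hwz : ∀ x, ‖x‖ ≤ 1 → 0 ≤ lastC x → 1 + N x ≤ C2 * ‖zz x‖ := by
    intro x hx hl
    have h1 := (abs_le.1 (Complex.abs_re_le_norm (zz x))).2
    have h2 := (abs_le.1 (Complex.abs_im_le_norm (zz x))).2
    rw [hzre, hPa] at h1
    rw [hzim, hRa] at h2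
    have h3 : lastC x ≤ ‖zz x‖ / σ := by rw [le_div_iff₀ hσ]; linarith
    have h4 : -sl * lastC x ≤ |sl| * lastC x := mul_le_mul_of_nonneg_right (neg_le_abs _) hl
    have h5 : (1 + |sl|) * lastC x ≤ (1 + |sl|) * (‖zz x‖ / σ) := by gcongr
    have h6 : C2 * ‖zz x‖ = ‖zz x‖ + (1 + |sl|) * (‖zz x‖ / σ) := by rw [hC2]; ring
    rw [h6, hNa]; linarith
  set δ := ε / (2 * C2 ^ 2 * S.Λ) with hδ
  have hδ0 : 0 < δ := by positivity
  set m1 : ℝ → ℝ := fun t => trQ (S.Q t) (P.smulRight P - R.smulRight R) with hm1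
  set m2 : ℝ → ℝ := fun t => trQ (S.Q t) (P.smulRight R + R.smulRight P) with hm2
  obtain ⟨τ, hτ, hτm⟩ : ∃ τ > 0, ∀ t, |t - t0| < τ → |m1 t| + |m2 t| < δ := by
    have hcm : Continuous fun t => |m1 t| + |m2 t| :=
      (trQ_cont S _).abs.add (trQ_cont S _).abs
    have hz : |m1 t0| + |m2 t0| < δ := by
      have e1 : m1 t0 = 0 := by
        simp only [hm1]; rw [trQ_sub]; exact sub_eq_zero.2 hq1
      have e2 : m2 t0 = 0 := by
        simp only [hm2]; rw [trQ_add]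
        have := qf_symm S t0 xR xP
        change qf (S.Q t0) xP xR + qf (S.Q t0) xR xP = 0
        rw [this, hq2]; norm_num
      rw [e1, e2]; simpa using hδ0
    obtain ⟨τ, hτ, h⟩ := Metric.eventually_nhds_iff.1 (hcm.continuousAt.eventually_lt continuousAt_const hz)
    exact ⟨τ, hτ, fun t ht => h (by rwa [Real.dist_eq])⟩
  set f : Eucl (d + 1) → ℝ := fun x => (c * zz x ^ (γ : ℂ)).re + ε * (1 + N x) ^ γ with hf
  refine ⟨f, ?_, ?_, ?_, τ, hτ, min (γ * (1 - γ) * ε / (9 * S.Λ)) (γ * σ / (6 * S.M)), ?_, ?_⟩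
  · intro x hx hl
    have h1 : ContinuousAt (fun x => (c * zz x ^ (γ : ℂ)).re) x := by
      refine ContinuousAt.comp (f := zz) (cpow_re_cont c hγ0 ?_) ?_
      · by_cases h : x = x0
        · right; rw [h, hz0]
        · left; exact hzs x hx hl h
      · rw [hzz]; fun_prop
    have h2 : ContinuousAt (fun x => (1 + N x) ^ γ) x :=
      ContinuousAt.rpow_const (by fun_prop) (Or.inr hγ0.le)
    exact h1.add (continuousAt_const.mul h2)
  · simp only [hf]
    rw [hz0, hN0, Real.zero_rpow hγ0.ne', Complex.zero_cpow (by exact_mod_cast hγ0.ne')]; simp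
  · intro x hx hl hne
    have h1 : 0 ≤ (c * zz x ^ (γ : ℂ)).re :=
      cre_nonneg hκ0 hκ1 (by rw [hzim, hRa]; positivity)
    have h2 := hw0 x hx hl hne
    simp only [hf]
    positivity
  · have : 0 < 1 - γ := by linarith
    exact lt_min (by positivity) (by positivity)
  · intro s w hx hl hne ht
    have hwp := hw0 _ hx hl hne
    obtain ⟨hd1, hd2⟩ := cpow_derivs c γ (hzs _ hx hl hne)
    have hj1 := cjet (s := s) (z := w) (k := 1) P R (a := zz w.1) rfl hd1 hd2
    have hj2 := (((JetW.lin (s := s) (z := w) N).add_const 1).comp (F := fun s => s ^ γ)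
      (rpow_T2 γ (by rw [add_comm]; exact hwp))).smul ε
    have hj := (hj1.add hj2)
    have key := hj.congr (ψ := fun w => f w.1) (by simp only [hf, hzz]; rw [add_comm (N w.1) 1])
      (Eventually.of_forall fun y => by simp only [hf, hzz]; rw [add_comm (N y.1) 1])
    have ha : (0 : ℝ) + ε * (γ * (N w.1 + 1) ^ (γ - 1) * 0) = 0 := by ring
    rw [ha] at key
    refine ⟨_, _, key, ?_, ?_⟩
    · rw [trQ_add, trQ_smul, trQ_add, trQ_smul, trQ_smul, trQ_zero, trQ_sub, trQ_smul, trQ_smul]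
      refine le_trans ?_ (neg_le_neg (min_le_left _ _))
      have hqN : 2 * S.Λ⁻¹ ≤ trQ (S.Q w.2) (N.smulRight N) := by
        have := trQ_ell S w.2 xN
        rw [hNn] at this; linarith
      have := corner_pde (z := zz w.1) hκ0 hκ1 hγ0 hγ1 hε0 hL hC21 hwp (hw3 _ hx) (hwz _ hx hl) hδ
        (hτm _ ht).le hqN rfl
      rw [add_comm (1 : ℝ)] at this
      rw [mul_zero, zero_add]
      exact this
    · intro hl0
      refine le_trans ?_ (neg_le_neg (min_le_right _ _))
      set r := 1 + N w.1 with hr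
      have hza : zz w.1 = (r : ℂ) := by
        apply Complex.ext
        · rw [hzre, hPa, hr, hNa, hl0]; simp
        · rw [hzim, hRa, hl0]; simp
      set W := r ^ (γ - 1) with hW
      have hWp : 0 < W := by positivity
      have hg1 : c * γ * (zz w.1) ^ ((γ - 1 : ℝ) : ℂ) = ((γ * W * κ : ℝ) : ℂ) + ((γ * W : ℝ) : ℂ) * Complex.I := by
        rw [hza, ← Complex.ofReal_cpow hwp.le, hc, ← hW]; push_cast; ring
      have hre : (c * γ * (zz w.1) ^ ((γ - 1 : ℝ) : ℂ)).re = γ * W * κ := by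
        rw [hg1]; simp [-Complex.ofReal_mul]
      have him : (c * γ * (zz w.1) ^ ((γ - 1 : ℝ) : ℂ)).im = γ * W := by
        rw [hg1]; simp [-Complex.ofReal_mul]
      have hval : ((c * γ * (zz w.1) ^ ((γ - 1 : ℝ) : ℂ)).re • P - (c * γ * (zz w.1) ^ ((γ - 1 : ℝ) : ℂ)).im • R
          + ε • (γ * (N w.1 + 1) ^ (γ - 1)) • N) (S.v w.2) =
          γ * W * (κ * P (S.v w.2) - R (S.v w.2) + ε * N (S.v w.2)) := by
        rw [hre, him, add_comm (N w.1) 1, ← hr, ← hW]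
        simp only [ContinuousLinearMap.add_apply, ContinuousLinearMap.sub_apply,
          ContinuousLinearMap.smul_apply, smul_eq_mul]
        ring
      refine hval.trans_le ?_
      have hv1 : |innerSL ℝ x0 (S.v w.2)| ≤ S.M := by
        refine (abs_real_inner_le_norm x0 _).trans ?_
        rw [hx0, one_mul]; exact S.vb _
      have hv2 : |lastC (S.v w.2)| ≤ S.M := (abs_lastC_le _).trans (S.vb _)
      have hv3 := S.vlast w.2
      have hPv : P (S.v w.2) ≤ S.M * (1 + |sl|) := by
        rw [hPa]
        have : sl * lastC (S.v w.2) ≤ |sl| * S.M := by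
          refine (le_abs_self _).trans ?_
          rw [abs_mul]; gcongr
        linarith [(abs_le.1 hv1).1]
      have hNv : N (S.v w.2) ≤ 2 * S.M := by
        rw [hNa]; linarith [(abs_le.1 hv1).1, (abs_le.1 hv2).2]
      have hRv : σ / S.M ≤ R (S.v w.2) := by
        rw [hRa, div_eq_mul_inv]; gcongr
      have hin : κ * P (S.v w.2) - R (S.v w.2) + ε * N (S.v w.2) ≤ - (σ / (2 * S.M)) := by
        have h1 : κ * P (S.v w.2) ≤ κ * (S.M * (1 + |sl|)) := by gcongr
        have h2 : ε * N (S.v w.2) ≤ ε * (2 * S.M) := by gcongr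
        have h3 : ε * (2 * S.M) = σ / (4 * S.M) := by rw [hε]; field_simp; norm_num
        have h4 : σ / S.M = 2 * (σ / (4 * S.M)) + σ / (2 * S.M) := by field_simp; norm_num
        linarith
      have hW3 : 1 / 3 ≤ W := by
        have h1 : (3 : ℝ) ^ (γ - 1) ≤ W := Real.rpow_le_rpow_of_nonpos hwp (hw3 _ hx) (by linarith)
        have h2 : (3 : ℝ) ^ (-1 : ℝ) ≤ 3 ^ (γ - 1) :=
          Real.rpow_le_rpow_of_exponent_le (by norm_num) (by linarith)
        rw [Real.rpow_neg_one] at h2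
        norm_num at h2 ⊢; linarith
      have h1 : γ * W * (κ * P (S.v w.2) - R (S.v w.2) + ε * N (S.v w.2)) ≤ γ * W * (- (σ / (2 * S.M))) := by
        gcongr
      have h2 : γ * (1 / 3) * (σ / (2 * S.M)) ≤ γ * W * (σ / (2 * S.M)) := by gcongr
      have h3 : γ * (1 / 3) * (σ / (2 * S.M)) = γ * σ / (6 * S.M) := by field_simp; norm_num
      linarith
lemma bar_corner (S : Dat d) {p0 : SpaceTime (d + 1)} (hp : p0 ∈ DD d) (hx0 : ‖p0.1‖ = 1)
    (hn : lastC p0.1 = 0) : ∃ b θ, Barrier S p0 b θ := by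
  have hl := S.lam_pos
  obtain ⟨f, hfc, hf0, hfp, τ, hτ, c', hc', hj⟩ := corner_f S p0.2 hx0 hn
  set A := 2 * (S.lam + 1) / c' with hA
  have hAp : 0 < A := by positivity
  have hAc : A * c' = 2 * (S.lam + 1) := by rw [hA]; field_simp
  have hfn : ∀ w ∈ DD d, 0 ≤ f w.1 := by
    intro w hw
    by_cases h : w.1 = p0.1
    · rw [h, hf0]
    · exact (hfp _ hw.1 hw.2.1 h).le
  refine ⟨fun w => A * f w.1 + (w.2 - p0.2) ^ 2, τ ^ 2, ?_, ?_, ?_, by positivity, ?_⟩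
  · intro w hw
    have h1 : ContinuousAt (fun w : SpaceTime (d + 1) => f w.1) w :=
      ContinuousAt.comp (f := Prod.fst) (hfc _ hw.1 hw.2.1) continuousAt_fst
    have h2 : ContinuousAt (fun w : SpaceTime (d + 1) => (w.2 - p0.2) ^ 2) w := by fun_prop
    exact ((continuousAt_const.mul h1).add h2).continuousWithinAt
  · simp [hf0]
  · intro w hw hne
    have h0 := mul_nonneg hAp.le (hfn w hw)
    by_cases h : w.1 = p0.1
    · have : w.2 - p0.2 ≠ 0 := sub_ne_zero.2 fun h' => hne (Prod.ext h h')
      positivity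
    · have := hfp _ hw.1 hw.2.1 h
      positivity
  · intro w hw hwb hlt
    have hne : w.1 ≠ p0.1 := fun h => hwb ⟨hw, Or.inl (by rw [h, hx0])⟩
    have ht : |w.2 - p0.2| < τ := by
      refine abs_lt_of_sq_lt_sq ?_ hτ.le
      have := mul_nonneg hAp.le (hfn w hw)
      linarith
    obtain ⟨p, X, hjet, hX, hpv⟩ := hj (DD d ∩ past w) w hw.1 hw.2.1 hne ht
    have h2 : -1 ≤ w.2 - p0.2 := by linarith [hw.2.2.1, hp.2.2.2]
    refine ⟨_, _, _, (hjet.smul A).add (sq_time_jet p0.2), fun h => ?_, fun h => ?_⟩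
    · rw [trQ_add, trQ_zero, trQ_smul]
      have h3 := mul_le_mul_of_nonneg_left hX hAp.le
      nlinarith
    · have h3 := mul_le_mul_of_nonneg_left (hpv h.2.1) hAp.le
      show A * p (S.v w.2) + 0 ≤ _
      nlinarith
lemma bar_exists (S : Dat d) {p0 : SpaceTime (d + 1)} (hp : p0 ∈ bd d) : ∃ b θ, Barrier S p0 b θ := by
  by_cases ht : p0.2 = -1
  · exact bar_bottom S hp.1 ht
  · have h1 : ‖p0.1‖ = 1 := hp.2.resolve_right ht
    rcases hp.1.2.1.lt_or_eq with h | h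
    · exact bar_lateral S hp.1 h1 h
    · exact bar_corner S hp.1 h1 h.symm
lemma bd_compact : IsCompact (bd d) := by
  have h : bd d = DD d ∩ {p | ‖p.1‖ = 1 ∨ p.2 = -1} := rfl
  rw [h]
  refine DD_compact.inter_right ?_
  exact (isClosed_eq (by fun_prop) continuous_const).union (isClosed_eq (by fun_prop) continuous_const)
lemma solve (S : Dat d) {ψ : SpaceTime (d + 1) → ℝ} (hψ : ContinuousOn ψ (bd d)) :
    ∃ u, ContinuousOn u (DD d) ∧ Sub S u ∧ Sub S (fun w => -u w) ∧ ∀ w ∈ bd d, u w = ψ w := by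
  obtain ⟨m, hm⟩ := bd_compact.exists_bound_of_continuousOn hψ
  have hm' : ∀ w ∈ bd d, |ψ w| ≤ m := fun w hw => hm w hw
  refine perron S hm' ?_ ?_
  · intro p hp ε hε
    obtain ⟨b, θ, hb⟩ := bar_exists S hp
    obtain ⟨g, h1, h2, h3, h4, h5⟩ := hb.use hp hψ hm' hε
    exact ⟨g, h1, h2, h3, h5⟩
  · intro p hp ε hε
    obtain ⟨b, θ, hb⟩ := bar_exists S hp
    obtain ⟨g, h1, h2, h3, h4, h5⟩ := hb.use (ψ := fun w => - ψ w) hp hψ.neg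
      (fun w hw => by rw [abs_neg]; exact hm' w hw) hε
    refine ⟨fun w => - g w, h1.neg, h2, fun w hw => ?_, fun w hw => ?_, ?_⟩
    · linarith [h3 w hw]
    · linarith [h4 w hw]
    · linarith
end
end Obl

/-- **Existence and uniqueness for the Dirichlet problem.** For every `ψ` continuous on
`∂_bK₁` there is a unique viscosity solution `η` of the linearized oblique problem on
`K₁⁺`, continuous on `K̄₁`, with `η = ψ` on `∂_bK₁`. -/
theorem dirichlet_existence (d : ℕ) (hd : 1 ≤ d) (lam Λ M C₀ : ℝ)
    (Q Q' : ℝ → Matrix (Fin (d + 1)) (Fin (d + 1)) ℝ) (v v' : ℝ → Eucl (d + 1))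
    (hdata : ObliqueData d lam Λ M C₀ Q Q' v v')
    (ψ : SpaceTime (d + 1) → ℝ) (hψ : ContinuousOn ψ (bdryK d)) :
    ∃ η : SpaceTime (d + 1) → ℝ,
      (ContinuousOn η (closure (Kc d 1)) ∧ ObliqueSolution d lam Q v η ∧
        EqOn η ψ (bdryK d)) ∧
      ∀ η₂ : SpaceTime (d + 1) → ℝ,
        (ContinuousOn η₂ (closure (Kc d 1)) ∧ ObliqueSolution d lam Q v η₂ ∧
          EqOn η₂ ψ (bdryK d)) →
        EqOn η η₂ (closure (Kc d 1)) := by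
  obtain ⟨S, hA⟩ := Obl.exists_dat hdata
  rw [Obl.bdryK_eq] at hψ ⊢
  rw [Obl.closure_Kc]
  obtain ⟨η, hc, h1, h2, hb⟩ := Obl.solve S hψ
  refine ⟨η, ⟨hc, ⟨Obl.oblique_of_sub hA hc h1, Obl.obliqueSup_of_sub hA hc h2⟩, hb⟩, ?_⟩
  rintro η₂ ⟨hc2, ⟨h3, h4⟩, hb2⟩
  have h3' := Obl.sub_of_oblique hA h3
  have h4' := Obl.sub_of_obliqueSup hA h4
  obtain ⟨m1, hm1⟩ := Obl.DD_compact.exists_bound_of_continuousOn hc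
  obtain ⟨m2, hm2⟩ := Obl.DD_compact.exists_bound_of_continuousOn hc2
  have e1 : ∀ w ∈ Obl.DD d, |η w| ≤ max m1 m2 := fun w hw => (hm1 w hw).trans (le_max_left _ _)
  have e2 : ∀ w ∈ Obl.DD d, |η₂ w| ≤ max m1 m2 := fun w hw => (hm2 w hw).trans (le_max_right _ _)
  have k1 := Obl.comparison S h1 h4' hc.upperSemicontinuousOn hc2.neg.upperSemicontinuousOn e1
    (fun w hw => by rw [abs_neg]; exact e2 w hw) (fun w hw => by rw [hb w hw, hb2 hw]; linarith)
  have k2 := Obl.comparison S h3' h2 hc2.upperSemicontinuousOn hc.neg.upperSemicontinuousOn e2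
    (fun w hw => by rw [abs_neg]; exact e1 w hw) (fun w hw => by rw [hb w hw, hb2 hw]; linarith)
  intro w hw
  have a1 := k1 w hw
  have a2 := k2 w hw
  show η w = η₂ w
  linarith
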